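/- Let Y ⊆ ℝ^d be a Borel set with dim_H Y ∈ (k−1, k] for some k ∈ {1,…,d−1}, and let X ⊆ ℝ^d be a Borel set with dim_H X > k. Then sup over x ∈ X of dim_H π_x(Y \ {x}) equals dim_H Y. -/

import Mathlib

open Metric MeasureTheory Set
open scoped ENNReal NNReal RealInnerProductSpace

noncomputable section

abbrev E2 := EuclideanSpace ℝ (Fin 2)

/-- Radial projection `π_x(y) = (y-x)/|y-x|`. -/
def radProj {E : Type*} [NormedAddCommGroup E] [NormedSpace ℝ E] (x y : E) : E :=
  ‖y - x‖⁻¹ • (y - x)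

/-- A subset of a real vector space is an affine line. -/
def IsAffineLine {E : Type*} [AddCommGroup E] [Module ℝ E] (ℓ : Set E) : Prop :=
  ∃ a v : E, v ≠ 0 ∧ ℓ = {p | ∃ t : ℝ, p = a + t • v}

/-- The (topological) support of a measure. -/
def msupport {E : Type*} [PseudoMetricSpace E] [MeasurableSpace E] (μ : Measure E) : Set E :=
  {x | ∀ r : ℝ, 0 < r → 0 < μ (ball x r)}

/-- `(μ,ν)` has `(t,K,c)`-thin tubes. -/
def ThinTubesWith (μ ν : Measure E2) (t K c : ℝ) : Prop :=
  ∃ G : Set (E2 × E2), MeasurableSet G ∧ G ⊆ (msupport μ) ×ˢ (msupport ν) ∧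
    ENNReal.ofReal c ≤ (μ.prod ν) G ∧
    ∀ x ∈ msupport μ, ∀ r : ℝ, 0 < r → ∀ ℓ : Set E2, IsAffineLine ℓ →
      x ∈ cthickening r ℓ →
      ν (cthickening r ℓ ∩ {y | (x, y) ∈ G}) ≤ ENNReal.ofReal (K * r ^ t)

/-- `(μ,ν)` has `t`-thin tubes. -/
def ThinTubes (μ ν : Measure E2) (t : ℝ) : Prop :=
  ∃ K c : ℝ, 0 < K ∧ 0 < c ∧ ThinTubesWith μ ν t K c

abbrev Ed (d : ℕ) := EuclideanSpace ℝ (Fin d)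

/-! ### Net contents -/

section NetContent

variable {X ι : Type*} {c : ℕ → X → ι} {w : ℕ → ℝ≥0∞}

/-- The set of points lying in one of the cells of the family `S`, where `(j, a)` stands for the
cell `{x | c j x = a}`. -/
def cellUnion (c : ℕ → X → ι) (S : Set (ℕ × ι)) : Set X := {x | ∃ j, (j, c j x) ∈ S}

/-- Total weight of a family of cells. -/
def cellWeight (w : ℕ → ℝ≥0∞) (S : Set (ℕ × ι)) : ℝ≥0∞ := ∑' q, S.indicator (fun q => w q.1) q

/-- The net content of `E`: the infimum of the total weights of the covers of `E` by cells. -/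
def netContent (c : ℕ → X → ι) (w : ℕ → ℝ≥0∞) (E : Set X) : ℝ≥0∞ :=
  ⨅ (S : Set (ℕ × ι)) (_ : E ⊆ cellUnion c S), cellWeight w S

/-- The cells of `S` that are not contained in a coarser cell of `S`. -/
def maxCells (c : ℕ → X → ι) (S : Set (ℕ × ι)) : Set (ℕ × ι) :=
  {q ∈ S | ∀ x, c q.1 x = q.2 → ∀ i < q.1, (i, c i x) ∉ S}

lemma netContent_le {E : Set X} {S : Set (ℕ × ι)} (h : E ⊆ cellUnion c S) :
    netContent c w E ≤ cellWeight w S := iInf₂_le S h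

lemma exists_cover_of_netContent_lt {E : Set X} {a : ℝ≥0∞} (h : netContent c w E < a) :
    ∃ S, E ⊆ cellUnion c S ∧ cellWeight w S < a := by
  simpa [netContent, iInf_lt_iff] using h

lemma mem_maxCells_of_forall_notMem (hc : ∀ i j x y, i ≤ j → c j x = c j y → c i x = c i y)
    {S : Set (ℕ × ι)} {x : X} {j : ℕ} (hj : (j, c j x) ∈ S) (hmin : ∀ i < j, (i, c i x) ∉ S) :
    (j, c j x) ∈ maxCells c S := by
  refine ⟨hj, fun y hy i hi => ?_⟩
  rw [hc i j y x hi.le hy]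
  exact hmin i hi

/-- Merging two covers: the maximal cells cover the union, the remaining ones still cover the
intersection. -/
lemma cellWeight_maxCells_union_add_netContent_le (S T : Set (ℕ × ι)) {E : Set X}
    (hS : E ⊆ cellUnion c S) (hT : E ⊆ cellUnion c T) :
    cellWeight w (maxCells c (S ∪ T)) + netContent c w E ≤ cellWeight w S + cellWeight w T := by
  have hD : E ⊆ cellUnion c ((S ∩ T) ∪ ((S ∪ T) \ maxCells c (S ∪ T))) := by
    intro x hx
    obtain ⟨i, hi⟩ := hS hx
    obtain ⟨j, hj⟩ := hT hx
    rcases lt_trichotomy i j with h | h | h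
    · refine ⟨j, Or.inr ⟨Or.inr hj, fun hm => hm.2 x rfl i h (Or.inl hi)⟩⟩
    · subst h
      exact ⟨i, Or.inl ⟨hi, hj⟩⟩
    · refine ⟨i, Or.inr ⟨Or.inl hi, fun hm => hm.2 x rfl j h (Or.inr hj)⟩⟩
  refine (add_le_add le_rfl (netContent_le hD)).trans ?_
  unfold cellWeight
  rw [← ENNReal.tsum_add, ← ENNReal.tsum_add]
  refine ENNReal.tsum_le_tsum fun q => ?_
  have hM : q ∈ maxCells c (S ∪ T) → q ∈ S ∪ T := fun h => h.1
  by_cases h1 : q ∈ S <;> by_cases h2 : q ∈ T <;> by_cases h3 : q ∈ maxCells c (S ∪ T) <;>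
    simp_all [indicator]

/-- Continuity of net contents along increasing sequences of arbitrary sets. -/
theorem netContent_iUnion_le (hc : ∀ i j x y, i ≤ j → c j x = c j y → c i x = c i y)
    {E : ℕ → Set X} (hE : Monotone E) {a : ℝ≥0∞} (ha : a ≠ ∞)
    (h : ∀ n, netContent c w (E n) ≤ a) : netContent c w (⋃ n, E n) ≤ a := by
  refine ENNReal.le_of_forall_pos_le_add fun ε hε _ => ?_
  obtain ⟨ε', hε', hsum⟩ := ENNReal.exists_pos_sum_of_countable (ENNReal.coe_pos.2 hε).ne' ℕ
  have hfin : ∀ n, netContent c w (E n) ≠ ∞ := fun n => ne_top_of_le_ne_top ha (h n)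
  have hQ : ∀ n, ∃ S, E n ⊆ cellUnion c S ∧ cellWeight w S < netContent c w (E n) + ε' n :=
    fun n => exists_cover_of_netContent_lt
      (ENNReal.lt_add_right (hfin n) (ENNReal.coe_pos.2 (hε' n)).ne')
  choose Q hQ1 hQ2 using hQ
  let C : ℕ → Set (ℕ × ι) := fun n => Nat.rec (Q 0) (fun n S => maxCells c (S ∪ Q (n + 1))) n
  have hC : ∀ n, C (n + 1) = maxCells c (C n ∪ Q (n + 1)) := fun n => rfl
  have hstep : ∀ n x j, (j, c j x) ∈ C n ∪ Q (n + 1) →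
      ∃ i ≤ j, (i, c i x) ∈ C (n + 1) := by
    intro n x j hj
    have hne : {i | (i, c i x) ∈ C n ∪ Q (n + 1)}.Nonempty := ⟨j, hj⟩
    exact ⟨_, Nat.sInf_le hj, mem_maxCells_of_forall_notMem hc (Nat.sInf_mem hne)
      fun i hi => Nat.notMem_of_lt_sInf hi⟩
  have hcov : ∀ n, E n ⊆ cellUnion c (C n) := by
    intro n
    cases n with
    | zero => exact hQ1 0
    | succ n =>
      intro x hx
      obtain ⟨j, hj⟩ := hQ1 _ hx
      obtain ⟨i, _, hi⟩ := hstep n x j (Or.inr hj)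
      exact ⟨i, hi⟩
  have hW : ∀ n, cellWeight w (C n) ≤
      netContent c w (E n) + ∑ i ∈ Finset.range (n + 1), (ε' i : ℝ≥0∞) := by
    intro n
    induction n with
    | zero =>
      change cellWeight w (Q 0) ≤ _
      simpa using (hQ2 0).le
    | succ n ih =>
      have h1 := cellWeight_maxCells_union_add_netContent_le (w := w) (C n) (Q (n + 1))
        (hcov n) ((hE n.le_succ).trans (hQ1 (n + 1)))
      rw [← hC] at h1
      rw [← ENNReal.add_le_add_iff_right (hfin n)]
      refine h1.trans ((add_le_add ih (hQ2 (n + 1)).le).trans (le_of_eq ?_))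
      rw [Finset.sum_range_succ _ (n + 1)]
      ring
  have hbound : ∀ n, cellWeight w (C n) ≤ a + ε := fun n =>
    (hW n).trans (add_le_add (h n) ((ENNReal.sum_le_tsum _).trans hsum.le))
  let D : Set (ℕ × ι) := {q | ∃ N, ∀ n ≥ N, q ∈ C n}
  have hDcov : (⋃ n, E n) ⊆ cellUnion c D := by
    intro x hx
    obtain ⟨N, hN⟩ := mem_iUnion.1 hx
    have hex : ∀ n, {j | (j, c j x) ∈ C (N + n)}.Nonempty := fun n =>
      hcov (N + n) (hE (Nat.le_add_right N n) hN)
    let f : ℕ → ℕ := fun n => sInf {j | (j, c j x) ∈ C (N + n)}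
    have hfmem : ∀ n, (f n, c (f n) x) ∈ C (N + n) := fun n => Nat.sInf_mem (hex n)
    have hf : Antitone f := antitone_nat_of_succ_le fun n => by
      obtain ⟨i, hi, hi'⟩ := hstep (N + n) x _ (Or.inl (hfmem n))
      exact (Nat.sInf_le hi').trans hi
    obtain ⟨n0, hn0⟩ : ∃ n0, ∀ n ≥ n0, f n = f n0 := by
      obtain ⟨_, ⟨m, rfl⟩, hm⟩ := WellFounded.has_min (wellFounded_lt (α := ℕ)) (range f)
        (range_nonempty f)
      exact ⟨m, fun n hn => le_antisymm (hf hn) (not_lt.1 (hm _ (mem_range_self n)))⟩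
    refine ⟨f n0, N + n0, fun n hn => ?_⟩
    obtain ⟨m, rfl⟩ := Nat.exists_eq_add_of_le hn
    have := hfmem (n0 + m)
    rw [hn0 (n0 + m) (by omega)] at this
    rwa [Nat.add_assoc]
  refine (netContent_le hDcov).trans ?_
  unfold cellWeight
  rw [ENNReal.tsum_eq_iSup_sum]
  refine iSup_le fun F => ?_
  have hev : ∀ᶠ n in Filter.atTop, ∀ q ∈ F, q ∈ D → q ∈ C n := by
    rw [Filter.eventually_all_finset]
    intro q _
    rcases em (q ∈ D) with hq | hq
    · obtain ⟨N, hN⟩ := hq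
      exact (Filter.eventually_ge_atTop N).mono fun n hn _ => hN n hn
    · exact Filter.Eventually.of_forall fun n h => absurd h hq
  obtain ⟨n, hn⟩ := hev.exists
  refine le_trans (Finset.sum_le_sum fun q hq => ?_)
    ((ENNReal.sum_le_tsum F).trans (hbound n))
  rcases em (q ∈ D) with hqD | hqD
  · rw [indicator_of_mem hqD, indicator_of_mem (hn q hq hqD)]
  · rw [indicator_of_notMem hqD]
    exact zero_le

end NetContent

/-! ### Compact sets of positive content -/

section Grid

variable {d : ℕ} {w : ℕ → ℝ≥0∞}

/-- The index of the dyadic cell of side `2⁻ʲ` containing `x`. -/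
def gridCell (d : ℕ) (j : ℕ) (x : Fin d → ℝ) : Fin d → ℤ := fun i => ⌊2 ^ j * x i⌋

lemma gridCell_eq_of_le {i j : ℕ} {x y : Fin d → ℝ} (hij : i ≤ j)
    (h : gridCell d j x = gridCell d j y) : gridCell d i x = gridCell d i y := by
  obtain ⟨m, rfl⟩ := Nat.exists_eq_add_of_le hij
  have key : ∀ z : Fin d → ℝ, ∀ l,
      gridCell d i z l = gridCell d (i + m) z l / ((2 ^ m : ℕ) : ℤ) := by
    intro z l
    have h2 : (2 : ℝ) ^ i * z l = 2 ^ (i + m) * z l / ((2 ^ m : ℕ) : ℝ) := by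
      push_cast
      field_simp
      ring
    rw [gridCell, h2, Int.floor_div_natCast]
    rfl
  funext l
  rw [key, key, h]

/-- The number of neighbours of a cell of the grid. -/
def neighborCount (d : ℕ) : ℕ := (Finset.Icc (-1 : Fin d → ℤ) 1).card

lemma neighborCount_ne_zero : (neighborCount d : ℝ≥0∞) ≠ 0 := by
  have h : (-1 : Fin d → ℤ) ≤ 1 := fun i => by norm_num
  rw [Nat.cast_ne_zero, neighborCount, Finset.card_ne_zero]
  exact ⟨1, Finset.mem_Icc.2 ⟨h, le_rfl⟩⟩

/-- The cells of `S` together with all their neighbours of the same generation. -/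
def thicken (S : Set (ℕ × (Fin d → ℤ))) : Set (ℕ × (Fin d → ℤ)) :=
  {q | ∃ e ∈ Finset.Icc (-1 : Fin d → ℤ) 1, (q.1, q.2 - e) ∈ S}

lemma cellWeight_thicken_le (S : Set (ℕ × (Fin d → ℤ))) :
    cellWeight w (thicken S) ≤ neighborCount d * cellWeight w S := by
  have h1 : cellWeight w (thicken S) ≤ ∑' q : ℕ × (Fin d → ℤ),
      ∑ e ∈ Finset.Icc (-1 : Fin d → ℤ) 1, S.indicator (fun q => w q.1) (q.1, q.2 - e) := by
    refine ENNReal.tsum_le_tsum fun q => ?_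
    rcases em (q ∈ thicken S) with hq | hq
    · rw [indicator_of_mem hq]
      obtain ⟨e, he, heS⟩ := hq
      refine le_trans (le_of_eq ?_) (Finset.single_le_sum (fun _ _ => zero_le) he)
      rw [indicator_of_mem heS]
    · rw [indicator_of_notMem hq]
      exact zero_le
  refine h1.trans (le_of_eq ?_)
  rw [Summable.tsum_finsetSum fun _ _ => ENNReal.summable, ← nsmul_eq_mul]
  refine Finset.sum_eq_card_nsmul fun e _ => ?_
  exact ((Equiv.refl ℕ).prodCongr (Equiv.subRight e)).tsum_eq (S.indicator fun q => w q.1)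

lemma exists_isOpen_between_thicken (S : Set (ℕ × (Fin d → ℤ))) :
    ∃ U, IsOpen U ∧ cellUnion (gridCell d) S ⊆ U ∧ U ⊆ cellUnion (gridCell d) (thicken S) := by
  refine ⟨⋃ q ∈ S, ⋂ i, {x | (q.2 i : ℝ) - 1 < 2 ^ q.1 * x i ∧ 2 ^ q.1 * x i < q.2 i + 2},
    ?_, ?_, ?_⟩
  · refine isOpen_biUnion fun q _ => isOpen_iInter_of_finite fun i => ?_
    have hc : Continuous fun x : Fin d → ℝ => (2 : ℝ) ^ q.1 * x i := by fun_prop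
    exact (isOpen_lt continuous_const hc).inter (isOpen_lt hc continuous_const)
  · rintro x ⟨j, hj⟩
    simp only [mem_iUnion, mem_iInter]
    refine ⟨_, hj, fun i => ?_⟩
    have h1 := Int.floor_le ((2 : ℝ) ^ j * x i)
    have h2 := Int.lt_floor_add_one ((2 : ℝ) ^ j * x i)
    simp only [gridCell, mem_ofPred_eq]
    constructor <;> linarith
  · intro x hx
    simp only [mem_iUnion, mem_iInter] at hx
    obtain ⟨⟨j, a⟩, hq, hx⟩ := hx
    refine ⟨j, gridCell d j x - a, ?_, by simpa using hq⟩
    rw [Finset.mem_Icc, Pi.le_def, Pi.le_def]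
    refine ⟨fun i => ?_, fun i => ?_⟩ <;> obtain ⟨h1, h2⟩ := hx i <;>
      simp only [gridCell, Pi.neg_apply, Pi.one_apply, Pi.sub_apply]
    · have : a i - 1 ≤ ⌊(2 : ℝ) ^ j * x i⌋ := Int.le_floor.2 (by push_cast; linarith)
      linarith
    · have : ⌊(2 : ℝ) ^ j * x i⌋ < a i + 2 := Int.floor_lt.2 (by push_cast; linarith)
      omega

/-- A bounded box of `ℕ^ℕ` inside an open set has a finite-dimensional thickening inside it. -/
lemma exists_cylinder_subset_of_box_subset {N : ℕ → ℕ} {V : Set (ℕ → ℕ)} (hV : IsOpen V)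
    (h : {n : ℕ → ℕ | ∀ i, n i ≤ N i} ⊆ V) : ∃ j, {n : ℕ → ℕ | ∀ i < j, n i ≤ N i} ⊆ V := by
  by_contra! hcon
  have hex : ∀ j, ∃ n : ℕ → ℕ, (∀ i < j, n i ≤ N i) ∧ n ∉ V := fun j => by
    simpa [Set.subset_def] using hcon j
  choose n hn hnV using hex
  have hcomp : IsCompact {m : ℕ → ℕ | ∀ i, m i ≤ N i} := by
    have := isCompact_univ_pi (s := fun i => Iic (N i)) fun i => (finite_Iic (N i)).isCompact
    simpa [Set.pi] using this
  obtain ⟨m, hm, φ, hφ, hlim⟩ := hcomp.tendsto_subseq (x := fun j i => min (n j i) (N i))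
    fun j i => min_le_right _ _
  have hlim' : Filter.Tendsto (fun j => n (φ j)) Filter.atTop (nhds m) := by
    rw [tendsto_pi_nhds] at hlim ⊢
    intro i
    refine (hlim i).congr' ?_
    filter_upwards [Filter.eventually_gt_atTop i] with j hj
    exact min_eq_left (hn _ i (hj.trans_le (hφ.id_le j)))
  exact (hV.isClosed_compl.mem_of_tendsto hlim' (Filter.Eventually.of_forall fun j => hnV _)) (h hm)

/-- Analytic sets of positive net content contain compact sets of positive net content. -/
theorem exists_isCompact_netContent_pos {E : Set (Fin d → ℝ)} (hE : AnalyticSet E)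
    (hpos : 0 < netContent (gridCell d) w E) :
    ∃ K ⊆ E, IsCompact K ∧ 0 < netContent (gridCell d) w K := by
  obtain ⟨a, ha0, ha⟩ := exists_between hpos
  rw [AnalyticSet] at hE
  rcases hE with rfl | ⟨f, hf, rfl⟩
  · exact ⟨∅, subset_rfl, isCompact_empty, hpos⟩
  have hstep : ∀ (A : {A : Set (ℕ → ℕ) // a < netContent (gridCell d) w (f '' A)}) (i : ℕ),
      ∃ m : ℕ, a < netContent (gridCell d) w (f '' (A.1 ∩ {n | n i ≤ m})) := by
    rintro ⟨A, hA⟩ i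
    by_contra! hcon
    refine hA.not_ge ?_
    have hU : f '' A = ⋃ m : ℕ, f '' (A ∩ {n | n i ≤ m}) := by
      rw [← image_iUnion, ← inter_iUnion]
      congr 1
      refine (inter_eq_left.2 fun n _ => ?_).symm
      exact mem_iUnion.2 ⟨n i, le_refl (n i)⟩
    rw [hU]
    have hmono : Monotone fun m : ℕ => f '' (A ∩ {n | n i ≤ m}) := fun m m' hm =>
      image_mono (inter_subset_inter_right _ fun n (hn : n i ≤ m) => hn.trans hm)
    exact netContent_iUnion_le (c := gridCell d) (fun i j x y => gridCell_eq_of_le) hmono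
      ha.ne_top hcon
  choose m hm using hstep
  let A : ℕ → {A : Set (ℕ → ℕ) // a < netContent (gridCell d) w (f '' A)} := fun j =>
    Nat.rec ⟨univ, by simpa using ha⟩ (fun j B => ⟨_, hm B j⟩) j
  let N : ℕ → ℕ := fun j => m (A j) j
  have hA : ∀ j, (A j).1 = {n : ℕ → ℕ | ∀ i < j, n i ≤ N i} := by
    intro j
    induction j with
    | zero => simp [A]
    | succ j ih =>
      change (A j).1 ∩ {n | n j ≤ N j} = _
      rw [ih]
      ext n
      simp only [mem_inter_iff, mem_ofPred_eq, Nat.lt_succ_iff_lt_or_eq]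
      exact ⟨fun h i hi => hi.elim (h.1 i) fun e => e ▸ h.2,
        fun h => ⟨fun i hi => h i (Or.inl hi), h j (Or.inr rfl)⟩⟩
  refine ⟨f '' {n | ∀ i, n i ≤ N i}, image_subset_range _ _, ?_, ?_⟩
  · have := isCompact_univ_pi (s := fun i => Iic (N i)) fun i => (finite_Iic (N i)).isCompact
    refine IsCompact.image ?_ hf
    simpa [Set.pi] using this
  · have hle : a ≤ neighborCount d *
        netContent (gridCell d) w (f '' {n | ∀ i, n i ≤ N i}) := by
      rw [netContent, ENNReal.mul_iInf_of_ne neighborCount_ne_zero (by simp)]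
      refine le_iInf fun S => ?_
      rw [ENNReal.mul_iInf_of_ne neighborCount_ne_zero (by simp)]
      refine le_iInf fun hS => ?_
      obtain ⟨U, hU, hSU, hUS⟩ := exists_isOpen_between_thicken S
      obtain ⟨j, hj⟩ := exists_cylinder_subset_of_box_subset (hU.preimage hf)
        (image_subset_iff.1 (hS.trans hSU))
      rw [← hA] at hj
      exact (A j).2.le.trans ((netContent_le ((image_subset_iff.2 hj).trans hUS)).trans
        (cellWeight_thicken_le S))
    rw [pos_iff_ne_zero]
    intro h0
    rw [h0, mul_zero] at hle
    exact ha0.not_ge hle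

end Grid

/-! ### Frostman measures -/

section Saturation

variable {X ι : Type*} [MeasurableSpace X] {c : ℕ → X → ι} {w : ℕ → ℝ≥0∞}

/-- A measure on a finite set which is as large as the constraints `μ (cell) ≤ w j` permit. -/
lemma exists_measure_saturated (hcm : ∀ j a, MeasurableSet {x | c j x = a})
    (hw : ∀ j, w j ≠ ∞) (J : ℕ) {F : Set X} (hF : F.Finite) :
    ∃ μ : Measure X, IsFiniteMeasure μ ∧ (∀ B, MeasurableSet B → Disjoint B F → μ B = 0) ∧
      (∀ j ≤ J, ∀ a, μ {x | c j x = a} ≤ w j) ∧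
      ∀ p ∈ F, ∃ j ≤ J, w j ≤ μ {x | c j x = c j p} := by
  induction F, hF using Set.Finite.induction_on with
  | empty => exact ⟨0, inferInstance, by simp, by simp, by simp⟩
  | @insert p F _ _ ih =>
    obtain ⟨μ, hμ, hsupp, hle, hsat⟩ := ih
    obtain ⟨i, hi, hmin⟩ := Finset.exists_min_image (Finset.range (J + 1))
      (fun j => w j - μ {x | c j x = c j p}) ⟨0, by simp⟩
    have hiJ : i ≤ J := Finset.mem_range_succ_iff.1 hi
    set m := w i - μ {x | c i x = c i p} with hm
    have hmtop : m ≠ ∞ := ENNReal.sub_ne_top (hw i)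
    have hμ' : IsFiniteMeasure (m • Measure.dirac p) := by
      refine ⟨?_⟩
      simpa using hmtop.lt_top
    refine ⟨μ + m • Measure.dirac p, inferInstance, fun B hB hd => ?_, fun j hj a => ?_, ?_⟩
    · rw [Set.disjoint_insert_right] at hd
      rw [Measure.add_apply, hsupp B hB hd.2, Measure.smul_apply, Measure.dirac_apply' _ hB,
        indicator_of_notMem hd.1]
      simp
    · rw [Measure.add_apply, Measure.smul_apply, Measure.dirac_apply' _ (hcm j a)]
      rcases em (c j p = a) with h | h
      · rw [indicator_of_mem (by exact h), ← h]
        have h1 := hmin j (Finset.mem_range_succ_iff.2 hj)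
        have h2 : μ {x | c j x = c j p} + (w j - μ {x | c j x = c j p}) = w j :=
          add_tsub_cancel_of_le (hle j hj _)
        calc _ = μ {x | c j x = c j p} + m := by simp
          _ ≤ _ := add_le_add le_rfl h1
          _ = w j := h2
      · rw [indicator_of_notMem (by exact h)]
        simpa using hle j hj a
    · intro q hq
      rcases hq with rfl | hq
      · refine ⟨i, hiJ, ?_⟩
        rw [Measure.add_apply, Measure.smul_apply, Measure.dirac_apply' _ (hcm i _),
          indicator_of_mem (by exact rfl)]
        have h2 : μ {x | c i x = c i q} + m = w i := add_tsub_cancel_of_le (hle i hiJ _)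
        simp [h2]
      · obtain ⟨j, hj, h⟩ := hsat q hq
        exact ⟨j, hj, h.trans (by rw [Measure.add_apply]; exact le_self_add)⟩

/-- Disjointness of maximal cells bounds their total weight. -/
lemma netContent_le_measure_univ [Countable ι] (hcm : ∀ j a, MeasurableSet {x | c j x = a})
    (hc : ∀ i j x y, i ≤ j → c j x = c j y → c i x = c i y) {μ : Measure X} {K : Set X}
    (hK : ∀ x ∈ K, ∃ j, w j ≤ μ {y | c j y = c j x}) : netContent c w K ≤ μ univ := by
  let S : Set (ℕ × ι) := {q | w q.1 ≤ μ {y | c q.1 y = q.2}}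
  have hcov : K ⊆ cellUnion c (maxCells c S) := by
    intro x hx
    have hne : {j | (j, c j x) ∈ S}.Nonempty := hK x hx
    exact ⟨_, mem_maxCells_of_forall_notMem hc (Nat.sInf_mem hne)
      fun i hi => Nat.notMem_of_lt_sInf hi⟩
  refine (netContent_le hcov).trans ?_
  rw [cellWeight, ← tsum_subtype]
  refine (ENNReal.tsum_le_tsum fun q : maxCells c S =>
    (q.2.1 : w q.1.1 ≤ μ {y | c q.1.1 y = q.1.2})).trans ?_
  rw [← measure_iUnion _ fun q => hcm _ _]
  · exact measure_mono (subset_univ _)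
  · rintro ⟨⟨i, a⟩, ha⟩ ⟨⟨j, b⟩, hb⟩ hne
    refine Set.disjoint_left.2 fun x hx hx' => hne ?_
    obtain rfl : c i x = a := hx
    obtain rfl : c j x = b := hx'
    rcases lt_trichotomy i j with h | rfl | h
    · exact absurd ha.1 (hb.2 x rfl i h)
    · rfl
    · exact absurd hb.1 (ha.2 x rfl j h)

end Saturation

section Frostman

variable {d : ℕ} {w : ℕ → ℝ≥0∞}

lemma measurable_gridCell (j : ℕ) : Measurable (gridCell d j) :=
  measurable_pi_lambda _ fun i => Int.measurable_floor.comp (by fun_prop)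

lemma measurableSet_gridCell_eq (j : ℕ) (a : Fin d → ℤ) :
    MeasurableSet {x | gridCell d j x = a} :=
  measurable_gridCell j (measurableSet_singleton a)

lemma finite_image_gridCell {K : Set (Fin d → ℝ)} (hK : IsCompact K) (j : ℕ) :
    (gridCell d j '' K).Finite := by
  obtain ⟨R, hR⟩ := hK.isBounded.exists_norm_le
  refine (Set.finite_Icc (fun _ => ⌊2 ^ j * -R⌋ : Fin d → ℤ) (fun _ => ⌊2 ^ j * R⌋)).subset ?_
  rintro _ ⟨x, hx, rfl⟩
  have h : ∀ i, |x i| ≤ R := fun i => (norm_le_pi_norm x i).trans (hR x hx)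
  exact ⟨fun i => Int.floor_mono (by gcongr; exact (abs_le.1 (h i)).1),
    fun i => Int.floor_mono (by gcongr; exact (abs_le.1 (h i)).2)⟩

lemma ball_subset_cellUnion_gridCell (x : Fin d → ℝ) (j : ℕ) :
    ball x (2 ^ j)⁻¹ ⊆ ⋃ e ∈ Finset.Icc (-1 : Fin d → ℤ) 1,
      {y | gridCell d j y = gridCell d j x + e} := by
  intro y hy
  simp only [mem_iUnion]
  refine ⟨gridCell d j y - gridCell d j x, ?_, by simp⟩
  have h : ∀ i, |2 ^ j * y i - 2 ^ j * x i| < 1 := fun i => by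
    rw [← mul_sub, abs_mul, abs_of_pos (by positivity), mul_comm, ← lt_div_iff₀ (by positivity),
      one_div]
    exact (dist_le_pi_dist y x i).trans_lt hy
  rw [Finset.mem_Icc, Pi.le_def, Pi.le_def]
  refine ⟨fun i => ?_, fun i => ?_⟩ <;> obtain ⟨h1, h2⟩ := abs_lt.1 (h i) <;>
    simp only [gridCell, Pi.neg_apply, Pi.one_apply, Pi.sub_apply]
  · have : ⌊(2 : ℝ) ^ j * x i⌋ - 1 ≤ ⌊(2 : ℝ) ^ j * y i⌋ :=
      Int.le_floor.2 (by push_cast; linarith [Int.floor_le ((2 : ℝ) ^ j * x i)])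
    linarith
  · have : ⌊(2 : ℝ) ^ j * y i⌋ < ⌊(2 : ℝ) ^ j * x i⌋ + 2 :=
      Int.floor_lt.2 (by push_cast; linarith [Int.lt_floor_add_one ((2 : ℝ) ^ j * x i)])
    omega

lemma exists_probabilityMeasure_gridCell_le (hw : ∀ j, w j ≠ ∞) {K : Set (Fin d → ℝ)}
    (hK : IsCompact K) (hpos : netContent (gridCell d) w K ≠ 0) (J : ℕ) :
    ∃ P : ProbabilityMeasure (Fin d → ℝ), (P : Measure (Fin d → ℝ)) Kᶜ = 0 ∧
      ∀ j ≤ J, ∀ a, (P : Measure (Fin d → ℝ)) {x | gridCell d j x = a} ≤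
        (netContent (gridCell d) w K)⁻¹ * w j := by
  obtain ⟨F, hFK, hF, hFeq⟩ : ∃ F ⊆ K, F.Finite ∧
      ∀ x ∈ K, ∃ p ∈ F, gridCell d J p = gridCell d J x := by
    obtain ⟨F, hFK, hF⟩ := exists_subset_bijOn K (gridCell d J)
    exact ⟨F, hFK, hF.finite_iff_finite.2 (finite_image_gridCell hK J),
      fun x hx => hF.surjOn (mem_image_of_mem _ hx)⟩
  obtain ⟨μ, hμ, hsupp, hle, hsat⟩ := exists_measure_saturated
    (c := gridCell d) measurableSet_gridCell_eq hw J hF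
  have hnet : netContent (gridCell d) w K ≤ μ univ := by
    refine netContent_le_measure_univ measurableSet_gridCell_eq
      (fun i j x y => gridCell_eq_of_le) fun x hx => ?_
    obtain ⟨p, hp, hpx⟩ := hFeq x hx
    obtain ⟨j, hj, h⟩ := hsat p hp
    exact ⟨j, by rwa [← gridCell_eq_of_le hj hpx]⟩
  have hμ0 : μ univ ≠ 0 := fun h => hpos (le_zero_iff.1 (h ▸ hnet))
  have hP : IsProbabilityMeasure ((μ univ)⁻¹ • μ) :=
    ⟨by simp [ENNReal.inv_mul_cancel hμ0 (measure_ne_top μ univ)]⟩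
  refine ⟨⟨_, hP⟩, ?_, fun j hj a => ?_⟩
  · change (μ univ)⁻¹ * μ Kᶜ = 0
    rw [hsupp _ hK.measurableSet.compl
      (Set.disjoint_left.2 fun x hx hxF => hx (hFK hxF)), mul_zero]
  · exact mul_le_mul' (ENNReal.inv_le_inv.2 hnet) (hle j hj a)

/-- **Frostman's lemma** for analytic sets, in terms of net contents. -/
theorem exists_frostman_measure (hw : ∀ j, w j ≠ ∞) {E : Set (Fin d → ℝ)} (hE : AnalyticSet E)
    (hpos : 0 < netContent (gridCell d) w E) :
    ∃ P : ProbabilityMeasure (Fin d → ℝ), ∃ C : ℝ≥0∞, (∃ K ⊆ E, IsCompact K ∧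
      (P : Measure (Fin d → ℝ)) Kᶜ = 0) ∧ C ≠ ∞ ∧
      ∀ x j, (P : Measure (Fin d → ℝ)) (ball x (2 ^ j)⁻¹) ≤ C * w j := by
  obtain ⟨K, hKE, hK, hKpos⟩ := exists_isCompact_netContent_pos hE hpos
  choose P hPK hP using exists_probabilityMeasure_gridCell_le hw hK hKpos.ne'
  have htight : IsTightMeasureSet
      {((μ : ProbabilityMeasure (Fin d → ℝ)) : Measure (Fin d → ℝ)) | μ ∈ range P} := by
    rw [isTightMeasureSet_iff_exists_isCompact_measure_compl_le]
    refine fun ε _ => ⟨K, hK, ?_⟩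
    rintro _ ⟨_, ⟨J, rfl⟩, rfl⟩
    rw [hPK]
    exact zero_le
  let U : Ultrafilter ℕ := Ultrafilter.of Filter.atTop
  obtain ⟨Q, -, hQ⟩ := isCompact_iff_ultrafilter_le_nhds.1
    (isCompact_closure_of_isTightMeasureSet htight) (U.map P)
    (Filter.le_principal_iff.2 (Filter.mem_map.2 (Filter.univ_mem'
      fun J => subset_closure (mem_range_self J))))
  have hlim : Filter.Tendsto P U (nhds Q) := hQ
  refine ⟨Q, neighborCount d * (netContent (gridCell d) w K)⁻¹, ⟨K, hKE, hK, ?_⟩, ?_, ?_⟩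
  · rw [← le_zero_iff]
    refine (ProbabilityMeasure.le_liminf_measure_open_of_tendsto hlim
      hK.isClosed.isOpen_compl).trans ?_
    refine Filter.liminf_le_of_frequently_le' (Filter.Frequently.of_forall fun J => ?_)
    exact (hPK J).le
  · exact ENNReal.mul_ne_top (by simp) (ENNReal.inv_ne_top.2 hKpos.ne')
  · intro x j
    refine (ProbabilityMeasure.le_liminf_measure_open_of_tendsto hlim isOpen_ball).trans ?_
    refine Filter.liminf_le_of_frequently_le' (Filter.Eventually.frequently ?_)
    have hev : ∀ᶠ J in (U : Filter ℕ), j ≤ J :=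
      Ultrafilter.of_le Filter.atTop (Filter.eventually_ge_atTop j)
    filter_upwards [hev] with J hJ
    refine (measure_mono (ball_subset_cellUnion_gridCell x j)).trans
      ((measure_biUnion_finset_le _ _).trans
      ((Finset.sum_le_card_nsmul _ _ _ fun e _ => hP J j hJ _).trans (le_of_eq ?_)))
    rw [nsmul_eq_mul, mul_assoc]
    rfl

end Frostman

/-! ### Measures of finite energy -/

section Energy

variable {d : ℕ}

/-- The weight `2⁻ʲˢ` of a dyadic cell of generation `j`. -/
def dyadicWeight (s : ℝ) (j : ℕ) : ℝ≥0∞ := ((2⁻¹ : ℝ≥0∞) ^ j) ^ s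

lemma dyadicWeight_ne_top {s : ℝ} (hs : 0 ≤ s) (j : ℕ) : dyadicWeight s j ≠ ∞ :=
  ENNReal.rpow_ne_top_of_nonneg hs (ENNReal.pow_ne_top (by simp))

lemma ediam_gridCell_le (j : ℕ) (a : Fin d → ℤ) :
    ediam {x | gridCell d j x = a} ≤ (2⁻¹ : ℝ≥0∞) ^ j := by
  refine ediam_le fun x hx y hy => ?_
  rw [edist_pi_le_iff]
  intro i
  have h : |(2 : ℝ) ^ j * x i - 2 ^ j * y i| < 1 :=
    Int.abs_sub_lt_one_of_floor_eq_floor ((congrFun hx i).trans (congrFun hy i).symm)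
  rw [edist_dist, Real.dist_eq, ENNReal.inv_pow.symm, ← ENNReal.ofReal_ofNat,
    ← ENNReal.ofReal_pow (by norm_num), ← ENNReal.ofReal_inv_of_pos (by positivity)]
  refine ENNReal.ofReal_le_ofReal ?_
  rw [← mul_sub, abs_mul, abs_of_pos (by positivity)] at h
  rw [← one_div, le_div_iff₀ (by positivity), mul_comm]
  exact h.le

lemma hausdorffMeasure_eq_zero_of_netContent {s : ℝ} (hs : 0 < s) {E : Set (Fin d → ℝ)}
    (h : netContent (gridCell d) (dyadicWeight s) E = 0) : μH[s] E = 0 := by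
  have hex : ∀ n : ℕ, ∃ S, E ⊆ cellUnion (gridCell d) S ∧
      cellWeight (dyadicWeight s) S < ((n : ℝ≥0∞) + 1)⁻¹ := fun n =>
    exists_cover_of_netContent_lt (by rw [h]; simp)
  choose S hS hSw using hex
  have hlim : Filter.Tendsto (fun n : ℕ => ((n : ℝ≥0∞) + 1)⁻¹) Filter.atTop (nhds 0) := by
    have := (Filter.tendsto_add_atTop_iff_nat 1).2 ENNReal.tendsto_inv_nat_nhds_zero
    simpa using this
  have hle : ∀ n, ∀ q : S n, ediam {x | gridCell d q.1.1 x = q.1.2} ^ s ≤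
      dyadicWeight s q.1.1 := fun n q => ENNReal.rpow_le_rpow (ediam_gridCell_le _ _) hs.le
  have hsum : ∀ n, ∑' q : S n, dyadicWeight s q.1.1 < ((n : ℝ≥0∞) + 1)⁻¹ := fun n => by
    have := hSw n
    rwa [cellWeight, ← tsum_subtype (S n)] at this
  have key := Measure.hausdorffMeasure_le_liminf_tsum s E (l := Filter.atTop)
    (fun n : ℕ => (((n : ℝ≥0∞) + 1)⁻¹) ^ s⁻¹)
    (by
      have := hlim.ennrpow_const s⁻¹
      rwa [ENNReal.zero_rpow_of_pos (inv_pos.2 hs)] at this)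
    (fun n (q : S n) => {x | gridCell d q.1.1 x = q.1.2})
    (Filter.Eventually.of_forall fun n q => by
      rw [← ENNReal.rpow_le_rpow_iff hs, ← ENNReal.rpow_mul, inv_mul_cancel₀ hs.ne',
        ENNReal.rpow_one]
      exact (hle n q).trans ((ENNReal.le_tsum q).trans (hsum n).le))
    (Filter.Eventually.of_forall fun n x hx => by
      obtain ⟨j, hj⟩ := hS n hx
      exact mem_iUnion.2 ⟨⟨_, hj⟩, rfl⟩)
  have h0 : Filter.Tendsto (fun n : ℕ => ∑' q : S n,
      ediam {x | gridCell d q.1.1 x = q.1.2} ^ s) Filter.atTop (nhds 0) :=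
    tendsto_of_tendsto_of_tendsto_of_le_of_le tendsto_const_nhds hlim (fun _ => zero_le)
      fun n => (ENNReal.tsum_le_tsum (hle n)).trans (hsum n).le
  rw [h0.liminf_eq] at key
  exact le_zero_iff.1 key

lemma rpow_neg_le_one_add_tsum {s : ℝ} (hs : 0 < s) (t : ℝ≥0∞) :
    t ^ (-s) ≤ 1 + ∑' j : ℕ, ((2 : ℝ≥0∞) ^ (j + 1)) ^ s *
      (Iio ((2⁻¹ : ℝ≥0∞) ^ j)).indicator 1 t := by
  rcases le_or_gt 1 t with h1 | h1
  · refine le_trans ?_ le_self_add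
    rw [ENNReal.rpow_neg, ENNReal.inv_le_one]
    exact ENNReal.one_le_rpow h1 hs
  rcases eq_or_ne t 0 with rfl | h0
  · have : ∑' j : ℕ, ((2 : ℝ≥0∞) ^ (j + 1)) ^ s *
        (Iio ((2⁻¹ : ℝ≥0∞) ^ j)).indicator 1 0 = ∞ := by
      rw [← top_le_iff, ← ENNReal.tsum_const_eq_top_of_ne_zero (α := ℕ) one_ne_zero]
      refine ENNReal.tsum_le_tsum fun j => ?_
      have : (0 : ℝ≥0∞) ∈ Iio ((2⁻¹ : ℝ≥0∞) ^ j) := by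
        rw [mem_Iio]
        exact ENNReal.pow_pos (by simp) _
      rw [indicator_of_mem this, Pi.one_apply, mul_one]
      exact ENNReal.one_le_rpow (one_le_pow₀ (by norm_num)) hs
    rw [this]
    simp
  · have hex : ∃ n, (2⁻¹ : ℝ≥0∞) ^ n ≤ t :=
      ((ENNReal.tendsto_pow_atTop_nhds_zero_of_lt_one (by norm_num)).eventually_lt_const
        (pos_iff_ne_zero.2 h0)).exists.imp fun _ h => h.le
    classical
    obtain ⟨j, hj⟩ : ∃ j, Nat.find hex = j + 1 := Nat.exists_eq_succ_of_ne_zero fun h => by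
      have := Nat.find_spec hex
      rw [h] at this
      exact h1.not_ge (by simpa using this)
    have hspec := Nat.find_spec hex
    have hmin : t < (2⁻¹ : ℝ≥0∞) ^ j := not_le.1 (Nat.find_min hex (by omega))
    rw [hj] at hspec
    refine le_trans ?_ (le_trans (ENNReal.le_tsum j) le_add_self)
    rw [indicator_of_mem (show t ∈ Iio _ from hmin), Pi.one_apply, mul_one,
      ENNReal.rpow_neg, ← ENNReal.inv_rpow]
    refine ENNReal.rpow_le_rpow ?_ hs.le
    rwa [ENNReal.inv_le_iff_inv_le, ENNReal.inv_pow]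

/-- The constant in `lintegral_rpow_neg_le`. -/
def dyadicConst (s s' : ℝ) : ℝ≥0∞ := 2 ^ s * (1 - (2⁻¹ : ℝ≥0∞) ^ (s' - s))⁻¹

lemma dyadicConst_ne_top {s s' : ℝ} (hs : 0 ≤ s) (h : s < s') : dyadicConst s s' ≠ ∞ := by
  refine ENNReal.mul_ne_top (ENNReal.rpow_ne_top_of_nonneg hs (by simp)) ?_
  rw [ENNReal.inv_ne_top]
  exact (tsub_pos_of_lt (ENNReal.rpow_lt_one (by norm_num) (by linarith))).ne'

lemma lintegral_rpow_neg_le {α : Type*} [MeasurableSpace α] {P : Measure α} {f : α → ℝ≥0∞}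
    (hf : Measurable f) {s s' : ℝ} (hs : 0 < s) {C : ℝ≥0∞}
    (h : ∀ j : ℕ, P {x | f x < (2⁻¹ : ℝ≥0∞) ^ j} ≤ C * dyadicWeight s' j) :
    ∫⁻ x, f x ^ (-s) ∂P ≤ P univ + C * dyadicConst s s' := by
  have hm : ∀ j : ℕ, MeasurableSet {x | f x < (2⁻¹ : ℝ≥0∞) ^ j} := fun j =>
    measurableSet_lt hf measurable_const
  calc ∫⁻ x, f x ^ (-s) ∂P
      ≤ ∫⁻ x, (1 + ∑' j : ℕ, ((2 : ℝ≥0∞) ^ (j + 1)) ^ s *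
          {x | f x < (2⁻¹ : ℝ≥0∞) ^ j}.indicator 1 x) ∂P :=
        lintegral_mono fun x => rpow_neg_le_one_add_tsum hs (f x)
    _ = P univ + ∑' j : ℕ, ((2 : ℝ≥0∞) ^ (j + 1)) ^ s * P {x | f x < (2⁻¹ : ℝ≥0∞) ^ j} := by
        rw [lintegral_add_left measurable_const, lintegral_const, one_mul, lintegral_tsum]
        · congr 2
          funext j
          rw [lintegral_const_mul _ (measurable_one.indicator (hm j)),
            lintegral_indicator_one (hm j)]
        · exact fun j => ((measurable_one.indicator (hm j)).const_mul _).aemeasurable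
    _ ≤ P univ + ∑' j : ℕ, C * 2 ^ s * ((2⁻¹ : ℝ≥0∞) ^ (s' - s)) ^ j := by
        refine add_le_add le_rfl (ENNReal.tsum_le_tsum fun j => ?_)
        refine (mul_le_mul' le_rfl (h j)).trans (le_of_eq ?_)
        have e1 : ((2 : ℝ≥0∞) ^ (j + 1)) ^ s = 2 ^ s * 2 ^ ((j : ℝ) * s) := by
          rw [← ENNReal.rpow_natCast, ← ENNReal.rpow_mul,
            ← ENNReal.rpow_add _ _ (by simp) (by simp)]
          push_cast
          ring_nf
        have e2 : dyadicWeight s' j = 2 ^ (-((j : ℝ) * s')) := by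
          rw [dyadicWeight, ← ENNReal.rpow_natCast, ← ENNReal.rpow_mul, ENNReal.inv_rpow,
            ENNReal.rpow_neg]
        have e3 : ((2⁻¹ : ℝ≥0∞) ^ (s' - s)) ^ j = 2 ^ ((j : ℝ) * s) * 2 ^ (-((j : ℝ) * s')) := by
          rw [← ENNReal.rpow_natCast, ← ENNReal.rpow_mul, ENNReal.inv_rpow, ← ENNReal.rpow_neg,
            ← ENNReal.rpow_add _ _ (by simp) (by simp)]
          ring_nf
        rw [e1, e2, e3]
        ring
    _ = P univ + C * dyadicConst s s' := by
        rw [ENNReal.tsum_mul_left, ENNReal.tsum_geometric, dyadicConst, mul_assoc]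

/-- A Borel set of dimension larger than `s` carries a measure with bounded `s`-potential. -/
theorem exists_measure_lintegral_edist_le {E : Set (Fin d → ℝ)} (hE : MeasurableSet E) {s : ℝ≥0}
    (hs0 : 0 < s) (hs : s < dimH E) : ∃ P : Measure (Fin d → ℝ), IsProbabilityMeasure P ∧ P Eᶜ = 0 ∧
      ∃ C : ℝ≥0∞, C ≠ ∞ ∧ ∀ x, ∫⁻ y, edist x y ^ (-(s : ℝ)) ∂P ≤ C := by
  obtain ⟨s', hs', hs'E⟩ := ENNReal.lt_iff_exists_nnreal_btwn.1 hs
  have hs' : (s : ℝ) < s' := by exact_mod_cast hs'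
  have hpos : 0 < netContent (gridCell d) (dyadicWeight s') E := by
    rw [pos_iff_ne_zero]
    intro h0
    have h1 := hausdorffMeasure_eq_zero_of_netContent (s.2.trans_lt hs') h0
    rw [hausdorffMeasure_of_lt_dimH hs'E] at h1
    exact ENNReal.top_ne_zero h1
  obtain ⟨P, C, ⟨K, hKE, -, hPK⟩, hC, hP⟩ :=
    exists_frostman_measure (dyadicWeight_ne_top s'.2) hE.analyticSet hpos
  refine ⟨P, inferInstance, measure_mono_null (compl_subset_compl.2 hKE) hPK,
    1 + C * dyadicConst s s', ENNReal.add_ne_top.2 ⟨ENNReal.one_ne_top,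
      ENNReal.mul_ne_top hC (dyadicConst_ne_top s.2 hs')⟩, fun x => ?_⟩
  refine (lintegral_rpow_neg_le (s' := s') (measurable_const.edist measurable_id)
    (NNReal.coe_pos.2 hs0) (C := C) fun j => ?_).trans (by simp)
  refine (measure_mono fun y hy => ?_).trans (hP x j)
  rw [mem_ball']
  have hy' : edist x y < (2⁻¹ : ℝ≥0∞) ^ j := hy
  rw [ENNReal.inv_pow.symm, ← ENNReal.ofReal_ofNat, ← ENNReal.ofReal_pow (by norm_num),
    ← ENNReal.ofReal_inv_of_pos (by positivity), edist_lt_ofReal] at hy'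
  exact hy'

end Energy

/-! ### Generic linear images -/

section GenericLinear

variable {d k : ℕ}

/-- The uniform probability measure on the unit cube. -/
def cubeMeasure (d : ℕ) : Measure (Fin d → ℝ) :=
  Measure.pi fun _ => (volume : Measure ℝ).restrict (Icc 0 1)

instance : IsProbabilityMeasure ((volume : Measure ℝ).restrict (Icc 0 1)) := ⟨by simp⟩

instance : IsProbabilityMeasure (cubeMeasure d) := by
  unfold cubeMeasure
  infer_instance

lemma cubeMeasure_abs_dotProduct_le (z : Fin d → ℝ) (hz : z ≠ 0) (ρ : ℝ) :
    cubeMeasure d {a | |∑ i, a i * z i| ≤ ρ * ‖z‖} ≤ ENNReal.ofReal (2 * ρ) := by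
  obtain ⟨i, hi⟩ : ∃ i, ‖z‖ = |z i| := by
    have : Nonempty (Fin d) := by
      by_contra h
      rw [not_nonempty_iff] at h
      exact hz (Subsingleton.elim _ _)
    obtain ⟨i, -, hi⟩ := Finset.exists_mem_eq_sup' Finset.univ_nonempty fun i => ‖z i‖₊
    refine ⟨i, ?_⟩
    rw [← Real.norm_eq_abs, ← coe_nnnorm, ← coe_nnnorm, ← hi, Pi.nnnorm_def,
      Finset.sup'_eq_sup]
  have hzi : 0 < |z i| := hi ▸ norm_pos_iff.2 hz
  cases d with
  | zero => exact i.elim0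
  | succ n =>
    have hmp := measurePreserving_piFinSuccAbove
      (fun _ : Fin (n + 1) => (volume : Measure ℝ).restrict (Icc 0 1)) i
    let B : Set (ℝ × (Fin n → ℝ)) :=
      {p | |p.1 * z i + ∑ l, p.2 l * z (i.succAbove l)| ≤ ρ * ‖z‖}
    have hB : MeasurableSet B := measurableSet_le (by fun_prop) (by fun_prop)
    have hpre : {a : Fin (n + 1) → ℝ | |∑ i, a i * z i| ≤ ρ * ‖z‖} =
        MeasurableEquiv.piFinSuccAbove (fun _ => ℝ) i ⁻¹' B := by
      ext a
      simp only [mem_ofPred_eq, mem_preimage, B, Fin.sum_univ_succAbove _ i]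
      rfl
    rw [hpre, cubeMeasure, hmp.measure_preimage hB.nullMeasurableSet,
      Measure.prod_apply_symm hB]
    refine (lintegral_mono (g := fun _ => ENNReal.ofReal (2 * ρ)) fun b => ?_).trans (by simp)
    refine (Measure.restrict_apply_le _ _).trans ?_
    have hsub : (fun t => (t, b)) ⁻¹' B ⊆
        closedBall (-(∑ l, b l * z (i.succAbove l)) / z i) ρ := by
      intro t ht
      have ht' : |t * z i + ∑ l, b l * z (i.succAbove l)| ≤ ρ * ‖z‖ := ht
      rw [mem_closedBall, Real.dist_eq, ← mul_le_mul_iff_left₀ hzi, ← abs_mul, ← hi]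
      refine le_trans (le_of_eq ?_) ht'
      congr 1
      field_simp [abs_pos.1 hzi]
      ring
    exact (measure_mono hsub).trans (by rw [Real.volume_closedBall])

/-- The linear functional with coefficients `a`. -/
def rowMap (a : Fin d → ℝ) : (Fin d → ℝ) →L[ℝ] ℝ :=
  ∑ l, a l • ContinuousLinearMap.proj (R := ℝ) (φ := fun _ : Fin d => ℝ) l

lemma rowMap_apply (a z : Fin d → ℝ) : rowMap a z = ∑ l, a l * z l := by
  simp [rowMap]

/-- The linear map with rows `A.1 i` and `A.2`. -/
def rowsMap (A : (Fin k → Fin d → ℝ) × (Fin d → ℝ)) : (Fin d → ℝ) →L[ℝ] (Fin k → ℝ) × ℝ :=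
  (ContinuousLinearMap.pi fun i => rowMap (A.1 i)).prod (rowMap A.2)

/-- The law of a matrix with independent rows, uniform in the unit cube. -/
def rowsMeasure (k d : ℕ) : Measure ((Fin k → Fin d → ℝ) × (Fin d → ℝ)) :=
  (Measure.pi fun _ => cubeMeasure d).prod (cubeMeasure d)

instance : IsProbabilityMeasure (rowsMeasure k d) := by
  unfold rowsMeasure
  infer_instance

lemma continuous_rowsMap : Continuous fun p : ((Fin k → Fin d → ℝ) × (Fin d → ℝ)) × (Fin d → ℝ) =>
    rowsMap p.1 p.2 := by
  have : (fun p : ((Fin k → Fin d → ℝ) × (Fin d → ℝ)) × (Fin d → ℝ) => rowsMap p.1 p.2) =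
      fun p => (fun i => ∑ l, p.1.1 i l * p.2 l, ∑ l, p.1.2 l * p.2 l) := by
    funext p
    simp [rowsMap, rowMap_apply]
  rw [this]
  fun_prop

lemma rowsMeasure_norm_le (z : Fin d → ℝ) (hz : z ≠ 0) (ρ : ℝ) :
    rowsMeasure k d {A | ‖rowsMap A z‖ ≤ ρ * ‖z‖} ≤ ENNReal.ofReal (2 * ρ) ^ (k + 1) := by
  have hsub : {A : (Fin k → Fin d → ℝ) × (Fin d → ℝ) | ‖rowsMap A z‖ ≤ ρ * ‖z‖} ⊆
      (Set.univ.pi fun _ => {a | |∑ i, a i * z i| ≤ ρ * ‖z‖}) ×ˢ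
        {a | |∑ i, a i * z i| ≤ ρ * ‖z‖} := by
    intro A hA
    have hA : ‖rowsMap A z‖ ≤ ρ * ‖z‖ := hA
    refine ⟨fun i _ => ?_, ?_⟩
    · change |∑ l, A.1 i l * z l| ≤ _
      rw [← rowMap_apply]
      exact ((norm_le_pi_norm (rowsMap A z).1 i).trans (norm_fst_le _)).trans hA
    · change |∑ l, A.2 l * z l| ≤ _
      rw [← rowMap_apply]
      exact (norm_snd_le (rowsMap A z)).trans hA
  refine (measure_mono hsub).trans ?_
  rw [rowsMeasure, Measure.prod_prod, Measure.pi_pi, Finset.prod_const, Finset.card_univ,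
    Fintype.card_fin, pow_succ]
  exact mul_le_mul' (pow_le_pow_left' (cubeMeasure_abs_dotProduct_le z hz ρ) k)
    (cubeMeasure_abs_dotProduct_le z hz ρ)

lemma ae_rowsMap_snd_ne_zero {z : Fin d → ℝ} (hz : z ≠ 0) :
    ∀ᵐ A ∂(rowsMeasure k d), (rowsMap A z).2 ≠ 0 := by
  rw [ae_iff]
  have h0 : cubeMeasure d {a | |∑ i, a i * z i| ≤ 0 * ‖z‖} = 0 := by
    simpa using cubeMeasure_abs_dotProduct_le z hz 0
  refine measure_mono_null (t := Set.univ ×ˢ {a | |∑ i, a i * z i| ≤ 0 * ‖z‖}) ?_ ?_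
  · intro A hA
    have hA : ¬ (rowsMap A z).2 ≠ 0 := hA
    refine ⟨mem_univ _, ?_⟩
    change |∑ l, A.2 l * z l| ≤ _
    rw [← rowMap_apply, show rowMap A.2 z = 0 from not_not.1 hA]
    simp
  · rw [rowsMeasure, Measure.prod_prod, h0, mul_zero]

lemma mul_rpow_neg (a : ℝ≥0∞) {b : ℝ≥0∞} (hb0 : b ≠ 0) (hb : b ≠ ∞) {s : ℝ} (hs : 0 ≤ s) :
    (a * b) ^ (-s) = a ^ (-s) * b ^ (-s) := by
  have h1 : b ^ s ≠ ∞ := ENNReal.rpow_ne_top_of_nonneg hs hb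
  have h0 : b ^ s ≠ 0 := by simp [ENNReal.rpow_eq_zero_iff, hb0, hb]
  rw [ENNReal.rpow_neg, ENNReal.rpow_neg, ENNReal.rpow_neg, ENNReal.mul_rpow_of_nonneg _ _ hs,
    ENNReal.mul_inv (Or.inr h1) (Or.inr h0)]

/-- The constant in `lintegral_enorm_rowsMap_rpow_neg_le`. -/
def rowsConst (k : ℕ) (s : ℝ) : ℝ≥0∞ := 1 + 2 ^ (k + 1) * dyadicConst s (k + 1)

lemma lintegral_enorm_rowsMap_rpow_neg_le {s : ℝ} (hs : 0 < s) (z : Fin d → ℝ) :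
    ∫⁻ A, ‖rowsMap A z‖ₑ ^ (-s) ∂(rowsMeasure k d) ≤ rowsConst k s * ‖z‖ₑ ^ (-s) := by
  rcases eq_or_ne z 0 with rfl | hz
  · rw [enorm_zero, ENNReal.zero_rpow_of_neg (by linarith), ENNReal.mul_top (by simp [rowsConst])]
    exact le_top
  have hz0 : ‖z‖ₑ ≠ 0 := by simpa using hz
  have hz1 : ‖z‖ₑ ≠ ∞ := by simp
  have hmeas : Measurable fun A : (Fin k → Fin d → ℝ) × (Fin d → ℝ) => ‖rowsMap A z‖ₑ * ‖z‖ₑ⁻¹ :=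
    ((continuous_rowsMap.comp (Continuous.prodMk_left z)).measurable.enorm).mul_const _
  have key := lintegral_rpow_neg_le (P := rowsMeasure k d) (s' := (k : ℝ) + 1)
    (C := 2 ^ (k + 1)) hmeas hs fun j => by
      have hsub : {A : (Fin k → Fin d → ℝ) × (Fin d → ℝ) |
          ‖rowsMap A z‖ₑ * ‖z‖ₑ⁻¹ < (2⁻¹ : ℝ≥0∞) ^ j} ⊆
          {A | ‖rowsMap A z‖ ≤ (2⁻¹ : ℝ) ^ j * ‖z‖} := by
        intro A hA
        have hA : ‖rowsMap A z‖ₑ * ‖z‖ₑ⁻¹ < (2⁻¹ : ℝ≥0∞) ^ j := hA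
        rw [← div_eq_mul_inv, ENNReal.div_lt_iff (Or.inl hz0) (Or.inl hz1)] at hA
        have h2 := ENNReal.toReal_mono (by finiteness) hA.le
        simpa using h2
      refine (measure_mono hsub).trans ((rowsMeasure_norm_le z hz _).trans (le_of_eq ?_))
      rw [ENNReal.ofReal_mul (by norm_num), mul_pow, dyadicWeight, ENNReal.ofReal_pow (by norm_num),
        ENNReal.ofReal_inv_of_pos (by norm_num)]
      norm_num
      rw [← Nat.cast_add_one, ENNReal.rpow_natCast]
  rw [measure_univ] at key
  calc ∫⁻ A, ‖rowsMap A z‖ₑ ^ (-s) ∂(rowsMeasure k d)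
      = ∫⁻ A, (‖rowsMap A z‖ₑ * ‖z‖ₑ⁻¹) ^ (-s) * ‖z‖ₑ ^ (-s) ∂(rowsMeasure k d) := by
        congr 1
        funext A
        rw [← mul_rpow_neg _ hz0 hz1 hs.le, mul_assoc, ENNReal.inv_mul_cancel hz0 hz1, mul_one]
    _ ≤ _ := by
        rw [lintegral_mul_const' _ _ (ENNReal.rpow_ne_top_of_ne_zero hz0 hz1)]
        exact mul_le_mul' key le_rfl

lemma rowsConst_ne_top {s : ℝ} (hs : 0 < s) (hsk : s < k + 1) : rowsConst k s ≠ ∞ :=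
  ENNReal.add_ne_top.2 ⟨ENNReal.one_ne_top,
    ENNReal.mul_ne_top (by finiteness) (dyadicConst_ne_top hs.le hsk)⟩

/-- The `s`-energy of a measure. -/
def rieszEnergy {E : Type*} [PseudoEMetricSpace E] [MeasurableSpace E] (s : ℝ) (μ : Measure E) :
    ℝ≥0∞ := ∫⁻ x, ∫⁻ y, edist x y ^ (-s) ∂μ ∂μ

lemma ae_rieszEnergy_map_rowsMap_lt_top {P : Measure (Fin d → ℝ)} [IsProbabilityMeasure P] {s : ℝ}
    (hs : 0 < s) (hsk : s < k + 1) (hP : rieszEnergy s P ≠ ∞) :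
    ∀ᵐ A ∂(rowsMeasure k d), ∫⁻ x, ∫⁻ y, ‖rowsMap A (x - y)‖ₑ ^ (-s) ∂P ∂P < ∞ := by
  have hm : Measurable fun p : ((Fin k → Fin d → ℝ) × (Fin d → ℝ)) ×
      ((Fin d → ℝ) × (Fin d → ℝ)) => ‖rowsMap p.1 (p.2.1 - p.2.2)‖ₑ ^ (-s) := by
    refine Measurable.pow_const (Measurable.enorm ?_) _
    exact (continuous_rowsMap.comp (f := fun p : ((Fin k → Fin d → ℝ) × (Fin d → ℝ)) ×
      ((Fin d → ℝ) × (Fin d → ℝ)) => (p.1, p.2.1 - p.2.2)) (by fun_prop)).measurable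
  have hA : ∀ A : (Fin k → Fin d → ℝ) × (Fin d → ℝ),
      ∫⁻ x, ∫⁻ y, ‖rowsMap A (x - y)‖ₑ ^ (-s) ∂P ∂P =
      ∫⁻ p, ‖rowsMap A (p.1 - p.2)‖ₑ ^ (-s) ∂(P.prod P) := fun A =>
    (lintegral_prod (fun p : (Fin d → ℝ) × (Fin d → ℝ) => ‖rowsMap A (p.1 - p.2)‖ₑ ^ (-s))
      (hm.comp measurable_prodMk_left).aemeasurable).symm
  simp_rw [hA]
  refine ae_lt_top hm.lintegral_prod_right' (ne_top_of_le_ne_top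
    (ENNReal.mul_ne_top (rowsConst_ne_top hs hsk) hP) ?_)
  rw [lintegral_lintegral_swap hm.aemeasurable]
  refine (lintegral_mono fun p => lintegral_enorm_rowsMap_rpow_neg_le hs _).trans (le_of_eq ?_)
  rw [lintegral_const_mul' _ _ (rowsConst_ne_top hs hsk), rieszEnergy,
    lintegral_prod _ (by fun_prop)]
  simp_rw [edist_eq_enorm_sub]

/-- A linear map onto a space of dimension `k + 1` which keeps two energies finite. -/
theorem exists_linear_rieszEnergy_lt_top {P Q : Measure (Fin d → ℝ)} [IsProbabilityMeasure P]
    [IsProbabilityMeasure Q] {s t : ℝ} (hs : 0 < s) (hsk : s < k + 1) (ht : 0 < t) (htk : t < k + 1)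
    (hP : rieszEnergy s P ≠ ∞) (hQ : rieszEnergy t Q ≠ ∞) {z : Fin d → ℝ} (hz : z ≠ 0) {a : ℝ}
    (ha : a ≠ 0) :
    ∃ A : (Fin d → ℝ) →L[ℝ] (Fin k → ℝ) × ℝ, (A z).2 = a ∧
      ∫⁻ x, ∫⁻ y, edist (A x) (A y) ^ (-s) ∂P ∂P < ∞ ∧
      ∫⁻ x, ∫⁻ y, edist (A x) (A y) ^ (-t) ∂Q ∂Q < ∞ := by
  obtain ⟨A, h1, h2, h3⟩ := ((ae_rowsMap_snd_ne_zero (k := k) hz).and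
    ((ae_rieszEnergy_map_rowsMap_lt_top hs hsk hP).and
    (ae_rieszEnergy_map_rowsMap_lt_top ht htk hQ))).exists
  set b : ℝ := a / (rowsMap A z).2 with hb
  have hb0 : b ≠ 0 := div_ne_zero ha h1
  have hbe : ‖b‖ₑ ≠ 0 := by simpa using hb0
  have key : ∀ r : ℝ, 0 < r → ∀ x y, edist ((b • rowsMap A) x) ((b • rowsMap A) y) ^ (-r) =
      ‖b‖ₑ ^ (-r) * ‖rowsMap A (x - y)‖ₑ ^ (-r) := fun r hr x y => by
    rw [edist_eq_enorm_sub, ← map_sub, _root_.smul_apply, enorm_smul, mul_comm,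
      mul_rpow_neg _ hbe (by simp) hr.le, mul_comm]
  have hbt : ∀ r : ℝ, ‖b‖ₑ ^ (-r) ≠ ∞ := fun r => ENNReal.rpow_ne_top_of_ne_zero hbe (by simp)
  refine ⟨b • rowsMap A, ?_, ?_, ?_⟩
  · simp [hb, h1]
  · simp_rw [key s hs, lintegral_const_mul' _ _ (hbt s)]
    exact ENNReal.mul_lt_top (hbt s).lt_top h2
  · simp_rw [key t ht, lintegral_const_mul' _ _ (hbt t)]
    exact ENNReal.mul_lt_top (hbt t).lt_top h3

end GenericLinear

/-! ### Slopes and tubes -/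

section Tubes

variable {k : ℕ}

/-- The slope of the line through `x` and `y`. -/
def lineSlope (x y : (Fin k → ℝ) × ℝ) : Fin k → ℝ := (y.2 - x.2)⁻¹ • (y.1 - x.1)

/-- The projection along the direction `(b, 1)` onto the horizontal hyperplane. -/
def shear (b : Fin k → ℝ) (z : (Fin k → ℝ) × ℝ) : Fin k → ℝ := z.1 - z.2 • b

/-- The mass of the tube of width `r` with apex `y` and slope `b`. -/
def tubeMass (μ : Measure ((Fin k → ℝ) × ℝ)) (y : (Fin k → ℝ) × ℝ) (b : Fin k → ℝ) (r : ℝ) :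
    ℝ≥0∞ := μ {x | ‖lineSlope x y - b‖ ≤ r}

lemma lineSlope_comm (x y : (Fin k → ℝ) × ℝ) : lineSlope x y = lineSlope y x := by
  rw [lineSlope, lineSlope, ← neg_sub x.2 y.2, ← neg_sub x.1 y.1, inv_neg, smul_neg, neg_smul,
    neg_neg]

lemma shear_sub (b : Fin k → ℝ) (z z' : (Fin k → ℝ) × ℝ) :
    shear b (z - z') = shear b z - shear b z' := by
  simp only [shear, Prod.fst_sub, Prod.snd_sub, sub_smul]
  abel

lemma shear_sub_eq_smul {x y : (Fin k → ℝ) × ℝ} (h : 1 ≤ |y.2 - x.2|) (b : Fin k → ℝ) :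
    shear b (y - x) = (y.2 - x.2) • (lineSlope x y - b) := by
  have h0 : y.2 - x.2 ≠ 0 := fun h0 => by norm_num [h0] at h
  rw [smul_sub, lineSlope, smul_smul, mul_inv_cancel₀ h0, one_smul]
  rfl

lemma norm_lineSlope_sub_le {x y : (Fin k → ℝ) × ℝ} (h : 1 ≤ |y.2 - x.2|) (b : Fin k → ℝ) :
    ‖lineSlope x y - b‖ ≤ ‖shear b (y - x)‖ := by
  rw [shear_sub_eq_smul h, norm_smul, Real.norm_eq_abs]
  exact le_mul_of_one_le_left (norm_nonneg _) h

lemma norm_shear_le {x y : (Fin k → ℝ) × ℝ} {L : ℝ} (h : 1 ≤ |y.2 - x.2|) (hx : ‖x‖ ≤ L)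
    (hy : ‖y‖ ≤ L) (b : Fin k → ℝ) : ‖shear b (y - x)‖ ≤ 2 * L * ‖lineSlope x y - b‖ := by
  rw [shear_sub_eq_smul h, norm_smul]
  refine mul_le_mul_of_nonneg_right ?_ (norm_nonneg _)
  exact (norm_snd_le (y - x)).trans ((norm_sub_le _ _).trans (by linarith))

lemma norm_lineSlope_le {x y : (Fin k → ℝ) × ℝ} {L : ℝ} (h : 1 ≤ |y.2 - x.2|) (hx : ‖x‖ ≤ L)
    (hy : ‖y‖ ≤ L) : ‖lineSlope x y‖ ≤ 2 * L := by
  have := norm_lineSlope_sub_le h 0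
  rw [sub_zero] at this
  refine this.trans ?_
  simp only [shear, smul_zero, sub_zero]
  exact (norm_fst_le (y - x)).trans ((norm_sub_le _ _).trans (by linarith))

lemma measurable_lineSlope :
    Measurable fun p : ((Fin k → ℝ) × ℝ) × ((Fin k → ℝ) × ℝ) => lineSlope p.1 p.2 := by
  unfold lineSlope
  fun_prop

lemma Measurable.lineSlope {α : Type*} [MeasurableSpace α] {f g : α → (Fin k → ℝ) × ℝ}
    (hf : Measurable f) (hg : Measurable g) : Measurable fun a => lineSlope (f a) (g a) :=
  measurable_lineSlope.comp (hf.prodMk hg)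

lemma continuous_shear :
    Continuous fun p : (Fin k → ℝ) × ((Fin k → ℝ) × ℝ) => shear p.1 p.2 := by
  unfold shear
  fun_prop

lemma Measurable.shear {α : Type*} [MeasurableSpace α] {f : α → Fin k → ℝ}
    {g : α → (Fin k → ℝ) × ℝ} (hf : Measurable f) (hg : Measurable g) :
    Measurable fun a => shear (f a) (g a) :=
  continuous_shear.measurable.comp (hf.prodMk hg)

lemma measurable_tubeMass (μ : Measure ((Fin k → ℝ) × ℝ)) [SFinite μ] (r : ℝ) :
    Measurable fun p : ((Fin k → ℝ) × ℝ) × (Fin k → ℝ) => tubeMass μ p.1 p.2 r := by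
  have hW : MeasurableSet {q : (((Fin k → ℝ) × ℝ) × (Fin k → ℝ)) × ((Fin k → ℝ) × ℝ) |
      ‖lineSlope q.2 q.1.1 - q.1.2‖ ≤ r} :=
    measurableSet_le (((measurable_snd.lineSlope measurable_fst.fst).sub
      measurable_fst.snd).norm) measurable_const
  exact measurable_measure_prodMk_left hW

lemma measurable_tubeMass_right (μ : Measure ((Fin k → ℝ) × ℝ)) [SFinite μ]
    (y : (Fin k → ℝ) × ℝ) (r : ℝ) : Measurable fun b => tubeMass μ y b r := by
  have h := (measurable_tubeMass μ r).comp (measurable_prodMk_left (x := y))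
  exact h

lemma tubeMass_mono {μ : Measure ((Fin k → ℝ) × ℝ)} {y : (Fin k → ℝ) × ℝ} {b b' : Fin k → ℝ}
    {r r' : ℝ} (h : r + ‖b - b'‖ ≤ r') : tubeMass μ y b r ≤ tubeMass μ y b' r' := by
  refine measure_mono fun x (hx : ‖lineSlope x y - b‖ ≤ r) => ?_
  change ‖lineSlope x y - b'‖ ≤ r'
  linarith [norm_sub_le_norm_sub_add_norm_sub (lineSlope x y) b b']

lemma volume_closedBall_fin (b : Fin k → ℝ) {r : ℝ} (hr : 0 ≤ r) :
    volume (closedBall b r) = ENNReal.ofReal ((2 * r) ^ k) := by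
  rw [Real.volume_pi_closedBall _ hr, Fintype.card_fin]

/-- Integrating tube masses over a ball of slopes. -/
lemma lintegral_tubeMass_closedBall_le (μ : Measure ((Fin k → ℝ) × ℝ)) [SFinite μ]
    (y : (Fin k → ℝ) × ℝ) (b₁ : Fin k → ℝ) {δ r : ℝ} (hδ : 0 ≤ δ) :
    ∫⁻ b in closedBall b₁ r, tubeMass μ y b δ ≤
      ENNReal.ofReal ((2 * δ) ^ k) * tubeMass μ y b₁ (r + δ) := by
  let W : Set ((Fin k → ℝ) × ((Fin k → ℝ) × ℝ)) := {q | ‖lineSlope q.2 y - q.1‖ ≤ δ}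
  have hW : MeasurableSet W := measurableSet_le
    (((measurable_snd.lineSlope measurable_const).sub measurable_fst).norm) measurable_const
  have h1 : ∫⁻ b in closedBall b₁ r, tubeMass μ y b δ =
      ((volume.restrict (closedBall b₁ r)).prod μ) W := (Measure.prod_apply hW).symm
  have h2 : ∀ x, volume.restrict (closedBall b₁ r) ((fun b => (b, x)) ⁻¹' W) ≤
      {x | ‖lineSlope x y - b₁‖ ≤ r + δ}.indicator
        (fun _ => ENNReal.ofReal ((2 * δ) ^ k)) x := by
    intro x
    rcases em (‖lineSlope x y - b₁‖ ≤ r + δ) with hx | hx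
    · rw [indicator_of_mem (by exact hx), ← volume_closedBall_fin (lineSlope x y) hδ]
      refine (Measure.restrict_apply_le _ _).trans (measure_mono fun b hb => ?_)
      rw [mem_closedBall', dist_eq_norm]
      exact hb
    · have : (fun b => (b, x)) ⁻¹' W ∩ closedBall b₁ r = ∅ := by
        refine eq_empty_of_forall_notMem fun b hb => hx ?_
        have h1 : ‖lineSlope x y - b‖ ≤ δ := hb.1
        have h2 := mem_closedBall.1 hb.2
        rw [dist_eq_norm] at h2
        linarith [norm_sub_le_norm_sub_add_norm_sub (lineSlope x y) b b₁]
      rw [Measure.restrict_apply (measurable_prodMk_right hW), this, measure_empty]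
      exact zero_le
  rw [h1, Measure.prod_apply_symm hW]
  exact (lintegral_mono h2).trans (lintegral_indicator_const_le _ _)

/-- Slopes whose tubes are heavy but not concentrated form a set of small volume. -/
lemma volume_heavy_inter_closedBall_le {μ : Measure ((Fin k → ℝ) × ℝ)} [SFinite μ]
    {y : (Fin k → ℝ) × ℝ} {S : Set (Fin k → ℝ)} {a δ K σ : ℝ} (hδ : 0 < δ)
    (hS : ∀ b ∈ S, ENNReal.ofReal a ≤ tubeMass μ y b (2 * δ))
    (hS' : ∀ b ∈ S, ∀ r, δ ≤ r → tubeMass μ y b r ≤ ENNReal.ofReal (K * r ^ σ))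
    (b₀ : Fin k → ℝ) {r : ℝ} (hr : δ ≤ r) :
    ENNReal.ofReal a * volume (S ∩ closedBall b₀ r) ≤
      ENNReal.ofReal ((4 * δ) ^ k * (K * (4 * r) ^ σ)) := by
  rcases (S ∩ closedBall b₀ r).eq_empty_or_nonempty with h | ⟨b₁, hb₁S, hb₁⟩
  · simp [h]
  have hm : Measurable fun b => tubeMass μ y b (2 * δ) := measurable_tubeMass_right μ y (2 * δ)
  have hsub : S ∩ closedBall b₀ r ⊆ closedBall b₁ (2 * r) := fun b hb => by
    have h1 := mem_closedBall.1 hb.2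
    have h2 := mem_closedBall'.1 hb₁
    exact mem_closedBall.2 ((dist_triangle b b₀ b₁).trans (by linarith))
  have h1 : ENNReal.ofReal a * volume (S ∩ closedBall b₀ r) ≤
      ∫⁻ b in S ∩ closedBall b₀ r, tubeMass μ y b (2 * δ) := by
    rw [← setLIntegral_const]
    exact setLIntegral_mono hm fun b hb => hS b hb.1
  have h2 : tubeMass μ y b₁ (2 * r + 2 * δ) ≤ tubeMass μ y b₁ (4 * r) :=
    tubeMass_mono (by rw [sub_self, norm_zero]; linarith)
  refine (h1.trans (lintegral_mono_set hsub)).trans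
    ((lintegral_tubeMass_closedBall_le μ y b₁ (by positivity)).trans ?_)
  rw [ENNReal.ofReal_mul (by positivity), ← mul_assoc, show (2 : ℝ) * 2 = 4 by norm_num]
  exact mul_le_mul' le_rfl (h2.trans (hS' b₁ hb₁S _ (by linarith)))

/-- Two slopes which nearly annihilate the same vector are close to each other. -/
lemma norm_sub_le_of_norm_shear_le {b b₀ : Fin k → ℝ} {z : (Fin k → ℝ) × ℝ} (hz : z ≠ 0)
    {L δ : ℝ} (hδ : 0 < δ) (hL : 1 ≤ L) (hb : ‖b‖ ≤ L) (hb₀ : ‖b₀‖ ≤ L)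
    (h : ‖shear b z‖ ≤ 2 * δ) (h₀ : ‖shear b₀ z‖ ≤ 2 * δ) :
    ‖b - b₀‖ ≤ (4 + 2 * L) * (L + 2) * δ / ‖z‖ := by
  have hz' : 0 < ‖z‖ := norm_pos_iff.2 hz
  have h1 : |z.2| * ‖b - b₀‖ ≤ 4 * δ := by
    rw [← Real.norm_eq_abs, ← norm_smul]
    have : z.2 • (b - b₀) = shear b₀ z - shear b z := by
      simp only [shear, smul_sub]
      abel
    rw [this]
    linarith [norm_sub_le (shear b₀ z) (shear b z)]
  have h2 : ‖z.1‖ ≤ 2 * δ + |z.2| * L := by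
    have : z.1 = shear b z + z.2 • b := by simp [shear]
    rw [this]
    refine (norm_add_le _ _).trans (add_le_add h ?_)
    rw [norm_smul, Real.norm_eq_abs]
    exact mul_le_mul_of_nonneg_left hb (abs_nonneg _)
  have h3 : ‖b - b₀‖ ≤ 2 * L := (norm_sub_le _ _).trans (by linarith)
  have h0 := norm_nonneg (b - b₀)
  rw [le_div_iff₀ hz']
  rcases le_or_gt δ |z.2| with hc | hc
  · have h4 : ‖z‖ ≤ (L + 2) * |z.2| := by
      refine max_le ?_ ?_
      · nlinarith
      · rw [Real.norm_eq_abs]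
        nlinarith [abs_nonneg z.2]
    calc ‖b - b₀‖ * ‖z‖ ≤ ‖b - b₀‖ * ((L + 2) * |z.2|) := by gcongr
      _ = (L + 2) * (|z.2| * ‖b - b₀‖) := by ring
      _ ≤ (L + 2) * (4 * δ) := by gcongr
      _ ≤ (4 + 2 * L) * (L + 2) * δ := by nlinarith [mul_pos hδ (by linarith : 0 < L + 2)]
  · have h4 : ‖z‖ ≤ (L + 2) * δ := by
      refine max_le ?_ ?_
      · nlinarith
      · rw [Real.norm_eq_abs]
        nlinarith [abs_nonneg z.2]
    calc ‖b - b₀‖ * ‖z‖ ≤ (2 * L) * ((L + 2) * δ) := by gcongr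
      _ ≤ (4 + 2 * L) * (L + 2) * δ := by nlinarith [mul_pos hδ (by linarith : 0 < L + 2)]

end Tubes

/-! ### Autocorrelations of mean-zero kernels -/

section Autocorrelation

variable {k : ℕ}

/-- A bounded mean-zero kernel supported in a ball of radius `R`. -/
structure IsMeanZeroKernel (g : (Fin k → ℝ) → ℝ) (M R I : ℝ) : Prop where
  measurable : Measurable g
  abs_le : ∀ a, |g a| ≤ M
  eq_zero : ∀ a, R < ‖a‖ → g a = 0
  integral_eq_zero : ∫ a, g a = 0
  integral_abs_le : ∫ a, |g a| ≤ I

namespace IsMeanZeroKernel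

variable {g : (Fin k → ℝ) → ℝ} {M R I : ℝ}

lemma integrable (hg : IsMeanZeroKernel g M R I) : Integrable g := by
  have h : IntegrableOn g (closedBall 0 R) :=
    Measure.integrableOn_of_bounded (M := M) measure_closedBall_lt_top.ne
      hg.measurable.aestronglyMeasurable (Filter.Eventually.of_forall hg.abs_le)
  refine h.integrable_of_forall_notMem_eq_zero fun a ha => hg.eq_zero a ?_
  simpa using ha

lemma nonneg (hg : IsMeanZeroKernel g M R I) : 0 ≤ M := (abs_nonneg _).trans (hg.abs_le 0)

lemma measurable_autocorr (hg : IsMeanZeroKernel g M R I) :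
    Measurable fun u => ∫ a, g a * g (a + u) := by
  have h : StronglyMeasurable fun p : (Fin k → ℝ) × (Fin k → ℝ) => g p.2 * g (p.2 + p.1) :=
    ((hg.measurable.comp measurable_snd).mul
      (hg.measurable.comp (measurable_snd.add measurable_fst))).stronglyMeasurable
  exact h.integral_prod_right.measurable

lemma integrable_mul_comp_add (hg : IsMeanZeroKernel g M R I) (u : Fin k → ℝ) :
    Integrable fun a => g a * g (a + u) :=
  hg.integrable.mul_bdd (c := M) (hg.measurable.comp (measurable_add_const u)).aestronglyMeasurable
    (Filter.Eventually.of_forall fun _ => hg.abs_le _)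

lemma abs_autocorr_le (hg : IsMeanZeroKernel g M R I) (u : Fin k → ℝ) :
    |∫ a, g a * g (a + u)| ≤ I * M := by
  refine abs_integral_le_integral_abs.trans ?_
  calc ∫ a, |g a * g (a + u)| ≤ ∫ a, |g a| * M := by
        refine integral_mono (hg.integrable_mul_comp_add u).abs (hg.integrable.abs.mul_const M)
          fun a => ?_
        change |g a * g (a + u)| ≤ _
        rw [abs_mul]
        exact mul_le_mul_of_nonneg_left (hg.abs_le _) (abs_nonneg _)
    _ = (∫ a, |g a|) * M := integral_mul_const _ _
    _ ≤ I * M := mul_le_mul_of_nonneg_right hg.integral_abs_le hg.nonneg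

/-- The autocorrelation of a mean-zero kernel is a mean-zero kernel. -/
lemma autocorr (hg : IsMeanZeroKernel g M R I) :
    IsMeanZeroKernel (fun u => ∫ a, g a * g (a + u)) (I * M) (2 * R) (I * I) := by
  have hf : Integrable (Function.uncurry fun u a => g a * g (a + u))
      ((volume : Measure (Fin k → ℝ)).prod volume) := by
    refine (integrable_prod_iff' ?_).2 ⟨Filter.Eventually.of_forall fun a => ?_, ?_⟩
    · exact ((hg.measurable.comp measurable_snd).mul
        (hg.measurable.comp (measurable_snd.add measurable_fst))).aestronglyMeasurable
    · exact (hg.integrable.comp_add_left a).const_mul (g a)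
    · have : (fun a => ∫ u, ‖Function.uncurry (fun u a => g a * g (a + u)) (u, a)‖) =
          fun a => |g a| * ∫ u, |g u| := by
        ext a
        simp only [Function.uncurry_apply_pair, norm_mul, Real.norm_eq_abs]
        rw [integral_const_mul, integral_add_left_eq_self (fun u => |g u|) a]
      rw [this]
      exact hg.integrable.abs.mul_const _
  have hI : 0 ≤ ∫ a, |g a| := integral_nonneg fun _ => abs_nonneg _
  refine ⟨hg.measurable_autocorr, hg.abs_autocorr_le, fun u hu => ?_, ?_, ?_⟩
  · have : (fun a => g a * g (a + u)) = fun _ => 0 := by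
      ext a
      rcases le_or_gt ‖a‖ R with ha | ha
      · rw [hg.eq_zero (a + u), mul_zero]
        have := norm_sub_le (a + u) a
        rw [add_sub_cancel_left] at this
        linarith
      · rw [hg.eq_zero a ha, zero_mul]
    rw [this, integral_zero]
  · rw [integral_integral_swap hf]
    simp_rw [integral_const_mul, integral_add_left_eq_self g, hg.integral_eq_zero, mul_zero,
      integral_zero]
  · calc ∫ u, |∫ a, g a * g (a + u)| ≤ ∫ u, ∫ a, |g a * g (a + u)| := by
          refine integral_mono hf.integral_prod_left.abs hf.abs.integral_prod_left
            fun u => abs_integral_le_integral_abs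
      _ = ∫ a, ∫ u, |g a * g (a + u)| := integral_integral_swap hf.abs
      _ = (∫ a, |g a|) * ∫ a, |g a| := by
          simp_rw [abs_mul, integral_const_mul, integral_add_left_eq_self (fun u => |g u|),
            integral_mul_const]
      _ ≤ I * I := mul_le_mul hg.integral_abs_le hg.integral_abs_le hI
          (hI.trans hg.integral_abs_le)

end IsMeanZeroKernel

/-- The difference of two normalized ball indicators is a mean-zero kernel. -/
lemma isMeanZeroKernel_ball_sub_ball {r R : ℝ} (hr : 0 < r) (hrR : r ≤ R) :
    IsMeanZeroKernel (fun a : Fin k → ℝ =>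
      (closedBall 0 r).indicator (fun _ => ((2 * r) ^ k)⁻¹) a -
        (closedBall 0 R).indicator (fun _ => ((2 * R) ^ k)⁻¹) a) (((2 * r) ^ k)⁻¹) R 2 := by
  have hR := hr.trans_le hrR
  have hm : ∀ ρ : ℝ, Measurable
      ((closedBall (0 : Fin k → ℝ) ρ).indicator fun _ => ((2 * ρ) ^ k)⁻¹) := fun ρ =>
    measurable_const.indicator measurableSet_closedBall
  have hi : ∀ ρ : ℝ, Integrable
      ((closedBall (0 : Fin k → ℝ) ρ).indicator fun _ => ((2 * ρ) ^ k)⁻¹) := fun ρ =>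
    (integrable_indicator_iff measurableSet_closedBall).2
      (integrableOn_const measure_closedBall_lt_top.ne)
  have h1 : ∀ ρ : ℝ, 0 < ρ →
      ∫ a : Fin k → ℝ, (closedBall 0 ρ).indicator (fun _ => ((2 * ρ) ^ k)⁻¹) a = 1 := by
    intro ρ hρ
    rw [integral_indicator measurableSet_closedBall, setIntegral_const, measureReal_def,
      volume_closedBall_fin _ hρ.le, ENNReal.toReal_ofReal (by positivity), smul_eq_mul,
      mul_inv_cancel₀ (by positivity)]
  have h0 : ∀ ρ : ℝ, 0 < ρ → ∀ a,
      0 ≤ (closedBall (0 : Fin k → ℝ) ρ).indicator (fun _ => ((2 * ρ) ^ k)⁻¹) a :=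
    fun ρ hρ a => indicator_nonneg (fun _ _ => by positivity) a
  have h2 : ((2 * R) ^ k)⁻¹ ≤ ((2 * r) ^ k)⁻¹ := by gcongr
  have h3 : ∀ ρ : ℝ, 0 < ρ → ∀ a,
      (closedBall (0 : Fin k → ℝ) ρ).indicator (fun _ => ((2 * ρ) ^ k)⁻¹) a ≤ ((2 * ρ) ^ k)⁻¹ :=
    fun ρ hρ a => indicator_le_self' (fun _ _ => by positivity) a
  refine ⟨(hm r).sub (hm R), fun a => ?_, fun a ha => ?_, ?_, ?_⟩
  · rw [abs_le]
    constructor <;> linarith [h0 r hr a, h0 R hR a, h3 r hr a, h3 R hR a]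
  · rw [indicator_of_notMem, indicator_of_notMem, sub_zero]
    · simpa using ha
    · simpa using hrR.trans_lt ha
  · rw [integral_sub (hi r) (hi R), h1 r hr, h1 R hR, sub_self]
  · calc _ ≤ ∫ a : Fin k → ℝ, ((closedBall 0 r).indicator (fun _ => ((2 * r) ^ k)⁻¹) a +
          (closedBall 0 R).indicator (fun _ => ((2 * R) ^ k)⁻¹) a) := by
          refine integral_mono ((hi r).sub (hi R)).abs ((hi r).add (hi R)) fun a => ?_
          refine (abs_sub _ _).trans_eq ?_
          simp only [abs_of_nonneg (h0 r hr a), abs_of_nonneg (h0 R hR a)]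
      _ = 2 := by rw [integral_add (hi r) (hi R), h1 r hr, h1 R hR]; norm_num

end Autocorrelation

/-! ### Averages of a mean-zero kernel over shears -/

section ShearAverage

variable {k : ℕ}

lemma integral_comp_shear (f : (Fin k → ℝ) → ℝ) (z : (Fin k → ℝ) × ℝ) :
    ∫ b, f (shear b z) = (|z.2| ^ k)⁻¹ * ∫ a, f a := by
  have h := Measure.integral_comp_smul volume (fun a => f (z.1 - a)) z.2
  rw [integral_sub_left_eq_self, Module.finrank_fin_fun, smul_eq_mul, abs_inv, abs_pow] at h
  exact h

lemma integrable_comp_shear {f : (Fin k → ℝ) → ℝ} (hf : Integrable f) {z : (Fin k → ℝ) × ℝ}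
    (hz : z.2 ≠ 0) : Integrable fun b => f (shear b z) := by
  have h1 : Integrable fun a => f (z.1 - a) := hf.comp_sub_left z.1
  exact h1.comp_smul hz

/-- A cutoff function: a `1`-Lipschitz function with values in `[0, 1]` supported in a ball. -/
structure IsCutoff (χ : (Fin k → ℝ) → ℝ) (L : ℝ) : Prop where
  lipschitz : LipschitzWith 1 χ
  nonneg : ∀ b, 0 ≤ χ b
  le_one : ∀ b, χ b ≤ 1
  eq_zero : ∀ b, L < ‖b‖ → χ b = 0

lemma exists_isCutoff (L : ℝ) :
    ∃ χ : (Fin k → ℝ) → ℝ, IsCutoff χ (L + 1) ∧ ∀ b, ‖b‖ ≤ L → χ b = 1 := by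
  refine ⟨fun b => max 0 (min 1 (L + 1 - ‖b‖)), ⟨?_, fun b => le_max_left _ _, fun b =>
    max_le zero_le_one (min_le_left _ _), fun b hb => ?_⟩, fun b hb => ?_⟩
  · have h1 : LipschitzWith 1 fun b : Fin k → ℝ => L + 1 - ‖b‖ := by
      simpa using (LipschitzWith.const (L + 1)).sub (lipschitzWith_one_norm (E := Fin k → ℝ))
    exact (h1.const_min 1).const_max 0
  · exact max_eq_left ((min_le_right _ _).trans (by linarith))
  · change max 0 (min 1 (L + 1 - ‖b‖)) = 1
    rw [min_eq_left (by linarith), max_eq_right zero_le_one]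

namespace IsCutoff

variable {χ : (Fin k → ℝ) → ℝ} {L : ℝ}

lemma measurable (hχ : IsCutoff χ L) : Measurable χ := hχ.lipschitz.continuous.measurable

lemma abs_le_one (hχ : IsCutoff χ L) (b : Fin k → ℝ) : |χ b| ≤ 1 := by
  rw [abs_of_nonneg (hχ.nonneg b)]
  exact hχ.le_one b

lemma integrable (hχ : IsCutoff χ L) : Integrable χ := by
  have h : IntegrableOn χ (closedBall 0 L) :=
    Measure.integrableOn_of_bounded (M := 1) measure_closedBall_lt_top.ne
      hχ.measurable.aestronglyMeasurable (Filter.Eventually.of_forall hχ.abs_le_one)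
  refine h.integrable_of_forall_notMem_eq_zero fun b hb => hχ.eq_zero b ?_
  simpa using hb

lemma integral_abs_le (hχ : IsCutoff χ L) (hL : 0 ≤ L) : ∫ b, |χ b| ≤ (2 * L) ^ k := by
  have h1 : (∫ b in closedBall 0 L, |χ b|) = ∫ b, |χ b| := by
    refine setIntegral_eq_integral_of_forall_compl_eq_zero fun b hb => ?_
    rw [hχ.eq_zero b (by simpa using hb), abs_zero]
  rw [← h1]
  calc ∫ b in closedBall 0 L, |χ b| ≤ ∫ _ in closedBall (0 : Fin k → ℝ) L, (1 : ℝ) :=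
        integral_mono hχ.integrable.abs.integrableOn
          (integrableOn_const measure_closedBall_lt_top.ne) hχ.abs_le_one
    _ = (2 * L) ^ k := by
        rw [setIntegral_const, measureReal_def, volume_closedBall_fin _ hL,
          ENNReal.toReal_ofReal (by positivity), smul_eq_mul, mul_one]

end IsCutoff

variable {χ G : (Fin k → ℝ) → ℝ} {L M R I : ℝ}

lemma abs_integral_cutoff_mul_shear_le (hχ : IsCutoff χ L) (hL : 0 ≤ L)
    (hG : IsMeanZeroKernel G M R I) (z : (Fin k → ℝ) × ℝ) :
    |∫ b, χ b * G (shear b z)| ≤ M * (2 * L) ^ k := by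
  calc |∫ b, χ b * G (shear b z)| ≤ ∫ b, |χ b| * M := by
        refine abs_integral_le_integral_abs.trans (integral_mono_of_nonneg
          (Filter.Eventually.of_forall fun b => abs_nonneg _)
          (hχ.integrable.abs.mul_const M) (Filter.Eventually.of_forall fun b => ?_))
        change |χ b * G (shear b z)| ≤ _
        rw [abs_mul]
        exact mul_le_mul_of_nonneg_left (hG.abs_le _) (abs_nonneg _)
    _ = M * ∫ b, |χ b| := by rw [integral_mul_const, mul_comm]
    _ ≤ M * (2 * L) ^ k := mul_le_mul_of_nonneg_left (hχ.integral_abs_le hL) hG.nonneg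

lemma integral_cutoff_mul_shear_eq_zero (hχ : IsCutoff χ L)
    (hG : IsMeanZeroKernel G M R I) {z : (Fin k → ℝ) × ℝ} (hz : R + L * |z.2| < ‖z.1‖) :
    ∫ b, χ b * G (shear b z) = 0 := by
  refine integral_eq_zero_of_ae (Filter.Eventually.of_forall fun b => ?_)
  change χ b * G (shear b z) = 0
  rcases le_or_gt ‖b‖ L with hb | hb
  · rw [hG.eq_zero, mul_zero]
    have h1 := norm_sub_norm_le z.1 (z.2 • b)
    rw [norm_smul, Real.norm_eq_abs] at h1
    have h2 : |z.2| * ‖b‖ ≤ |z.2| * L := by gcongr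
    change R < ‖z.1 - z.2 • b‖
    linarith
  · rw [hχ.eq_zero b hb, zero_mul]

lemma abs_integral_cutoff_mul_shear_le_of_ne (hχ : IsCutoff χ L)
    (hG : IsMeanZeroKernel G M R I) (hR : 0 ≤ R) {z : (Fin k → ℝ) × ℝ} (hz : z.2 ≠ 0) :
    |∫ b, χ b * G (shear b z)| ≤ (|z.2| ^ k)⁻¹ * (R / |z.2| * I) := by
  have hi : Integrable fun b => G (shear b z) := integrable_comp_shear hG.integrable hz
  have h0 : ∫ b, G (shear b z) = 0 := by rw [integral_comp_shear, hG.integral_eq_zero, mul_zero]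
  set c := χ (z.2⁻¹ • z.1) with hc
  have h1 : ∫ b, χ b * G (shear b z) = ∫ b, (χ b - c) * G (shear b z) := by
    simp_rw [sub_mul]
    rw [integral_sub (hi.bdd_mul (c := 1) hχ.measurable.aestronglyMeasurable
      (Filter.Eventually.of_forall hχ.abs_le_one)) (hi.const_mul c), integral_const_mul, h0,
      mul_zero, sub_zero]
  have h2 : ∀ b, |(χ b - c) * G (shear b z)| ≤ R / |z.2| * |G (shear b z)| := by
    intro b
    rw [abs_mul]
    rcases le_or_gt ‖shear b z‖ R with hb | hb
    · refine mul_le_mul_of_nonneg_right ?_ (abs_nonneg _)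
      have h3 := hχ.lipschitz.dist_le_mul b (z.2⁻¹ • z.1)
      rw [NNReal.coe_one, one_mul, Real.dist_eq, dist_comm, dist_eq_norm] at h3
      refine h3.trans ((le_div_iff₀' (abs_pos.2 hz)).2 ?_)
      rw [← Real.norm_eq_abs, ← norm_smul, smul_sub, smul_smul, mul_inv_cancel₀ hz, one_smul]
      exact hb
    · rw [hG.eq_zero _ hb, abs_zero, mul_zero, mul_zero]
  rw [h1]
  calc |∫ b, (χ b - c) * G (shear b z)| ≤ ∫ b, R / |z.2| * |G (shear b z)| :=
        abs_integral_le_integral_abs.trans (integral_mono_of_nonneg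
          (Filter.Eventually.of_forall fun b => abs_nonneg _)
          (hi.abs.const_mul _) (Filter.Eventually.of_forall h2))
    _ = (|z.2| ^ k)⁻¹ * (R / |z.2| * ∫ a, |G a|) := by
        rw [integral_const_mul, integral_comp_shear fun a => |G a|]
        ring
    _ ≤ _ := by
        gcongr
        exact hG.integral_abs_le

/-- The average over shears of a mean-zero kernel decays like a Riesz kernel. -/
lemma abs_integral_cutoff_mul_shear_mul_rpow_le (hχ : IsCutoff χ L) (hL : 0 ≤ L)
    (hG : IsMeanZeroKernel G (2 * M) (2 * R) 4) (hR : 0 < R) (hMR : (R ^ k)⁻¹ ≤ 2 ^ k * M)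
    {s : ℝ} (hs : 0 ≤ s) (hsk : s ≤ k + 1) (z : (Fin k → ℝ) × ℝ) :
    |∫ b, χ b * G (shear b z)| * ‖z‖ ^ s ≤
      (2 * (2 * L) ^ k + 8 * 2 ^ k) * (L + 3) ^ s * M * R ^ s := by
  have hM : 0 ≤ M := by linarith [hG.nonneg]
  rcases lt_or_ge (2 * R + L * |z.2|) ‖z.1‖ with hz | hz
  · rw [integral_cutoff_mul_shear_eq_zero hχ hG hz, abs_zero, zero_mul]
    positivity
  rcases le_or_gt |z.2| R with hh | hh
  · have h1 : ‖z‖ ≤ (L + 3) * R := by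
      refine max_le ?_ ?_
      · nlinarith
      · rw [Real.norm_eq_abs]
        nlinarith
    calc _ ≤ (2 * M * (2 * L) ^ k) * ((L + 3) * R) ^ s := by
          gcongr
          exact abs_integral_cutoff_mul_shear_le hχ hL hG z
      _ = (2 * (2 * L) ^ k) * (L + 3) ^ s * M * R ^ s := by
          rw [Real.mul_rpow (by positivity) hR.le]
          ring
      _ ≤ _ := by
          gcongr
          linarith [show (0 : ℝ) ≤ 8 * 2 ^ k by positivity]
  · have hh0 : 0 < |z.2| := hR.trans hh
    have h1 : ‖z‖ ≤ (L + 3) * |z.2| := by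
      refine max_le ?_ ?_
      · nlinarith
      · rw [Real.norm_eq_abs]
        nlinarith
    have h2 : (|z.2| ^ k)⁻¹ * (R / |z.2|) ≤ 2 ^ k * M * (R / |z.2|) ^ s := by
      calc (|z.2| ^ k)⁻¹ * (R / |z.2|) = (R ^ k)⁻¹ * (R / |z.2|) ^ ((k : ℝ) + 1) := by
            rw [Real.rpow_add_one (by positivity), Real.rpow_natCast, div_pow]
            field_simp
        _ ≤ (2 ^ k * M) * (R / |z.2|) ^ s := by
            refine mul_le_mul hMR ?_ (by positivity) (by positivity)
            exact Real.rpow_le_rpow_of_exponent_ge (by positivity)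
              ((div_le_one hh0).2 hh.le) hsk
    calc _ ≤ ((|z.2| ^ k)⁻¹ * ((2 * R) / |z.2| * 4)) * ((L + 3) * |z.2|) ^ s := by
          gcongr
          exact abs_integral_cutoff_mul_shear_le_of_ne hχ hG (by positivity)
            (abs_pos.1 hh0)
      _ = 8 * ((|z.2| ^ k)⁻¹ * (R / |z.2|)) * ((L + 3) * |z.2|) ^ s := by ring
      _ ≤ 8 * (2 ^ k * M * (R / |z.2|) ^ s) * ((L + 3) * |z.2|) ^ s := by gcongr
      _ = (8 * 2 ^ k) * (L + 3) ^ s * M * R ^ s := by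
          rw [Real.mul_rpow (by positivity) hh0.le, Real.div_rpow hR.le hh0.le]
          field_simp
      _ ≤ _ := by
          gcongr
          linarith [show (0 : ℝ) ≤ 2 * (2 * L) ^ k by positivity]

end ShearAverage

/-! ### The high-low estimate -/

section HighLow

variable {k : ℕ} {E : Type*} [MeasurableSpace E] {g χ : (Fin k → ℝ) → ℝ} {M R I L : ℝ}

lemma integrable_comp_sub_mul (hg : IsMeanZeroKernel g M R I) {φ : E → Fin k → ℝ}
    (hφ : Measurable φ) (μ : Measure E) [IsFiniteMeasure μ] :
    Integrable (fun q : (Fin k → ℝ) × (E × E) => g (q.1 - φ q.2.1) * g (q.1 - φ q.2.2))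
      ((volume : Measure (Fin k → ℝ)).prod (μ.prod μ)) := by
  have hm1 : Measurable fun q : (Fin k → ℝ) × (E × E) => g (q.1 - φ q.2.1) :=
    hg.measurable.comp (measurable_fst.sub (hφ.comp measurable_snd.fst))
  have hm2 : Measurable fun q : (Fin k → ℝ) × (E × E) => g (q.1 - φ q.2.2) :=
    hg.measurable.comp (measurable_fst.sub (hφ.comp measurable_snd.snd))
  have h1 : Integrable (fun q : (Fin k → ℝ) × (E × E) => g (q.1 - φ q.2.1))
      ((volume : Measure (Fin k → ℝ)).prod (μ.prod μ)) := by
    refine (integrable_prod_iff' hm1.aestronglyMeasurable).2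
      ⟨Filter.Eventually.of_forall fun p => hg.integrable.comp_sub_right (φ p.1), ?_⟩
    have : (fun p : E × E => ∫ a, ‖g (a - φ p.1)‖) = fun _ => ∫ a, ‖g a‖ := by
      ext p
      exact integral_sub_right_eq_self (fun a => ‖g a‖) (φ p.1)
    rw [this]
    exact integrable_const _
  exact h1.mul_bdd (c := M) hm2.aestronglyMeasurable
    (Filter.Eventually.of_forall fun q => hg.abs_le _)

lemma lintegral_sq_integral_comp_sub (hg : IsMeanZeroKernel g M R I) {φ : E → Fin k → ℝ}
    (hφ : Measurable φ) (μ : Measure E) [IsFiniteMeasure μ] :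
    0 ≤ ∫ p : E × E, (∫ a, g a * g (a + (φ p.1 - φ p.2))) ∂(μ.prod μ) ∧
    ∫⁻ a, ENNReal.ofReal ((∫ x, g (a - φ x) ∂μ) ^ 2) =
      ENNReal.ofReal (∫ p : E × E, (∫ a, g a * g (a + (φ p.1 - φ p.2))) ∂(μ.prod μ)) := by
  have hf := integrable_comp_sub_mul hg hφ μ
  have h1 : ∀ a, (∫ x, g (a - φ x) ∂μ) ^ 2 =
      ∫ p : E × E, g (a - φ p.1) * g (a - φ p.2) ∂(μ.prod μ) := fun a => by
    rw [sq, ← integral_prod_mul]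
  have h2 : Integrable fun a => (∫ x, g (a - φ x) ∂μ) ^ 2 := by
    simp_rw [h1]
    exact hf.integral_prod_left
  have h3 : ∫ a, (∫ x, g (a - φ x) ∂μ) ^ 2 =
      ∫ p : E × E, (∫ a, g a * g (a + (φ p.1 - φ p.2))) ∂(μ.prod μ) := by
    simp_rw [h1]
    rw [integral_integral_swap hf]
    refine integral_congr_ae (Filter.Eventually.of_forall fun p => ?_)
    change ∫ a, g (a - φ p.1) * g (a - φ p.2) = ∫ a, g a * g (a + (φ p.1 - φ p.2))
    rw [← integral_add_right_eq_self (fun a => g (a - φ p.1) * g (a - φ p.2)) (φ p.1)]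
    refine integral_congr_ae (Filter.Eventually.of_forall fun a => ?_)
    change g (a + φ p.1 - φ p.1) * g (a + φ p.1 - φ p.2) = _
    rw [add_sub_cancel_right, add_sub_assoc]
  rw [← h3]
  exact ⟨integral_nonneg fun _ => sq_nonneg _,
    (ofReal_integral_eq_lintegral_ofReal h2
      (Filter.Eventually.of_forall fun _ => sq_nonneg _)).symm⟩

lemma lintegral_cutoff_mul_autocorr_le (hχ : IsCutoff χ L) (hL : 0 ≤ L)
    {G : (Fin k → ℝ) → ℝ} (hG : IsMeanZeroKernel G (2 * M) (2 * R) 4) (hR : 0 < R)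
    (hMR : (R ^ k)⁻¹ ≤ 2 ^ k * M) {s : ℝ} (hs : 0 < s) (hsk : s ≤ k + 1)
    (μ : Measure ((Fin k → ℝ) × ℝ)) [IsFiniteMeasure μ]
    (hH : ∀ b, 0 ≤ ∫ p, G (shear b (p.1 - p.2)) ∂(μ.prod μ)) :
    ∫⁻ b, ENNReal.ofReal (χ b * ∫ p, G (shear b (p.1 - p.2)) ∂(μ.prod μ)) ≤
      ENNReal.ofReal ((2 * (2 * L) ^ k + 8 * 2 ^ k) * (L + 3) ^ s * M * R ^ s) *
        rieszEnergy s μ := by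
  set C := (2 * (2 * L) ^ k + 8 * 2 ^ k) * (L + 3) ^ s * M * R ^ s with hC
  have hM : 0 ≤ M := by linarith [hG.nonneg]
  have hM' : 0 < M := by
    refine lt_of_le_of_ne hM fun h => ?_
    rw [← h, mul_zero] at hMR
    exact absurd hMR (not_le.2 (by positivity))
  have hC0 : 0 < C := by positivity
  have hsub : Measurable fun q : (Fin k → ℝ) × (((Fin k → ℝ) × ℝ) × ((Fin k → ℝ) × ℝ)) =>
      G (shear q.1 (q.2.1 - q.2.2)) :=
    hG.measurable.comp (measurable_fst.shear (measurable_snd.fst.sub measurable_snd.snd))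
  have hf : Integrable (fun q : (Fin k → ℝ) × (((Fin k → ℝ) × ℝ) × ((Fin k → ℝ) × ℝ)) =>
      χ q.1 * G (shear q.1 (q.2.1 - q.2.2)))
      ((volume : Measure (Fin k → ℝ)).prod (μ.prod μ)) :=
    (hχ.integrable.comp_fst (μ.prod μ)).mul_bdd (c := 2 * M) hsub.aestronglyMeasurable
      (Filter.Eventually.of_forall fun q => hG.abs_le _)
  have h1 : Integrable fun b => χ b * ∫ p, G (shear b (p.1 - p.2)) ∂(μ.prod μ) := by
    simp_rw [← integral_const_mul]
    exact hf.integral_prod_left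
  have h2 : ∫ b, χ b * ∫ p, G (shear b (p.1 - p.2)) ∂(μ.prod μ) =
      ∫ p, (∫ b, χ b * G (shear b (p.1 - p.2))) ∂(μ.prod μ) := by
    simp_rw [← integral_const_mul]
    exact integral_integral_swap hf
  have h3 : ∀ p : ((Fin k → ℝ) × ℝ) × ((Fin k → ℝ) × ℝ),
      ENNReal.ofReal ‖∫ b, χ b * G (shear b (p.1 - p.2))‖ ≤
        ENNReal.ofReal C * edist p.1 p.2 ^ (-s) := by
    intro p
    rcases eq_or_ne p.1 p.2 with hp | hp
    · rw [hp, edist_self, ENNReal.zero_rpow_of_neg (by linarith), ENNReal.mul_top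
        (by simpa using hC0)]
      exact le_top
    · have hp' : 0 < ‖p.1 - p.2‖ := norm_pos_iff.2 (sub_ne_zero.2 hp)
      rw [edist_dist, dist_eq_norm, ENNReal.ofReal_rpow_of_pos hp', ← ENNReal.ofReal_mul hC0.le]
      refine ENNReal.ofReal_le_ofReal ?_
      rw [Real.rpow_neg hp'.le, ← div_eq_mul_inv, le_div_iff₀ (by positivity)]
      exact abs_integral_cutoff_mul_shear_mul_rpow_le hχ hL hG hR hMR hs.le hsk _
  have hme : Measurable fun p : ((Fin k → ℝ) × ℝ) × ((Fin k → ℝ) × ℝ) =>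
      edist p.1 p.2 ^ (-s) := by fun_prop
  rw [← ofReal_integral_eq_lintegral_ofReal h1
    (Filter.Eventually.of_forall fun b => mul_nonneg (hχ.nonneg b) (hH b)), h2, rieszEnergy]
  calc ENNReal.ofReal (∫ p, (∫ b, χ b * G (shear b (p.1 - p.2))) ∂(μ.prod μ))
      ≤ ENNReal.ofReal (∫ p, ‖∫ b, χ b * G (shear b (p.1 - p.2))‖ ∂(μ.prod μ)) :=
        ENNReal.ofReal_le_ofReal (integral_mono hf.integral_prod_right
          hf.integral_prod_right.norm fun p => Real.le_norm_self _)
    _ = ∫⁻ p, ENNReal.ofReal ‖∫ b, χ b * G (shear b (p.1 - p.2))‖ ∂(μ.prod μ) :=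
        ofReal_integral_eq_lintegral_ofReal hf.integral_prod_right.norm
          (Filter.Eventually.of_forall fun _ => norm_nonneg _)
    _ ≤ ∫⁻ p, ENNReal.ofReal C * edist p.1 p.2 ^ (-s) ∂(μ.prod μ) := lintegral_mono h3
    _ = ENNReal.ofReal C * ∫⁻ x, ∫⁻ y, edist x y ^ (-s) ∂μ ∂μ := by
        rw [lintegral_const_mul _ hme, lintegral_prod _ hme.aemeasurable]

/-- The high-low estimate: the high frequency part of the Radon transform of a measure is
controlled in `L²` by its Riesz energy. -/
lemma lintegral_sq_integral_shear_le (hg : IsMeanZeroKernel g M R 2) (hL : 0 ≤ L) (hR : 0 < R)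
    (hMR : (R ^ k)⁻¹ ≤ 2 ^ k * M) {s : ℝ} (hs : 0 < s) (hsk : s ≤ k + 1)
    (μ : Measure ((Fin k → ℝ) × ℝ)) [IsFiniteMeasure μ] :
    ∫⁻ b in closedBall 0 L, ∫⁻ a, ENNReal.ofReal ((∫ x, g (a - shear b x) ∂μ) ^ 2) ≤
      ENNReal.ofReal ((2 * (2 * (L + 1)) ^ k + 8 * 2 ^ k) * (L + 4) ^ s * M * R ^ s) *
        rieszEnergy s μ := by
  obtain ⟨χ, hχ, hχ1⟩ := exists_isCutoff (k := k) L
  have hG : IsMeanZeroKernel (fun u => ∫ a, g a * g (a + u)) (2 * M) (2 * R) 4 := by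
    have := hg.autocorr
    norm_num at this
    exact this
  have hb := fun b : Fin k → ℝ =>
    lintegral_sq_integral_comp_sub hg (φ := shear b) (measurable_const.shear measurable_id) μ
  simp_rw [← shear_sub] at hb
  have h1 := lintegral_cutoff_mul_autocorr_le hχ (by linarith) hG hR hMR hs hsk μ
    fun b => (hb b).1
  rw [show L + 1 + 3 = L + 4 by ring] at h1
  refine le_trans ?_ h1
  rw [← lintegral_indicator measurableSet_closedBall]
  refine lintegral_mono fun b => ?_
  rcases em (b ∈ closedBall 0 L) with hbL | hbL
  swap
  · rw [indicator_of_notMem hbL]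
    exact zero_le
  rw [indicator_of_mem hbL, (hb b).2, hχ1 b (by simpa using hbL), one_mul]

end HighLow

/-! ### Counting incidences -/

section Counting

variable {k : ℕ}

/-- The mass of the points `y` with `(y, b) ∈ D` on the tube of width `δ` with slope `b` through
`(a, 0)`. -/
def incidence (ν : Measure ((Fin k → ℝ) × ℝ)) (D : Set (((Fin k → ℝ) × ℝ) × (Fin k → ℝ))) (δ : ℝ)
    (b a : Fin k → ℝ) : ℝ≥0∞ := ν {y | (y, b) ∈ D ∧ ‖a - shear b y‖ ≤ δ}

variable {μ ν : Measure ((Fin k → ℝ) × ℝ)} [IsFiniteMeasure μ] [IsFiniteMeasure ν]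
  {D D' : Set (((Fin k → ℝ) × ℝ) × (Fin k → ℝ))}

lemma incidence_lt_top (δ : ℝ) (b a : Fin k → ℝ) : incidence ν D δ b a < ∞ := measure_lt_top _ _

lemma measurableSet_incidence (hD : MeasurableSet D) (δ : ℝ) :
    MeasurableSet {q : ((Fin k → ℝ) × (Fin k → ℝ)) × ((Fin k → ℝ) × ℝ) |
      (q.2, q.1.1) ∈ D ∧ ‖q.1.2 - shear q.1.1 q.2‖ ≤ δ} := by
  have h1 : Measurable fun q : ((Fin k → ℝ) × (Fin k → ℝ)) × ((Fin k → ℝ) × ℝ) => (q.2, q.1.1) :=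
    measurable_snd.prodMk measurable_fst.fst
  have h2 : Measurable fun q : ((Fin k → ℝ) × (Fin k → ℝ)) × ((Fin k → ℝ) × ℝ) =>
      ‖q.1.2 - shear q.1.1 q.2‖ :=
    (measurable_fst.snd.sub (measurable_fst.fst.shear measurable_snd)).norm
  exact (h1 hD).inter (measurableSet_le h2 measurable_const)

lemma measurable_incidence (hD : MeasurableSet D) (δ : ℝ) :
    Measurable fun p : (Fin k → ℝ) × (Fin k → ℝ) => incidence ν D δ p.1 p.2 :=
  measurable_measure_prodMk_left (measurableSet_incidence hD δ)

/-- Double counting of incidences. -/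
lemma lintegral_incidence (hD : MeasurableSet D) (δ : ℝ) :
    ∫⁻ b, ∫⁻ a, incidence ν D δ b a =
      ∫⁻ y, (∫⁻ b, volume {a | (y, b) ∈ D ∧ ‖a - shear b y‖ ≤ δ}) ∂ν := by
  have hT := measurableSet_incidence hD δ
  set T := {q : ((Fin k → ℝ) × (Fin k → ℝ)) × ((Fin k → ℝ) × ℝ) |
      (q.2, q.1.1) ∈ D ∧ ‖q.1.2 - shear q.1.1 q.2‖ ≤ δ} with hTdef
  have h1 : ∫⁻ b, ∫⁻ a, incidence ν D δ b a =
      (((volume : Measure (Fin k → ℝ)).prod (volume : Measure (Fin k → ℝ))).prod ν) T := by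
    rw [Measure.prod_apply hT, lintegral_prod _ (measurable_measure_prodMk_left hT).aemeasurable]
    rfl
  rw [h1, Measure.prod_apply_symm hT]
  refine lintegral_congr fun y => ?_
  rw [Measure.prod_apply (measurable_prodMk_right hT)]
  rfl

/-- Double counting of pairs of incidences. -/
lemma lintegral_incidence_mul (hD : MeasurableSet D) (hD' : MeasurableSet D') (δ r : ℝ) :
    ∫⁻ b, ∫⁻ a, incidence ν D δ b a * incidence μ D' r b a =
      ∫⁻ p : ((Fin k → ℝ) × ℝ) × ((Fin k → ℝ) × ℝ),
        (∫⁻ b, volume {a | ((p.1, b) ∈ D ∧ ‖a - shear b p.1‖ ≤ δ) ∧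
          (p.2, b) ∈ D' ∧ ‖a - shear b p.2‖ ≤ r}) ∂(ν.prod μ) := by
  let T : Set (((Fin k → ℝ) × (Fin k → ℝ)) × (((Fin k → ℝ) × ℝ) × ((Fin k → ℝ) × ℝ))) :=
    {q | ((q.2.1, q.1.1) ∈ D ∧ ‖q.1.2 - shear q.1.1 q.2.1‖ ≤ δ) ∧
      (q.2.2, q.1.1) ∈ D' ∧ ‖q.1.2 - shear q.1.1 q.2.2‖ ≤ r}
  have hT : MeasurableSet T := by
    have h1 : Measurable fun q : ((Fin k → ℝ) × (Fin k → ℝ)) ×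
        (((Fin k → ℝ) × ℝ) × ((Fin k → ℝ) × ℝ)) => (q.1, q.2.1) :=
      measurable_fst.prodMk measurable_snd.fst
    have h2 : Measurable fun q : ((Fin k → ℝ) × (Fin k → ℝ)) ×
        (((Fin k → ℝ) × ℝ) × ((Fin k → ℝ) × ℝ)) => (q.1, q.2.2) :=
      measurable_fst.prodMk measurable_snd.snd
    exact (h1 (measurableSet_incidence hD δ)).inter (h2 (measurableSet_incidence hD' r))
  have h1 : ∫⁻ b, ∫⁻ a, incidence ν D δ b a * incidence μ D' r b a =
      (((volume : Measure (Fin k → ℝ)).prod (volume : Measure (Fin k → ℝ))).prod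
        (ν.prod μ)) T := by
    rw [Measure.prod_apply hT, lintegral_prod _ (measurable_measure_prodMk_left hT).aemeasurable]
    refine lintegral_congr fun b => lintegral_congr fun a => ?_
    rw [incidence, incidence, ← Measure.prod_prod]
    rfl
  rw [h1, Measure.prod_apply_symm hT]
  refine lintegral_congr fun y => ?_
  rw [Measure.prod_apply (measurable_prodMk_right hT)]
  rfl

/-- A lower bound for the number of pairs of incidences. -/
lemma le_lintegral_incidence_mul (hD : MeasurableSet D) {L δ : ℝ} (hδ : 0 ≤ δ)
    {B : Set (((Fin k → ℝ) × ℝ) × ((Fin k → ℝ) × ℝ))} (hB : MeasurableSet B)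
    (hBL : ∀ p ∈ B, ‖p.1‖ ≤ L ∧ ‖p.2‖ ≤ L ∧ 1 ≤ |p.1.2 - p.2.2|)
    (hBD : ∀ p ∈ B, ∀ b, ‖b - lineSlope p.2 p.1‖ ≤ δ → (p.1, b) ∈ D) :
    ENNReal.ofReal ((2 * δ) ^ k * (2 * δ) ^ k) * (ν.prod μ) B ≤
      ∫⁻ b, ∫⁻ a, incidence ν D δ b a * incidence μ univ ((2 * L + 1) * δ) b a := by
  rw [lintegral_incidence_mul hD MeasurableSet.univ, ← lintegral_indicator_const hB]
  refine lintegral_mono fun p => ?_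
  rcases em (p ∈ B) with hp | hp
  swap
  · rw [indicator_of_notMem hp]
    exact zero_le
  obtain ⟨h1, h2, h3⟩ := hBL p hp
  rw [indicator_of_mem hp, ENNReal.ofReal_mul (by positivity), mul_comm]
  nth_rewrite 1 [← volume_closedBall_fin (lineSlope p.2 p.1) hδ]
  rw [mul_comm, ← setLIntegral_const, ← lintegral_indicator measurableSet_closedBall]
  refine lintegral_mono fun b => ?_
  rcases em (b ∈ closedBall (lineSlope p.2 p.1) δ) with hb | hb
  swap
  · rw [indicator_of_notMem hb]
    exact zero_le
  rw [indicator_of_mem hb, ← volume_closedBall_fin (shear b p.1) hδ]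
  rw [mem_closedBall, dist_eq_norm] at hb
  refine measure_mono fun a ha => ?_
  rw [mem_closedBall, dist_eq_norm] at ha
  refine ⟨⟨hBD p hp b hb, ha⟩, mem_univ _, ?_⟩
  have h4 := norm_shear_le h3 h2 h1 b
  rw [shear_sub, norm_sub_rev (lineSlope _ _)] at h4
  have h5 := norm_sub_le_norm_sub_add_norm_sub a (shear b p.1) (shear b p.2)
  have h6 : 2 * L * ‖b - lineSlope p.2 p.1‖ ≤ 2 * L * δ :=
    mul_le_mul_of_nonneg_left hb (by linarith [norm_nonneg p.1])
  linarith

lemma volume_and_le (P : Prop) (c : Fin k → ℝ) {δ : ℝ} (hδ : 0 ≤ δ) {S : Set (Fin k → ℝ)}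
    {b : Fin k → ℝ} (hP : P → b ∈ S) (U : Set (Fin k → ℝ)) (hU : ∀ a ∈ U, P ∧ ‖a - c‖ ≤ δ) :
    volume U ≤ S.indicator (fun _ => ENNReal.ofReal ((2 * δ) ^ k)) b := by
  rcases U.eq_empty_or_nonempty with h | ⟨a, ha⟩
  · simp [h]
  rw [indicator_of_mem (hP (hU a ha).1), ← volume_closedBall_fin c hδ]
  refine measure_mono fun a ha => ?_
  rw [mem_closedBall, dist_eq_norm]
  exact (hU a ha).2

lemma lintegral_incidence_le (hD : MeasurableSet D) {δ V : ℝ} (hδ : 0 ≤ δ)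
    (hV : ∀ y, volume {b | (y, b) ∈ D} ≤ ENNReal.ofReal V) :
    ∫⁻ b, ∫⁻ a, incidence ν D δ b a ≤ ENNReal.ofReal ((2 * δ) ^ k * V) * ν univ := by
  rw [lintegral_incidence hD, ← lintegral_const]
  refine lintegral_mono fun y => ?_
  refine (lintegral_mono fun b => volume_and_le ((y, b) ∈ D) (shear b y) hδ
    (S := {b | (y, b) ∈ D}) (fun h => h) _ fun a ha => ha).trans ?_
  refine (lintegral_indicator_const_le _ _).trans ?_
  rw [ENNReal.ofReal_mul (by positivity)]
  exact mul_le_mul' le_rfl (hV y)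

/-- An `L²` bound for the incidence function in terms of the Riesz energy. -/
lemma lintegral_incidence_sq_le (hD : MeasurableSet D) {δ L V σ t : ℝ} (hδ : 0 < δ) (hL : 1 ≤ L)
    (hσt : σ ≤ t) (hV : 0 < V) (ht : 0 < t)
    (hDL : ∀ p ∈ D, ‖p.1‖ ≤ L ∧ ‖p.2‖ ≤ 2 * L + 1)
    (hDV : ∀ y b₀ r, δ ≤ r →
      volume ({b | (y, b) ∈ D} ∩ closedBall b₀ r) ≤ ENNReal.ofReal (V * r ^ σ)) :
    ∫⁻ b, ∫⁻ a, incidence ν D δ b a * incidence ν D δ b a ≤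
      ENNReal.ofReal ((2 * δ) ^ k * (V * (((4 * L + 6) * (2 * L + 3) * δ) ^ σ *
        (2 * L) ^ (t - σ)))) * rieszEnergy t ν := by
  have hme : Measurable fun p : ((Fin k → ℝ) × ℝ) × ((Fin k → ℝ) × ℝ) =>
      edist p.1 p.2 ^ (-t) := by fun_prop
  rw [lintegral_incidence_mul hD hD, rieszEnergy, ← lintegral_prod _ hme.aemeasurable,
    ENNReal.ofReal_mul (by positivity), mul_assoc, ← lintegral_const_mul _ hme,
    ← lintegral_const_mul _ (by fun_prop)]
  refine lintegral_mono fun p => ?_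
  let S : Set (Fin k → ℝ) := {b | ((p.1, b) ∈ D ∧ (p.2, b) ∈ D) ∧ ‖shear b (p.1 - p.2)‖ ≤ 2 * δ}
  have hS : ∫⁻ b, volume {a | ((p.1, b) ∈ D ∧ ‖a - shear b p.1‖ ≤ δ) ∧
          (p.2, b) ∈ D ∧ ‖a - shear b p.2‖ ≤ δ} ≤
      ENNReal.ofReal ((2 * δ) ^ k) * volume S := by
    refine (lintegral_mono fun b => ?_).trans (lintegral_indicator_const_le S _)
    refine volume_and_le (((p.1, b) ∈ D ∧ (p.2, b) ∈ D) ∧ ‖shear b (p.1 - p.2)‖ ≤ 2 * δ)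
      (shear b p.1) hδ.le (fun h => h) _ fun a ha => ⟨⟨⟨ha.1.1, ha.2.1⟩, ?_⟩, ha.1.2⟩
    rw [shear_sub]
    have h1 := ha.1.2
    rw [norm_sub_rev] at h1
    linarith [norm_sub_le_norm_sub_add_norm_sub (shear b p.1) a (shear b p.2), ha.2.2]
  refine hS.trans (mul_le_mul' le_rfl ?_)
  rcases S.eq_empty_or_nonempty with hSe | ⟨b₀, ⟨hb1, hb2⟩, hb3⟩
  · simp [hSe]
  have hC : 0 < V * (((4 * L + 6) * (2 * L + 3) * δ) ^ σ * (2 * L) ^ (t - σ)) := by positivity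
  rcases eq_or_ne p.1 p.2 with hp | hp
  · rw [hp, edist_self, ENNReal.zero_rpow_of_neg (by linarith), ENNReal.mul_top (by simpa using hC)]
    exact le_top
  have hp' : 0 < ‖p.1 - p.2‖ := norm_pos_iff.2 (sub_ne_zero.2 hp)
  have hp2 : ‖p.1 - p.2‖ ≤ 2 * L :=
    (norm_sub_le _ _).trans (by linarith [(hDL _ hb1).1, (hDL _ hb2).1])
  have hsub : S ⊆ {b | (p.1, b) ∈ D} ∩
      closedBall b₀ ((4 * L + 6) * (2 * L + 3) * δ / ‖p.1 - p.2‖) := fun b hb => by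
    refine ⟨hb.1.1, mem_closedBall.2 ?_⟩
    rw [dist_eq_norm]
    have := norm_sub_le_of_norm_shear_le (sub_ne_zero.2 hp) hδ (by linarith : 1 ≤ 2 * L + 1)
      (hDL _ hb.1.1).2 (hDL _ hb1).2 hb.2 hb3
    convert this using 3
    ring
  refine (measure_mono hsub).trans ((hDV _ _ _ ?_).trans ?_)
  · rw [le_div_iff₀ hp', mul_comm]
    exact mul_le_mul_of_nonneg_right (by nlinarith) hδ.le
  · rw [edist_dist, dist_eq_norm, ENNReal.ofReal_rpow_of_pos hp', ← ENNReal.ofReal_mul hC.le]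
    refine ENNReal.ofReal_le_ofReal ?_
    have h1 : (‖p.1 - p.2‖ ^ σ)⁻¹ ≤ (2 * L) ^ (t - σ) * ‖p.1 - p.2‖ ^ (-t) := by
      rw [← Real.rpow_neg hp'.le, show -σ = (t - σ) + -t by ring, Real.rpow_add hp']
      gcongr
    rw [Real.div_rpow (by positivity) hp'.le, div_eq_mul_inv, mul_assoc V]
    refine mul_le_mul_of_nonneg_left ?_ hV.le
    rw [mul_assoc (((4 * L + 6) * (2 * L + 3) * δ) ^ σ)]
    exact mul_le_mul_of_nonneg_left h1 (by positivity)

end Counting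

section Counting

variable {k : ℕ}

lemma incidence_univ_le {μ ν : Measure ((Fin k → ℝ) × ℝ)}
    {D : Set (((Fin k → ℝ) × ℝ) × (Fin k → ℝ))} {R δ T : ℝ} (hδR : δ ≤ R)
    (hDμ : ∀ p ∈ D, ∀ᵐ x ∂μ, 1 ≤ |p.1.2 - x.2|)
    (hDT : ∀ p ∈ D, tubeMass μ p.1 p.2 (2 * R) ≤ ENNReal.ofReal T) (b a : Fin k → ℝ)
    (h : incidence ν D δ b a ≠ 0) : incidence μ univ R b a ≤ ENNReal.ofReal T := by
  obtain ⟨y, hyD, hy⟩ := nonempty_of_measure_ne_zero h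
  refine le_trans (measure_mono_ae ?_) (hDT _ hyD)
  filter_upwards [hDμ _ hyD] with x hx hxR
  have h1 : ‖a - shear b x‖ ≤ R := hxR.2
  change ‖lineSlope x y - b‖ ≤ 2 * R
  refine (norm_lineSlope_sub_le hx b).trans ?_
  rw [shear_sub]
  rw [norm_sub_rev] at hy
  linarith [norm_sub_le_norm_sub_add_norm_sub (shear b y) a (shear b x)]

variable {μ ν : Measure ((Fin k → ℝ) × ℝ)} [IsFiniteMeasure μ] [IsFiniteMeasure ν]
  {D : Set (((Fin k → ℝ) × ℝ) × (Fin k → ℝ))}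

/-- The difference of two normalized ball indicators. -/
def ballKernel (k : ℕ) (r R : ℝ) (a : Fin k → ℝ) : ℝ :=
  (closedBall 0 r).indicator (fun _ => ((2 * r) ^ k)⁻¹) a -
    (closedBall 0 R).indicator (fun _ => ((2 * R) ^ k)⁻¹) a

lemma integral_ballKernel_shear (r R : ℝ) (b a : Fin k → ℝ) :
    ∫ x, ballKernel k r R (a - shear b x) ∂μ =
      ((2 * r) ^ k)⁻¹ * (incidence μ univ r b a).toReal -
        ((2 * R) ^ k)⁻¹ * (incidence μ univ R b a).toReal := by
  have hm : ∀ ρ : ℝ, MeasurableSet {x : (Fin k → ℝ) × ℝ | a - shear b x ∈ closedBall 0 ρ} :=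
    fun ρ => (measurable_const.sub (measurable_const.shear measurable_id)) measurableSet_closedBall
  have h1 : ∀ ρ : ℝ, {x : (Fin k → ℝ) × ℝ | a - shear b x ∈ closedBall 0 ρ} =
      {y | (y, b) ∈ (univ : Set (((Fin k → ℝ) × ℝ) × (Fin k → ℝ))) ∧ ‖a - shear b y‖ ≤ ρ} := by
    intro ρ
    ext x
    simp
  have h2 : ∀ ρ c : ℝ, Integrable (fun x => {x : (Fin k → ℝ) × ℝ |
      a - shear b x ∈ closedBall 0 ρ}.indicator (fun _ => c) x) μ := fun ρ c =>
    (integrable_const c).indicator (hm ρ)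
  have h3 : ∀ ρ c : ℝ, ∫ x, {x : (Fin k → ℝ) × ℝ |
      a - shear b x ∈ closedBall 0 ρ}.indicator (fun _ => c) x ∂μ =
        c * (incidence μ univ ρ b a).toReal := fun ρ c => by
    rw [integral_indicator (hm ρ), setIntegral_const, smul_eq_mul, mul_comm, measureReal_def, h1,
      incidence]
  rw [← h3, ← h3, ← integral_sub (h2 _ _) (h2 _ _)]
  rfl

lemma incidence_mul_le {δ r R T ε : ℝ} (hr : 0 < r) (hR : 0 < R) (hT : 0 ≤ T) (hε : 0 < ε)
    (b a : Fin k → ℝ)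
    (h : incidence ν D δ b a ≠ 0 → incidence μ univ R b a ≤ ENNReal.ofReal T) :
    incidence ν D δ b a * incidence μ univ r b a ≤ ENNReal.ofReal ((2 * r) ^ k) *
      (ENNReal.ofReal (((2 * R) ^ k)⁻¹ * T) * incidence ν D δ b a +
        ENNReal.ofReal ε * (incidence ν D δ b a * incidence ν D δ b a) +
        ENNReal.ofReal ε⁻¹ *
          ENNReal.ofReal ((∫ x, ballKernel k r R (a - shear b x) ∂μ) ^ 2)) := by
  rcases eq_or_ne (incidence ν D δ b a) 0 with h0 | h0
  · rw [h0, zero_mul]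
    exact zero_le
  have hN := ENNReal.toReal_le_of_le_ofReal hT (h h0)
  have hk := integral_ballKernel_shear (μ := μ) r R b a
  set d := ∫ x, ballKernel k r R (a - shear b x) ∂μ
  rw [← ENNReal.ofReal_toReal (incidence_lt_top (ν := ν) (D := D) δ b a).ne,
    ← ENNReal.ofReal_toReal (incidence_lt_top (ν := μ) (D := univ) r b a).ne]
  have hl0 : 0 ≤ (incidence ν D δ b a).toReal := ENNReal.toReal_nonneg
  set l := (incidence ν D δ b a).toReal
  set n := (incidence μ univ r b a).toReal
  set N := (incidence μ univ R b a).toReal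
  have hm : 0 < ((2 * R) ^ k)⁻¹ := by positivity
  have hn : n = (2 * r) ^ k * (((2 * R) ^ k)⁻¹ * N + d) := by
    rw [hk]
    have : (2 * r) ^ k ≠ 0 := by positivity
    field_simp
    ring
  have h1 : l * d ≤ ε * (l * l) + ε⁻¹ * d ^ 2 := by
    have h2 : 0 ≤ ε⁻¹ * (ε * l - d) ^ 2 := by positivity
    have h3 : ε⁻¹ * (ε * l - d) ^ 2 = ε * (l * l) - 2 * (l * d) + ε⁻¹ * d ^ 2 := by
      field_simp
      ring
    have h4 : 0 ≤ ε * (l * l) + ε⁻¹ * d ^ 2 := by positivity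
    linarith
  rw [← ENNReal.ofReal_mul hl0, ← ENNReal.ofReal_mul (by positivity),
    ← ENNReal.ofReal_mul (by positivity), ← ENNReal.ofReal_mul (by positivity),
    ← ENNReal.ofReal_mul (by positivity), ← ENNReal.ofReal_add (by positivity) (by positivity),
    ← ENNReal.ofReal_add (by positivity) (by positivity), ← ENNReal.ofReal_mul (by positivity)]
  refine ENNReal.ofReal_le_ofReal ?_
  calc l * n = (2 * r) ^ k * (((2 * R) ^ k)⁻¹ * N * l + l * d) := by rw [hn]; ring
    _ ≤ (2 * r) ^ k * (((2 * R) ^ k)⁻¹ * T * l + (ε * (l * l) + ε⁻¹ * d ^ 2)) := by gcongr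
    _ = _ := by ring

lemma lintegral_lintegral_const_mul_add {α β : Type*} [MeasurableSpace α] [MeasurableSpace β]
    {P : Measure α} {Q : Measure β} [SFinite Q] {f₁ f₂ : α → β → ℝ≥0∞}
    (h₁ : Measurable fun p : α × β => f₁ p.1 p.2) (h₂ : Measurable fun p : α × β => f₂ p.1 p.2)
    (f₃ : α → β → ℝ≥0∞) {c : ℝ≥0∞} (hc : c ≠ ∞) :
    ∫⁻ b, ∫⁻ a, c * (f₁ b a + f₂ b a + f₃ b a) ∂Q ∂P =
      c * ((∫⁻ b, ∫⁻ a, f₁ b a ∂Q ∂P) + (∫⁻ b, ∫⁻ a, f₂ b a ∂Q ∂P) +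
        ∫⁻ b, ∫⁻ a, f₃ b a ∂Q ∂P) := by
  have h : ∀ b, ∫⁻ a, c * (f₁ b a + f₂ b a + f₃ b a) ∂Q =
      c * (((∫⁻ a, f₁ b a ∂Q) + ∫⁻ a, f₂ b a ∂Q) + ∫⁻ a, f₃ b a ∂Q) := fun b => by
    have m₁ : Measurable (f₁ b) := h₁.comp (measurable_prodMk_left (x := b))
    have m₂ : Measurable (f₂ b) := h₂.comp (measurable_prodMk_left (x := b))
    have m₁₂ : Measurable fun a => f₁ b a + f₂ b a := m₁.add m₂
    rw [lintegral_const_mul' _ _ hc, lintegral_add_left m₁₂, lintegral_add_left m₁]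
  have e₁ : Measurable fun b => ∫⁻ a, f₁ b a ∂Q := h₁.lintegral_prod_right'
  have e₂ : Measurable fun b => ∫⁻ a, f₂ b a ∂Q := h₂.lintegral_prod_right'
  have e₁₂ : Measurable fun b => (∫⁻ a, f₁ b a ∂Q) + ∫⁻ a, f₂ b a ∂Q := e₁.add e₂
  simp_rw [h]
  rw [lintegral_const_mul' _ _ hc, lintegral_add_left e₁₂, lintegral_add_left e₁]

/-- The main counting estimate: few pairs of points lie on a common heavy tube. -/
lemma measure_heavy_le (hD : MeasurableSet D) {δ L R T V ε σ s t : ℝ} (hδ : 0 < δ) (hL : 1 ≤ L)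
    (hRδ : (2 * L + 1) * δ ≤ R) (hT : 0 ≤ T) (hV : 0 < V) (hε : 0 < ε)
    (hσt : σ ≤ t) (ht : 0 < t) (hs : 0 < s) (hsk : s ≤ k + 1)
    (hDL : ∀ p ∈ D, ‖p.1‖ ≤ L ∧ ‖p.2‖ ≤ 2 * L + 1)
    (hDμ : ∀ p ∈ D, ∀ᵐ x ∂μ, 1 ≤ |p.1.2 - x.2|)
    (hDT : ∀ p ∈ D, tubeMass μ p.1 p.2 (2 * R) ≤ ENNReal.ofReal T)
    (hDV : ∀ y b₀ r, δ ≤ r →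
      volume ({b | (y, b) ∈ D} ∩ closedBall b₀ r) ≤ ENNReal.ofReal (V * r ^ σ))
    (hδL : δ ≤ 2 * L + 1)
    {B : Set (((Fin k → ℝ) × ℝ) × ((Fin k → ℝ) × ℝ))} (hB : MeasurableSet B)
    (hBL : ∀ p ∈ B, ‖p.1‖ ≤ L ∧ ‖p.2‖ ≤ L ∧ 1 ≤ |p.1.2 - p.2.2|)
    (hBD : ∀ p ∈ B, ∀ b, ‖b - lineSlope p.2 p.1‖ ≤ δ → (p.1, b) ∈ D) :
    ENNReal.ofReal ((2 * δ) ^ k * (2 * δ) ^ k) * (ν.prod μ) B ≤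
      ENNReal.ofReal ((2 * ((2 * L + 1) * δ)) ^ k) *
      (ENNReal.ofReal (((2 * R) ^ k)⁻¹ * T) *
          (ENNReal.ofReal ((2 * δ) ^ k * (V * (2 * L + 1) ^ σ)) * ν univ) +
        ENNReal.ofReal ε *
          (ENNReal.ofReal ((2 * δ) ^ k * (V * (((4 * L + 6) * (2 * L + 3) * δ) ^ σ *
          (2 * L) ^ (t - σ)))) * rieszEnergy t ν) +
        ENNReal.ofReal ε⁻¹ * (ENNReal.ofReal ((2 * (2 * ((2 * L + 1) + 1)) ^ k + 8 * 2 ^ k) *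
          ((2 * L + 1) + 4) ^ s * ((2 * ((2 * L + 1) * δ)) ^ k)⁻¹ * R ^ s) * rieszEnergy s μ)) := by
  set r := (2 * L + 1) * δ with hr
  have hr0 : 0 < r := by positivity
  have hR : 0 < R := hr0.trans_le hRδ
  have hδR : δ ≤ R := le_trans (by nlinarith) hRδ
  have hmi := measurable_incidence (ν := ν) hD δ
  have hA : Measurable fun p : (Fin k → ℝ) × (Fin k → ℝ) =>
      ENNReal.ofReal (((2 * R) ^ k)⁻¹ * T) * incidence ν D δ p.1 p.2 := hmi.const_mul _
  have hA2 : Measurable fun p : (Fin k → ℝ) × (Fin k → ℝ) =>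
      ENNReal.ofReal ε * (incidence ν D δ p.1 p.2 * incidence ν D δ p.1 p.2) :=
    (hmi.mul hmi).const_mul _
  have hzero : ∀ b, b ∉ closedBall (0 : Fin k → ℝ) (2 * L + 1) → ∀ a,
      incidence ν D δ b a = 0 := fun b hb a => by
    refine measure_mono_null (fun y hy => hb ?_) measure_empty
    simpa using (hDL _ hy.1).2
  refine (le_lintegral_incidence_mul hD hδ.le hB hBL hBD).trans ?_
  calc ∫⁻ b, ∫⁻ a, incidence ν D δ b a * incidence μ univ r b a
      = ∫⁻ b in closedBall 0 (2 * L + 1), ∫⁻ a, incidence ν D δ b a * incidence μ univ r b a := by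
        rw [← lintegral_indicator measurableSet_closedBall]
        refine lintegral_congr fun b => ?_
        rcases em (b ∈ closedBall (0 : Fin k → ℝ) (2 * L + 1)) with hb | hb
        · rw [indicator_of_mem hb]
        · rw [indicator_of_notMem hb]
          simp [hzero b hb]
    _ ≤ ∫⁻ b in closedBall 0 (2 * L + 1), ∫⁻ a, ENNReal.ofReal ((2 * r) ^ k) *
          (ENNReal.ofReal (((2 * R) ^ k)⁻¹ * T) * incidence ν D δ b a +
          ENNReal.ofReal ε * (incidence ν D δ b a * incidence ν D δ b a) +
          ENNReal.ofReal ε⁻¹ *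
            ENNReal.ofReal ((∫ x, ballKernel k r R (a - shear b x) ∂μ) ^ 2)) :=
        lintegral_mono fun b => lintegral_mono fun a => incidence_mul_le hr0 hR hT hε b a
          (incidence_univ_le hδR hDμ hDT b a)
    _ = ENNReal.ofReal ((2 * r) ^ k) *
          ((∫⁻ b in closedBall 0 (2 * L + 1),
            ∫⁻ a, ENNReal.ofReal (((2 * R) ^ k)⁻¹ * T) * incidence ν D δ b a) +
            (∫⁻ b in closedBall 0 (2 * L + 1),
              ∫⁻ a, ENNReal.ofReal ε * (incidence ν D δ b a * incidence ν D δ b a)) +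
            ∫⁻ b in closedBall 0 (2 * L + 1), ∫⁻ a, ENNReal.ofReal ε⁻¹ *
              ENNReal.ofReal ((∫ x, ballKernel k r R (a - shear b x) ∂μ) ^ 2)) :=
        lintegral_lintegral_const_mul_add hA hA2 _ ENNReal.ofReal_ne_top
    _ ≤ _ := by
        refine mul_le_mul' le_rfl (add_le_add (add_le_add ?_ ?_) ?_)
        · simp_rw [lintegral_const_mul' _ _ ENNReal.ofReal_ne_top]
          refine mul_le_mul' le_rfl ((setLIntegral_le_lintegral _ _).trans
            (lintegral_incidence_le hD hδ.le fun y => ?_))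
          have hsub : {b | (y, b) ∈ D} ⊆ {b | (y, b) ∈ D} ∩ closedBall 0 (2 * L + 1) :=
            fun b hb => ⟨hb, by simpa using (hDL _ hb).2⟩
          exact (measure_mono hsub).trans (hDV y 0 _ hδL)
        · simp_rw [lintegral_const_mul' _ _ ENNReal.ofReal_ne_top]
          exact mul_le_mul' le_rfl ((setLIntegral_le_lintegral _ _).trans
            (lintegral_incidence_sq_le hD hδ hL hσt hV ht hDL hDV))
        · simp_rw [lintegral_const_mul' _ _ ENNReal.ofReal_ne_top]
          refine mul_le_mul' le_rfl (lintegral_sq_integral_shear_le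
            (isMeanZeroKernel_ball_sub_ball hr0 hRδ) (by linarith) hR ?_ hs hsk μ)
          rw [mul_pow, mul_inv, ← mul_assoc, mul_inv_cancel₀ (by positivity), one_mul]
          gcongr

end Counting

/-! ### Choosing the scales -/

section Scales

variable {k : ℕ}

/-- The gain of thinness in one step of the iteration. -/
def thinGain (k s t : ℝ) : ℝ := (s - k) / (2 * s) * (k - t) / 2

lemma thinGain_pos {k s t : ℝ} (hk : 0 ≤ k) (hs : k < s) (ht : t < k) : 0 < thinGain k s t := by
  have h1 : 0 < s - k := by linarith
  have h2 : 0 < k - t := by linarith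
  have h3 : 0 < s := by linarith
  unfold thinGain
  positivity

lemma thinGain_lt {k s t : ℝ} (hs : k < s) (ht0 : 0 < t) (ht : t < k) :
    thinGain k s t < (s - k) / 2 := by
  have h3 : 0 < s := by linarith
  unfold thinGain
  rw [div_mul_eq_mul_div, div_div, div_lt_div_iff₀ (by positivity) (by positivity)]
  nlinarith [mul_pos (sub_pos.2 hs) h3, mul_pos (sub_pos.2 hs) (sub_pos.2 ht),
    mul_pos (sub_pos.2 hs) ht0, mul_pos (sub_pos.2 hs) (sub_pos.2 hs)]

lemma mul_rpow_natPow {c δ e : ℝ} (hδ : 0 < δ) : (c * δ ^ e) ^ k = c ^ k * δ ^ (e * k) := by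
  rw [mul_pow, Real.rpow_mul_natCast hδ.le]

lemma mul_rpow_rpow {c δ e σ : ℝ} (hc : 0 ≤ c) (hδ : 0 < δ) :
    (c * δ ^ e) ^ σ = c ^ σ * δ ^ (e * σ) := by
  rw [Real.mul_rpow hc (Real.rpow_nonneg hδ.le _), ← Real.rpow_mul hδ.le]

lemma le_mul_of_mul_le_mul_add {x n I J : ℝ≥0∞} {p q a₁ a₂ b₁ b₂ d₁ d₂ c₁ c₂ c₃ g : ℝ}
    (hp : 0 < p) (hq : 0 ≤ q) (ha : 0 ≤ a₁) (hb : 0 ≤ b₁) (hd : 0 ≤ d₁) (hc₁ : 0 ≤ c₁)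
    (hc₂ : 0 ≤ c₂) (hc₃ : 0 ≤ c₃)
    (h : ENNReal.ofReal p * x ≤ ENNReal.ofReal q * (ENNReal.ofReal a₁ * (ENNReal.ofReal a₂ * n) +
      ENNReal.ofReal b₁ * (ENNReal.ofReal b₂ * I) + ENNReal.ofReal d₁ * (ENNReal.ofReal d₂ * J)))
    (h₁ : q * (a₁ * a₂) ≤ p * (c₁ * g)) (h₂ : q * (b₁ * b₂) ≤ p * (c₂ * g))
    (h₃ : q * (d₁ * d₂) ≤ p * (c₃ * g)) :
    x ≤ (ENNReal.ofReal c₁ * n + ENNReal.ofReal c₂ * I + ENNReal.ofReal c₃ * J) *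
      ENNReal.ofReal g := by
  have key : ∀ {a b c : ℝ} {z : ℝ≥0∞}, 0 ≤ a → 0 ≤ c → q * (a * b) ≤ p * (c * g) →
      ENNReal.ofReal q * (ENNReal.ofReal a * (ENNReal.ofReal b * z)) ≤
        ENNReal.ofReal p * (ENNReal.ofReal c * z * ENNReal.ofReal g) := by
    intro a b c z ha hc hle
    have h0 := ENNReal.ofReal_le_ofReal hle
    rw [ENNReal.ofReal_mul hq, ENNReal.ofReal_mul ha, ENNReal.ofReal_mul hp.le,
      ENNReal.ofReal_mul hc] at h0
    calc _ = ENNReal.ofReal q * (ENNReal.ofReal a * ENNReal.ofReal b) * z := by ring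
      _ ≤ ENNReal.ofReal p * (ENNReal.ofReal c * ENNReal.ofReal g) * z := by gcongr
      _ = _ := by ring
  have hp0 : ENNReal.ofReal p ≠ 0 := by simpa using hp
  refine (ENNReal.mul_le_mul_iff_right hp0 ENNReal.ofReal_ne_top).1 (h.trans ?_)
  rw [mul_add, mul_add, add_mul, add_mul, mul_add, mul_add]
  exact add_le_add (add_le_add (key ha hc₁ h₁) (key hb hc₂ h₂)) (key hd hc₃ h₃)

lemma volume_heavy_inter_closedBall_le_rpow {μ : Measure ((Fin k → ℝ) × ℝ)} [IsFiniteMeasure μ]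
    {D : Set (((Fin k → ℝ) × ℝ) × (Fin k → ℝ))} {δ σ η K : ℝ} (hδ : 0 < δ) (hK : 0 < K)
    (hDa : ∀ p ∈ D, ENNReal.ofReal (δ ^ (σ + η)) ≤ tubeMass μ p.1 p.2 (2 * δ))
    (hDK : ∀ p ∈ D, ∀ r, δ ≤ r → tubeMass μ p.1 p.2 r ≤ ENNReal.ofReal (K * r ^ σ))
    (y : (Fin k → ℝ) × ℝ) (b₀ : Fin k → ℝ) (r : ℝ) (hr : δ ≤ r) :
    volume ({b | (y, b) ∈ D} ∩ closedBall b₀ r) ≤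
      ENNReal.ofReal (4 ^ k * 4 ^ σ * K * δ ^ (k - σ - η) * r ^ σ) := by
  have hS : ∀ b ∈ {b | (y, b) ∈ D}, ENNReal.ofReal (δ ^ (σ + η)) ≤ tubeMass μ y b (2 * δ) :=
    fun b hb => hDa (y, b) hb
  have hS' : ∀ b ∈ {b | (y, b) ∈ D}, ∀ r, δ ≤ r →
      tubeMass μ y b r ≤ ENNReal.ofReal (K * r ^ σ) := fun b hb => hDK (y, b) hb
  have h1 := volume_heavy_inter_closedBall_le hδ hS hS' b₀ hr
  have ha : 0 < δ ^ (σ + η) := Real.rpow_pos_of_pos hδ _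
  rw [mul_comm, ← ENNReal.le_div_iff_mul_le (Or.inl (by simpa using ha))
    (Or.inl ENNReal.ofReal_ne_top), ← ENNReal.ofReal_div_of_pos ha] at h1
  refine h1.trans_eq (congrArg _ ?_)
  have hr0 := hδ.trans_le hr
  rw [mul_pow, Real.mul_rpow (by norm_num) hr0.le,
    show (k : ℝ) - σ - η = k - (σ + η) by ring, Real.rpow_sub hδ, Real.rpow_natCast]
  field_simp

section Exponents

variable {δ A W K σ ζ η : ℝ}

lemma low_frequency_exponent_le (hδ : 0 < δ) (hδ1 : δ ≤ 1) (hA : 0 < A) (hW : 0 ≤ W) (hK : 0 ≤ K)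
    {κ : ℝ} (hκ : κ ≤ ζ * (k - σ) - η) :
    (2 * (A * δ)) ^ k * ((((2 * (A * δ ^ (1 - ζ))) ^ k)⁻¹ * (K * (2 * (A * δ ^ (1 - ζ))) ^ σ)) *
      ((2 * δ) ^ k * (W * δ ^ (k - σ - η) * A ^ σ))) ≤
    (2 * δ) ^ k * (2 * δ) ^ k * ((2 * A) ^ k * (2 ^ k)⁻¹ * ((2 * A) ^ k)⁻¹ * K * (2 * A) ^ σ * W *
      A ^ σ * δ ^ κ) := by
  have hκ' := Real.rpow_le_rpow_of_exponent_ge hδ hδ1 hκ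
  have e : δ ^ k * (δ ^ ((1 - ζ) * k))⁻¹ * δ ^ ((1 - ζ) * σ) * δ ^ k * δ ^ (k - σ - η) =
      δ ^ k * δ ^ k * δ ^ (ζ * (k - σ) - η) := by
    rw [← Real.rpow_natCast, ← Real.rpow_neg hδ.le]
    simp only [← Real.rpow_add hδ]
    congr 1; ring
  rw [← mul_assoc 2 A δ, ← mul_assoc 2 A (δ ^ (1 - ζ)), mul_rpow_natPow hδ,
    mul_rpow_rpow (by positivity) hδ, mul_pow (2 * A) δ, mul_pow 2 δ, mul_inv]
  calc _ = (2 * A) ^ k * ((2 * A) ^ k)⁻¹ * K * (2 * A) ^ σ * 2 ^ k * W * A ^ σ *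
        (δ ^ k * (δ ^ ((1 - ζ) * k))⁻¹ * δ ^ ((1 - ζ) * σ) * δ ^ k * δ ^ (k - σ - η)) := by ring
    _ = (2 * A) ^ k * ((2 * A) ^ k)⁻¹ * K * (2 * A) ^ σ * 2 ^ k * W * A ^ σ *
        (δ ^ k * δ ^ k) * δ ^ (ζ * (k - σ) - η) := by rw [e]; ring
    _ ≤ (2 * A) ^ k * ((2 * A) ^ k)⁻¹ * K * (2 * A) ^ σ * 2 ^ k * W * A ^ σ *
        (δ ^ k * δ ^ k) * δ ^ κ := by gcongr
    _ = _ := by field_simp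

lemma diagonal_exponent_le (hδ : 0 < δ) (hδ1 : δ ≤ 1) (hA : 0 ≤ A) (hW : 0 ≤ W) {κ κ' a b : ℝ}
    (ha : 0 ≤ a) (hb : 0 ≤ b) (hκ : κ ≤ κ') :
    (2 * (A * δ)) ^ k * (δ ^ (-k + η + κ') *
      ((2 * δ) ^ k * (W * δ ^ (k - σ - η) * ((a * δ) ^ σ * b)))) ≤
    (2 * δ) ^ k * (2 * δ) ^ k * ((2 * A) ^ k * (2 ^ k)⁻¹ * W * a ^ σ * b * δ ^ κ) := by
  have hκ' := Real.rpow_le_rpow_of_exponent_ge hδ hδ1 hκ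
  have e : δ ^ (-k + η + κ') * δ ^ (k - σ - η) * δ ^ σ = δ ^ κ' := by
    simp only [← Real.rpow_add hδ]
    congr 1; ring
  rw [← mul_assoc 2 A δ, Real.mul_rpow ha hδ.le, mul_pow (2 * A) δ, mul_pow 2 δ]
  calc _ = (2 * A) ^ k * 2 ^ k * W * a ^ σ * b * (δ ^ k * δ ^ k) *
        (δ ^ (-k + η + κ') * δ ^ (k - σ - η) * δ ^ σ) := by ring
    _ ≤ (2 * A) ^ k * 2 ^ k * W * a ^ σ * b * (δ ^ k * δ ^ k) * δ ^ κ := by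
        rw [e]; gcongr
    _ = _ := by field_simp

lemma high_frequency_exponent_le (hδ : 0 < δ) (hδ1 : δ ≤ 1) (hA : 0 < A) {κ κ' s c : ℝ}
    (hc : 0 ≤ c) (hκ : κ ≤ s - k - ζ * s - η - κ') :
    (2 * (A * δ)) ^ k * ((δ ^ (-k + η + κ'))⁻¹ *
      (c * ((2 * (A * δ)) ^ k)⁻¹ * (A * δ ^ (1 - ζ)) ^ s)) ≤
    (2 * δ) ^ k * (2 * δ) ^ k * ((2 ^ k * 2 ^ k)⁻¹ * c * A ^ s * δ ^ κ) := by
  have hκ' := Real.rpow_le_rpow_of_exponent_ge hδ hδ1 hκ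
  have e : (δ ^ (-k + η + κ'))⁻¹ * δ ^ ((1 - ζ) * s) =
      δ ^ k * δ ^ k * δ ^ (s - k - ζ * s - η - κ') := by
    rw [← Real.rpow_natCast, ← Real.rpow_neg hδ.le]
    simp only [← Real.rpow_add hδ]
    congr 1; ring
  have hAδ : (2 * (A * δ)) ^ k * ((2 * (A * δ)) ^ k)⁻¹ = 1 := mul_inv_cancel₀ (by positivity)
  rw [mul_rpow_rpow hA.le hδ, mul_pow 2 δ]
  calc _ = (2 * (A * δ)) ^ k * ((2 * (A * δ)) ^ k)⁻¹ * (c * A ^ s) *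
        ((δ ^ (-k + η + κ'))⁻¹ * δ ^ ((1 - ζ) * s)) := by ring
    _ ≤ c * A ^ s * (δ ^ k * δ ^ k * δ ^ κ) := by
        rw [e, hAδ, one_mul]; gcongr
    _ = _ := by field_simp

end Exponents

lemma measure_heavy_le_rpow {μ ν : Measure ((Fin k → ℝ) × ℝ)} [IsFiniteMeasure μ]
    [IsFiniteMeasure ν] {L s t σ K : ℝ} (hL : 1 ≤ L) (hks : k < s) (hsk : s ≤ k + 1) (ht : 0 < t)
    (htk : t < k) (hσt : σ ≤ t) (hK : 0 < K) (hμ : rieszEnergy s μ ≠ ∞)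
    (hν : rieszEnergy t ν ≠ ∞) :
    ∃ C : ℝ≥0∞, C ≠ ∞ ∧ ∃ κ : ℝ, 0 < κ ∧ ∀ δ : ℝ, 0 < δ → δ ≤ 1 →
      ∀ D : Set (((Fin k → ℝ) × ℝ) × (Fin k → ℝ)), MeasurableSet D →
      (∀ p ∈ D, ‖p.1‖ ≤ L ∧ ‖p.2‖ ≤ 2 * L + 1) →
      (∀ p ∈ D, ∀ᵐ x ∂μ, 1 ≤ |p.1.2 - x.2|) →
      (∀ p ∈ D, ENNReal.ofReal (δ ^ (σ + thinGain k s t)) ≤ tubeMass μ p.1 p.2 (2 * δ)) →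
      (∀ p ∈ D, ∀ r, δ ≤ r → tubeMass μ p.1 p.2 r ≤ ENNReal.ofReal (K * r ^ σ)) →
      ∀ B : Set (((Fin k → ℝ) × ℝ) × ((Fin k → ℝ) × ℝ)), MeasurableSet B →
      (∀ p ∈ B, ‖p.1‖ ≤ L ∧ ‖p.2‖ ≤ L ∧ 1 ≤ |p.1.2 - p.2.2|) →
      (∀ p ∈ B, ∀ b, ‖b - lineSlope p.2 p.1‖ ≤ δ → (p.1, b) ∈ D) →
      (ν.prod μ) B ≤ C * ENNReal.ofReal (δ ^ κ) := by
  have hk0 : (0 : ℝ) ≤ k := Nat.cast_nonneg k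
  have hs0 : 0 < s := by linarith
  set η := thinGain k s t with hη
  have hη0 : 0 < η := thinGain_pos hk0 hks htk
  have hηs : η < (s - k) / 2 := thinGain_lt hks ht htk
  set ζ := (s - k) / (2 * s) with hζ
  have hζ0 : 0 < ζ := div_pos (by linarith) (by linarith)
  have hζη : ζ * (k - t) = 2 * η := by rw [hη, thinGain]; ring
  have hζs : ζ * s = (s - k) / 2 := by rw [hζ]; field_simp
  set κ' := ((s - k) / 2 - η) / 2 with hκ'
  have hκ'0 : 0 < κ' := by rw [hκ']; linarith
  have hA1 : 1 ≤ 2 * L + 1 := by linarith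
  have hL0 : 0 ≤ L := by linarith
  refine ⟨ENNReal.ofReal ((2 * (2 * L + 1)) ^ k * (2 ^ k)⁻¹ * ((2 * (2 * L + 1)) ^ k)⁻¹ * K *
      (2 * (2 * L + 1)) ^ σ * (4 ^ k * 4 ^ σ * K) * (2 * L + 1) ^ σ) * ν univ +
    ENNReal.ofReal ((2 * (2 * L + 1)) ^ k * (2 ^ k)⁻¹ * (4 ^ k * 4 ^ σ * K) *
      ((4 * L + 6) * (2 * L + 3)) ^ σ * (2 * L) ^ (t - σ)) * rieszEnergy t ν +
    ENNReal.ofReal ((2 ^ k * 2 ^ k)⁻¹ * ((2 * (2 * ((2 * L + 1) + 1)) ^ k + 8 * 2 ^ k) *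
      ((2 * L + 1) + 4) ^ s) * (2 * L + 1) ^ s) * rieszEnergy s μ, ?_, min η κ',
    lt_min hη0 hκ'0, fun δ hδ hδ1 D hD hDL hDμ hDa hDK B hB hBL hBD => ?_⟩
  rotate_left
  · have hδR : (2 * L + 1) * δ ≤ (2 * L + 1) * δ ^ (1 - ζ) := by
      refine mul_le_mul_of_nonneg_left ?_ (by linarith)
      calc δ = δ ^ (1 : ℝ) := (Real.rpow_one δ).symm
        _ ≤ δ ^ (1 - ζ) := Real.rpow_le_rpow_of_exponent_ge hδ hδ1 (by linarith)
    have hDT : ∀ p ∈ D, tubeMass μ p.1 p.2 (2 * ((2 * L + 1) * δ ^ (1 - ζ))) ≤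
        ENNReal.ofReal (K * (2 * ((2 * L + 1) * δ ^ (1 - ζ))) ^ σ) :=
      fun p hp => hDK p hp _ (by nlinarith)
    have hDV := volume_heavy_inter_closedBall_le_rpow hδ hK hDa hDK
    have hmain := measure_heavy_le (ν := ν) (μ := μ) (ε := δ ^ (-k + η + κ')) hD hδ hL hδR
      (by positivity)
      (by positivity) (by positivity) hσt ht hs0 hsk hDL hDμ hDT hDV (by linarith) hB hBL hBD
    refine le_mul_of_mul_le_mul_add (by positivity) (by positivity) (by positivity) (by positivity)
      (by positivity) ?_ ?_ ?_ hmain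
      (low_frequency_exponent_le hδ hδ1 (by positivity) (by positivity) hK.le ?_)
      (diagonal_exponent_le hδ hδ1 (by positivity) (by positivity) (by positivity) (by positivity)
        (min_le_right _ _))
      (high_frequency_exponent_le hδ hδ1 (by positivity) (by positivity) ?_)
    · positivity
    · positivity
    · positivity
    · have := mul_le_mul_of_nonneg_left (sub_le_sub_left hσt (k : ℝ)) hζ0.le
      exact (min_le_left _ _).trans (by linarith)
    · exact (min_le_right _ _).trans (by linarith)
  · simp [ENNReal.mul_eq_top, hμ, hν]

end Scales

/-! ### Thin tubes at dyadic scales -/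

section Dyadic

lemma half_pow_rpow (j : ℕ) (κ : ℝ) : (((2 : ℝ)⁻¹) ^ j) ^ κ = (((2 : ℝ)⁻¹) ^ κ) ^ j := by
  rw [← Real.rpow_natCast, ← Real.rpow_natCast, ← Real.rpow_mul (by norm_num),
    ← Real.rpow_mul (by norm_num), mul_comm]

lemma tsum_ofReal_half_pow_rpow_lt_top {κ : ℝ} (hκ : 0 < κ) :
    ∑' j : ℕ, ENNReal.ofReal ((((2 : ℝ)⁻¹) ^ j) ^ κ) < ∞ := by
  have h0 : (0 : ℝ) ≤ (2 : ℝ)⁻¹ ^ κ := by positivity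
  simp only [half_pow_rpow, ENNReal.ofReal_pow h0]
  rw [ENNReal.tsum_geometric, ENNReal.inv_lt_top, tsub_pos_iff_lt, ENNReal.ofReal_lt_one]
  exact Real.rpow_lt_one (by norm_num) (by norm_num) hκ

/-- A Borel-Cantelli lemma over dyadic scales. -/
lemma ae_exists_forall_le_of_measure_le {α : Type*} [MeasurableSpace α] {P : Measure α}
    {f : ℕ → α → ℝ≥0∞} {m : ℝ≥0∞} (hm : m ≠ ∞) (hf : ∀ j x, f j x ≤ m) {G : Set α} {C : ℝ≥0∞}
    (hC : C ≠ ∞) {κ u : ℝ} (hκ : 0 < κ) (hu : 0 ≤ u)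
    (h : ∀ j, P {x | x ∈ G ∧ ENNReal.ofReal (((2 : ℝ)⁻¹ ^ j) ^ u) < f j x} ≤
      C * ENNReal.ofReal (((2 : ℝ)⁻¹ ^ j) ^ κ)) :
    ∀ᵐ x ∂P, x ∈ G → ∃ M : ℕ, ∀ j, f j x ≤ ENNReal.ofReal (M * ((2 : ℝ)⁻¹ ^ j) ^ u) := by
  have hsum : ∑' j, P {x | x ∈ G ∧ ENNReal.ofReal (((2 : ℝ)⁻¹ ^ j) ^ u) < f j x} ≠ ∞ := by
    refine ne_top_of_le_ne_top ?_ (ENNReal.tsum_le_tsum h)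
    rw [ENNReal.tsum_mul_left]
    exact ENNReal.mul_ne_top hC (tsum_ofReal_half_pow_rpow_lt_top hκ).ne
  filter_upwards [ae_eventually_notMem hsum] with x hx hxG
  obtain ⟨N, hN⟩ := Filter.eventually_atTop.1 hx
  set δ : ℝ := ((2 : ℝ)⁻¹ ^ N) ^ u with hδ
  have hδ0 : 0 < δ := by positivity
  obtain ⟨M, hM⟩ := exists_nat_ge (max 1 (m.toReal / δ))
  have hM1 : (1 : ℝ) ≤ M := (le_max_left _ _).trans hM
  refine ⟨M, fun j => ?_⟩
  rcases le_or_gt N j with hj | hj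
  · have h1 : f j x ≤ ENNReal.ofReal (((2 : ℝ)⁻¹ ^ j) ^ u) := by
      by_contra hcon
      exact hN j hj ⟨hxG, not_le.1 hcon⟩
    exact h1.trans (ENNReal.ofReal_le_ofReal (le_mul_of_one_le_left (by positivity) hM1))
  · refine (hf j x).trans ?_
    rw [← ENNReal.ofReal_toReal hm]
    refine ENNReal.ofReal_le_ofReal ?_
    have h2 : m.toReal ≤ M * δ := (div_le_iff₀ hδ0).1 ((le_max_right _ _).trans hM)
    refine h2.trans (mul_le_mul_of_nonneg_left ?_ (by linarith))
    exact Real.rpow_le_rpow (by positivity)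
      (pow_le_pow_of_le_one (by norm_num) (by norm_num) hj.le) hu

lemma le_ofReal_mul_rpow_of_forall_half_pow {f : ℝ → ℝ≥0∞} (hf : Monotone f) {m M σ : ℝ}
    (hm : 0 ≤ m) (hM : 0 ≤ M) (hσ : 0 ≤ σ) (hfm : ∀ r, f r ≤ ENNReal.ofReal m) {j : ℕ}
    (h : ∀ i ≤ j, f ((2 : ℝ)⁻¹ ^ i) ≤ ENNReal.ofReal (M * ((2 : ℝ)⁻¹ ^ i) ^ σ)) {r : ℝ}
    (hr : (2 : ℝ)⁻¹ ^ j ≤ r) : f r ≤ ENNReal.ofReal ((M * 2 ^ σ + m) * r ^ σ) := by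
  have hr0 : 0 < r := lt_of_lt_of_le (by positivity) hr
  rcases le_or_gt 1 r with h1 | h1
  · refine (hfm r).trans (ENNReal.ofReal_le_ofReal ?_)
    have h2 : 1 ≤ r ^ σ := Real.one_le_rpow h1 hσ
    have h3 : 0 ≤ M * 2 ^ σ := by positivity
    nlinarith
  · obtain ⟨n, hn, hn'⟩ := exists_nat_pow_near_of_lt_one hr0 h1.le
      (show (0 : ℝ) < 2⁻¹ by norm_num) (by norm_num)
    have hnj : n ≤ j := by
      by_contra hcon
      have := pow_lt_pow_right_of_lt_one₀ (show (0 : ℝ) < 2⁻¹ by norm_num) (by norm_num)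
        (not_le.1 hcon)
      linarith
    refine (hf hn').trans ((h n hnj).trans (ENNReal.ofReal_le_ofReal ?_))
    have h2 : ((2 : ℝ)⁻¹ ^ n) ^ σ ≤ 2 ^ σ * r ^ σ := by
      rw [← Real.mul_rpow (by norm_num) hr0.le]
      refine Real.rpow_le_rpow (by positivity) ?_ hσ
      rw [pow_succ] at hn
      linarith
    have h3 : 0 ≤ m * r ^ σ := by positivity
    nlinarith

end Dyadic

section Thin

variable {k : ℕ} {μ ν : Measure ((Fin k → ℝ) × ℝ)}

/-- Almost every pair `(y, x)` is such that the dyadic tubes around the line through `x` and `y`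
have `μ`-measure bounded by a multiple of the `σ`-th power of the width. -/
def IsThin (ν μ : Measure ((Fin k → ℝ) × ℝ)) (σ : ℝ) : Prop :=
  ∀ᵐ p ∂(ν.prod μ), ∃ M : ℕ, ∀ j : ℕ,
    tubeMass μ p.1 (lineSlope p.2 p.1) ((2 : ℝ)⁻¹ ^ j) ≤ ENNReal.ofReal (M * ((2 : ℝ)⁻¹ ^ j) ^ σ)

lemma tubeMass_le_ofReal [IsFiniteMeasure μ] (y : (Fin k → ℝ) × ℝ) (b : Fin k → ℝ) (r : ℝ) :
    tubeMass μ y b r ≤ ENNReal.ofReal (μ univ).toReal := by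
  rw [ENNReal.ofReal_toReal (measure_ne_top _ _)]
  exact measure_mono (subset_univ _)

lemma tubeMass_monotone (y : (Fin k → ℝ) × ℝ) (b : Fin k → ℝ) : Monotone (tubeMass μ y b) :=
  fun r r' h => tubeMass_mono (by simpa using h)

lemma IsThin.zero [IsFiniteMeasure μ] : IsThin ν μ 0 := by
  refine Filter.Eventually.of_forall fun p => ?_
  obtain ⟨M, hM⟩ := exists_nat_ge (μ univ).toReal
  exact ⟨M, fun j =>
    (tubeMass_le_ofReal _ _ _).trans (ENNReal.ofReal_le_ofReal (by simpa using hM))⟩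

lemma IsThin.mono {σ σ' : ℝ} (h : IsThin ν μ σ) (hσ : σ' ≤ σ) : IsThin ν μ σ' := by
  filter_upwards [h] with p ⟨M, hM⟩
  refine ⟨M, fun j => (hM j).trans (ENNReal.ofReal_le_ofReal ?_)⟩
  exact mul_le_mul_of_nonneg_left (Real.rpow_le_rpow_of_exponent_ge (by positivity)
    (pow_le_one₀ (by norm_num) (by norm_num)) hσ) (Nat.cast_nonneg M)

lemma measurable_tubeMass_lineSlope [IsFiniteMeasure μ] (r : ℝ) :
    Measurable fun p : ((Fin k → ℝ) × ℝ) × ((Fin k → ℝ) × ℝ) =>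
      tubeMass μ p.1 (lineSlope p.2 p.1) r := by
  have h1 : Measurable fun p : ((Fin k → ℝ) × ℝ) × ((Fin k → ℝ) × ℝ) =>
    (p.1, lineSlope p.2 p.1) := measurable_fst.prodMk (measurable_snd.lineSlope measurable_fst)
  have h := (measurable_tubeMass μ r).comp h1
  exact h

variable [IsFiniteMeasure μ] [IsFiniteMeasure ν] {L s t σ : ℝ}
  {S T : Set ((Fin k → ℝ) × ℝ)}

lemma IsThin.add_thinGain (hL : 1 ≤ L) (hks : k < s) (hsk : s ≤ k + 1) (ht : 0 < t)
    (htk : t < k) (hσ : 0 ≤ σ) (hσt : σ ≤ t) (hμ : rieszEnergy s μ ≠ ∞)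
    (hν : rieszEnergy t ν ≠ ∞) (hS : MeasurableSet S) (hT : MeasurableSet T) (hμS : μ Sᶜ = 0)
    (hνT : ν Tᶜ = 0) (hSL : ∀ x ∈ S, ‖x‖ ≤ L) (hTL : ∀ y ∈ T, ‖y‖ ≤ L)
    (hST : ∀ x ∈ S, ∀ y ∈ T, 1 ≤ |y.2 - x.2|) (h : IsThin ν μ σ) :
    IsThin ν μ (σ + thinGain k s t) := by
  have hη := thinGain_pos (Nat.cast_nonneg k) hks htk
  set η := thinGain k s t
  set m := (μ univ).toReal
  have hm : 0 ≤ m := ENNReal.toReal_nonneg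
  have key : ∀ M : ℕ, ∀ᵐ p ∂(ν.prod μ), p ∈ {p | p.1 ∈ T ∧ p.2 ∈ S ∧ ∀ j : ℕ,
      tubeMass μ p.1 (lineSlope p.2 p.1) ((2 : ℝ)⁻¹ ^ j) ≤
        ENNReal.ofReal (M * ((2 : ℝ)⁻¹ ^ j) ^ σ)} →
      ∃ M : ℕ, ∀ j, tubeMass μ p.1 (lineSlope p.2 p.1) ((2 : ℝ)⁻¹ ^ j) ≤
        ENNReal.ofReal (M * ((2 : ℝ)⁻¹ ^ j) ^ (σ + η)) := by
    intro M
    set M' : ℝ := (M * 2 ^ σ + m) * 2 ^ σ with hM'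
    have hM'0 : 0 ≤ M' := by positivity
    obtain ⟨C, hC, κ, hκ, hle⟩ := measure_heavy_le_rpow (K := M' * 2 ^ σ + m + 1) hL hks hsk ht htk
      hσt (by positivity) hμ hν
    refine ae_exists_forall_le_of_measure_le (C := C) (κ := κ) (measure_ne_top μ univ)
      (fun j p => measure_mono (subset_univ _)) hC hκ (by positivity) fun j => ?_
    set δ : ℝ := (2 : ℝ)⁻¹ ^ j with hδ
    have hδ0 : 0 < δ := by positivity
    have hδ1 : δ ≤ 1 := pow_le_one₀ (by norm_num) (by norm_num)
    set D : Set (((Fin k → ℝ) × ℝ) × (Fin k → ℝ)) := {p | p.1 ∈ T ∧ ‖p.2‖ ≤ 2 * L + 1 ∧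
      ENNReal.ofReal (δ ^ (σ + η)) ≤ tubeMass μ p.1 p.2 (2 * δ) ∧ ∀ i ≤ j,
        tubeMass μ p.1 p.2 ((2 : ℝ)⁻¹ ^ i) ≤ ENNReal.ofReal (M' * ((2 : ℝ)⁻¹ ^ i) ^ σ)} with hD
    refine hle δ hδ0 hδ1 D ?_ ?_ ?_ ?_ ?_ _ ?_ ?_ ?_
    · refine (measurable_fst hT).inter ((measurableSet_le measurable_snd.norm
        measurable_const).inter ((measurableSet_le measurable_const
        (measurable_tubeMass μ _)).inter ?_))
      refine MeasurableSet.congr (s := ⋂ i ∈ Set.Iic j, {p | tubeMass μ p.1 p.2 ((2 : ℝ)⁻¹ ^ i) ≤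
        ENNReal.ofReal (M' * ((2 : ℝ)⁻¹ ^ i) ^ σ)}) ?_ (by ext p; simp only [mem_iInter]; rfl)
      exact MeasurableSet.biInter (Set.to_countable _) fun i _ =>
        measurableSet_le (measurable_tubeMass μ _) measurable_const
    · exact fun p hp => ⟨hTL _ hp.1, hp.2.1⟩
    · intro p hp
      filter_upwards [measure_eq_zero_iff_ae_notMem.1 hμS] with x hx
      exact hST x (not_not.1 hx) _ hp.1
    · exact fun p hp => hp.2.2.1
    · intro p hp r hr
      refine (le_ofReal_mul_rpow_of_forall_half_pow (tubeMass_monotone p.1 p.2) hm hM'0 hσ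
        (tubeMass_le_ofReal _ _) hp.2.2.2 hr).trans (ENNReal.ofReal_le_ofReal ?_)
      have : 0 ≤ r ^ σ := Real.rpow_nonneg (hδ0.le.trans hr) _
      nlinarith
    · refine MeasurableSet.inter ((measurable_fst hT).inter ((measurable_snd hS).inter ?_))
        (measurableSet_lt measurable_const (measurable_tubeMass_lineSlope _))
      refine MeasurableSet.congr (s := ⋂ i : ℕ, {p | tubeMass μ p.1 (lineSlope p.2 p.1)
        ((2 : ℝ)⁻¹ ^ i) ≤ ENNReal.ofReal (M * ((2 : ℝ)⁻¹ ^ i) ^ σ)}) ?_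
          (by ext p; simp only [mem_iInter]; rfl)
      exact MeasurableSet.iInter fun i =>
        measurableSet_le (measurable_tubeMass_lineSlope _) measurable_const
    · exact fun p hp => ⟨hTL _ hp.1.1, hSL _ hp.1.2.1, hST _ hp.1.2.1 _ hp.1.1⟩
    · rintro p ⟨⟨hpT, hpS, hpM⟩, hpδ⟩ b hb
      have hsl := norm_lineSlope_le (hST _ hpS _ hpT) (hSL _ hpS) (hTL _ hpT)
      have hb' : ‖lineSlope p.2 p.1 - b‖ ≤ δ := by rwa [norm_sub_rev]
      refine ⟨hpT, ?_, ?_, fun i hi => ?_⟩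
      · have := norm_le_norm_add_norm_sub' b (lineSlope p.2 p.1)
        show ‖b‖ ≤ 2 * L + 1
        linarith
      · exact hpδ.le.trans (tubeMass_mono (by linarith))
      · have hi' : δ ≤ (2 : ℝ)⁻¹ ^ i := pow_le_pow_of_le_one (by norm_num) (by norm_num) hi
        have h2 : δ ≤ 2 * (2 : ℝ)⁻¹ ^ i := by linarith
        have h1 := le_ofReal_mul_rpow_of_forall_half_pow
          (tubeMass_monotone (μ := μ) p.1 (lineSlope p.2 p.1)) hm (Nat.cast_nonneg M) hσ
          (tubeMass_le_ofReal _ _) (fun i _ => hpM i) h2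
        rw [Real.mul_rpow (by norm_num) (by positivity), ← mul_assoc] at h1
        exact (tubeMass_mono (by linarith)).trans h1
  have hTS : ∀ᵐ p ∂(ν.prod μ), p.1 ∈ T ∧ p.2 ∈ S := by
    have h1 : ∀ᵐ y ∂ν, y ∈ T := by simpa using measure_eq_zero_iff_ae_notMem.1 hνT
    have h2 : ∀ᵐ x ∂μ, x ∈ S := by simpa using measure_eq_zero_iff_ae_notMem.1 hμS
    exact (Measure.quasiMeasurePreserving_fst.ae h1).and (Measure.quasiMeasurePreserving_snd.ae h2)
  filter_upwards [h, hTS, ae_all_iff.2 key] with p ⟨M, hM⟩ hp hkey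
  exact hkey M ⟨hp.1, hp.2, hM⟩

lemma isThin_of_rieszEnergy_ne_top (hL : 1 ≤ L) (hks : k < s) (hsk : s ≤ k + 1) (ht : 0 < t)
    (htk : t < k) (hμ : rieszEnergy s μ ≠ ∞) (hν : rieszEnergy t ν ≠ ∞) (hS : MeasurableSet S)
    (hT : MeasurableSet T) (hμS : μ Sᶜ = 0) (hνT : ν Tᶜ = 0) (hSL : ∀ x ∈ S, ‖x‖ ≤ L)
    (hTL : ∀ y ∈ T, ‖y‖ ≤ L) (hST : ∀ x ∈ S, ∀ y ∈ T, 1 ≤ |y.2 - x.2|) : IsThin ν μ t := by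
  have hη := thinGain_pos (Nat.cast_nonneg k) hks htk
  have key : ∀ n : ℕ, IsThin ν μ (min (n * thinGain k s t) t) := by
    intro n
    induction n with
    | zero => exact IsThin.zero.mono (by simp)
    | succ n ih =>
      refine (ih.add_thinGain hL hks hsk ht htk (le_min (by positivity) ht.le) (min_le_right _ _)
        hμ hν hS hT hμS hνT hSL hTL hST).mono ?_
      rw [← min_add_add_right]
      refine min_le_min (by push_cast; linarith) (by linarith)
  obtain ⟨n, hn⟩ := exists_nat_ge (t / thinGain k s t)
  exact (key n).mono (le_min ((div_le_iff₀ hη).1 hn) le_rfl)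

end Thin

/-! ### Exchanging the roles of the two measures -/

section Transfer

lemma prod_prod_apply_eq_lintegral_lintegral {α β γ : Type*} [MeasurableSpace α]
    [MeasurableSpace β] [MeasurableSpace γ] (μ : Measure α) (ν : Measure β) (ν' : Measure γ)
    [SFinite μ] [SFinite ν] [SFinite ν'] {W : Set ((α × β) × γ)} (hW : MeasurableSet W) :
    ((μ.prod ν).prod ν') W = ∫⁻ y, ∫⁻ y', μ {x | ((x, y), y') ∈ W} ∂ν' ∂ν := by
  rw [Measure.prod_apply hW, lintegral_prod_symm' _ (measurable_measure_prodMk_left hW)]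
  refine lintegral_congr fun y => ?_
  have hWy : MeasurableSet {q : α × γ | ((q.1, y), q.2) ∈ W} :=
    ((measurable_fst.prodMk measurable_const).prodMk measurable_snd) hW
  exact (Measure.prod_apply hWy).symm.trans (Measure.prod_apply_symm hWy)

variable {k : ℕ} {μ ν : Measure ((Fin k → ℝ) × ℝ)}

lemma norm_shear_lineSlope_le {L δ : ℝ} (hL : 1 ≤ L)
    {x y y' : (Fin k → ℝ) × ℝ} (hx : ‖x‖ ≤ L) (hy' : ‖y'‖ ≤ L) (hxy : 1 ≤ |y.2 - x.2|)
    (hxy' : 1 ≤ |y'.2 - x.2|) (h : ‖lineSlope x y' - lineSlope x y‖ ≤ δ) :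
    ‖shear (lineSlope x y) (y' - y)‖ ≤ 2 * (L * δ) := by
  have h0 : shear (lineSlope x y) (y - x) = 0 := by
    rw [shear_sub_eq_smul hxy, sub_self, smul_zero]
  have h1 : y' - y = (y' - x) - (y - x) := by abel
  rw [h1, shear_sub, h0, sub_zero]
  refine (norm_shear_le hxy' hx hy' _).trans ?_
  rw [mul_assoc]
  gcongr

lemma measure_lineSlope_close_le [IsFiniteMeasure μ] {L δ t K : ℝ} (hL : 1 ≤ L) (hδ : 0 < δ)
    (ht : 0 < t) (hK : 0 < K) {y y' : (Fin k → ℝ) × ℝ} (hy : ‖y‖ ≤ L) (hy' : ‖y'‖ ≤ L)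
    {A : Set ((Fin k → ℝ) × ℝ)} (hAL : ∀ x ∈ A, ‖x‖ ≤ L)
    (hAy : ∀ x ∈ A, 1 ≤ |y.2 - x.2| ∧ 1 ≤ |y'.2 - x.2|)
    (hA : ∀ x ∈ A, ∀ r, 0 < r → tubeMass μ y (lineSlope x y) r ≤ ENNReal.ofReal (K * r ^ t))
    (hAδ : ∀ x ∈ A, ‖lineSlope x y' - lineSlope x y‖ ≤ δ) :
    μ A ≤ ENNReal.ofReal (K * ((4 + 2 * (2 * L)) * (2 * L + 2) * (L * δ)) ^ t) *
      edist y y' ^ (-t) := by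
  rcases eq_or_ne y y' with rfl | hne
  · rw [edist_self, ENNReal.zero_rpow_of_neg (by linarith), ENNReal.mul_top]
    · exact le_top
    · simp only [ne_eq, ENNReal.ofReal_eq_zero, not_le]
      positivity
  rcases A.eq_empty_or_nonempty with rfl | ⟨x₀, hx₀⟩
  · simp
  have hz : y' - y ≠ 0 := sub_ne_zero.2 hne.symm
  have hz0 : 0 < ‖y' - y‖ := norm_pos_iff.2 hz
  set c : ℝ := (4 + 2 * (2 * L)) * (2 * L + 2) * (L * δ) with hc
  have hc0 : 0 < c := by positivity
  have hsub : A ⊆ {x | ‖lineSlope x y - lineSlope x₀ y‖ ≤ c / ‖y' - y‖} := fun x hx =>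
    norm_sub_le_of_norm_shear_le hz (by positivity) (by linarith)
      (norm_lineSlope_le (hAy x hx).1 (hAL x hx) hy)
      (norm_lineSlope_le (hAy x₀ hx₀).1 (hAL x₀ hx₀) hy)
      (norm_shear_lineSlope_le hL (hAL x hx) hy' (hAy x hx).1 (hAy x hx).2
        (hAδ x hx))
      (norm_shear_lineSlope_le hL (hAL x₀ hx₀) hy' (hAy x₀ hx₀).1
        (hAy x₀ hx₀).2 (hAδ x₀ hx₀))
  refine (measure_mono hsub).trans ((hA x₀ hx₀ _ (by positivity)).trans_eq ?_)
  rw [edist_comm, edist_dist, dist_eq_norm, ENNReal.ofReal_rpow_of_pos hz0,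
    ← ENNReal.ofReal_mul (by positivity), Real.div_rpow hc0.le hz0.le, Real.rpow_neg hz0.le,
    mul_assoc, div_eq_mul_inv]

variable [IsFiniteMeasure μ] [IsFiniteMeasure ν] {L t u : ℝ} {S T : Set ((Fin k → ℝ) × ℝ)}

lemma IsThin.swap (hL : 1 ≤ L) (ht : 0 < t) (hu : 0 ≤ u) (hut : u < t)
    (hν : rieszEnergy t ν ≠ ∞) (hS : MeasurableSet S)
    (hT : MeasurableSet T) (hμS : μ Sᶜ = 0) (hνT : ν Tᶜ = 0) (hSL : ∀ x ∈ S, ‖x‖ ≤ L)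
    (hTL : ∀ y ∈ T, ‖y‖ ≤ L) (hST : ∀ x ∈ S, ∀ y ∈ T, 1 ≤ |y.2 - x.2|) (h : IsThin ν μ t) :
    IsThin μ ν u := by
  set m := (μ univ).toReal
  have hm : 0 ≤ m := ENNReal.toReal_nonneg
  have key : ∀ M : ℕ, ∀ᵐ p ∂(μ.prod ν), p ∈ {p | p.1 ∈ S ∧ p.2 ∈ T ∧ ∀ j : ℕ,
      tubeMass μ p.2 (lineSlope p.1 p.2) ((2 : ℝ)⁻¹ ^ j) ≤
        ENNReal.ofReal (M * ((2 : ℝ)⁻¹ ^ j) ^ t)} →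
      ∃ M : ℕ, ∀ j, tubeMass ν p.1 (lineSlope p.2 p.1) ((2 : ℝ)⁻¹ ^ j) ≤
        ENNReal.ofReal (M * ((2 : ℝ)⁻¹ ^ j) ^ u) := by
    intro M
    set K : ℝ := M * 2 ^ t + m + 1 with hK
    have hK0 : 0 < K := by positivity
    set c : ℝ := (4 + 2 * (2 * L)) * (2 * L + 2) * L with hc
    have hc0 : 0 < c := by positivity
    set G : Set (((Fin k → ℝ) × ℝ) × ((Fin k → ℝ) × ℝ)) := {p | p.1 ∈ S ∧ p.2 ∈ T ∧ ∀ j : ℕ,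
      tubeMass μ p.2 (lineSlope p.1 p.2) ((2 : ℝ)⁻¹ ^ j) ≤
        ENNReal.ofReal (M * ((2 : ℝ)⁻¹ ^ j) ^ t)} with hG
    have hGm : MeasurableSet G := by
      refine (measurable_fst hS).inter ((measurable_snd hT).inter ?_)
      refine MeasurableSet.congr (s := ⋂ j : ℕ, Prod.swap ⁻¹' {p | tubeMass μ p.1
        (lineSlope p.2 p.1) ((2 : ℝ)⁻¹ ^ j) ≤ ENNReal.ofReal (M * ((2 : ℝ)⁻¹ ^ j) ^ t)}) ?_
        (by ext p; simp only [mem_iInter]; rfl)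
      exact MeasurableSet.iInter fun j => measurable_swap
        (measurableSet_le (measurable_tubeMass_lineSlope _) measurable_const)
    have hGK : ∀ p ∈ G, ∀ r, 0 < r →
        tubeMass μ p.2 (lineSlope p.1 p.2) r ≤ ENNReal.ofReal (K * r ^ t) := by
      intro p hp r hr
      obtain ⟨j, hj⟩ := exists_pow_lt_of_lt_one hr (show (2 : ℝ)⁻¹ < 1 by norm_num)
      refine (le_ofReal_mul_rpow_of_forall_half_pow (tubeMass_monotone _ _) hm (Nat.cast_nonneg M)
        ht.le (tubeMass_le_ofReal _ _) (fun i _ => hp.2.2 i) hj.le).trans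
        (ENNReal.ofReal_le_ofReal ?_)
      exact mul_le_mul_of_nonneg_right (by linarith) (by positivity)
    refine ae_exists_forall_le_of_measure_le (C := ENNReal.ofReal (K * c ^ t) * rieszEnergy t ν)
      (κ := t - u) (measure_ne_top ν univ) (fun j p => measure_mono (subset_univ _))
      (ENNReal.mul_ne_top ENNReal.ofReal_ne_top hν) (by linarith) hu fun j => ?_
    set δ : ℝ := (2 : ℝ)⁻¹ ^ j with hδ
    have hδ0 : 0 < δ := by positivity
    set W : Set ((((Fin k → ℝ) × ℝ) × ((Fin k → ℝ) × ℝ)) × ((Fin k → ℝ) × ℝ)) :=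
      {q | q.1 ∈ G ∧ q.2 ∈ T ∧ ‖lineSlope q.2 q.1.1 - lineSlope q.1.2 q.1.1‖ ≤ δ} with hW
    have hWm : MeasurableSet W := (measurable_fst hGm).inter ((measurable_snd hT).inter
      (measurableSet_le (((measurable_snd.lineSlope measurable_fst.fst).sub
        (measurable_fst.snd.lineSlope measurable_fst.fst)).norm) measurable_const))
    have hW_le : ((μ.prod ν).prod ν) W ≤
        ENNReal.ofReal (K * c ^ t * δ ^ t) * rieszEnergy t ν := by
      rw [prod_prod_apply_eq_lintegral_lintegral μ ν ν hWm, rieszEnergy,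
        ← lintegral_const_mul' _ _ ENNReal.ofReal_ne_top]
      refine lintegral_mono fun y => ?_
      rw [← lintegral_const_mul' _ _ ENNReal.ofReal_ne_top]
      refine lintegral_mono fun y' => ?_
      rw [mul_assoc, ← Real.mul_rpow hc0.le hδ0.le, hc, mul_assoc _ L δ]
      rcases em (y ∈ T ∧ y' ∈ T) with hy | hy
      · refine measure_lineSlope_close_le hL hδ0 ht hK0 (hTL y hy.1) (hTL y' hy.2)
          (fun x hx => hSL x hx.1.1) (fun x hx => ⟨hST x hx.1.1 y hy.1, hST x hx.1.1 y' hy.2⟩)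
          (fun x hx => hGK (x, y) hx.1) (fun x hx => ?_)
        rw [lineSlope_comm x y', lineSlope_comm x y]
        exact hx.2.2
      · have : {x | ((x, y), y') ∈ W} = ∅ :=
          eq_empty_of_forall_notMem fun x hx => hy ⟨hx.1.2.1, hx.2.1⟩
        rw [this, measure_empty]
        exact zero_le
    set B : Set (((Fin k → ℝ) × ℝ) × ((Fin k → ℝ) × ℝ)) :=
      {p | p ∈ G ∧ ENNReal.ofReal (δ ^ u) < tubeMass ν p.1 (lineSlope p.2 p.1) δ} with hB
    have hB_le : ENNReal.ofReal (δ ^ u) * (μ.prod ν) B ≤ ((μ.prod ν).prod ν) W := by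
      rw [Measure.prod_apply hWm]
      refine le_trans ?_ (mul_meas_ge_le_lintegral (measurable_measure_prodMk_left hWm)
        (ENNReal.ofReal (δ ^ u)))
      gcongr
      rintro p ⟨hp, hlt⟩
      refine hlt.le.trans ?_
      rw [tubeMass, ← measure_inter_conull hνT]
      exact measure_mono fun y' hy' => ⟨hp, hy'.2, hy'.1⟩
    have hδu : 0 < δ ^ u := Real.rpow_pos_of_pos hδ0 _
    have h1 := hB_le.trans hW_le
    rw [mul_comm, ← ENNReal.le_div_iff_mul_le (Or.inl (by simpa using hδu))
      (Or.inl ENNReal.ofReal_ne_top), ENNReal.ofReal_mul (by positivity)] at h1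
    refine h1.trans_eq ?_
    rw [Real.rpow_sub hδ0, ENNReal.ofReal_div_of_pos hδu, div_eq_mul_inv, div_eq_mul_inv]
    ring
  have hTS : ∀ᵐ p ∂(μ.prod ν), p.1 ∈ S ∧ p.2 ∈ T := by
    have h1 : ∀ᵐ y ∂ν, y ∈ T := by simpa using measure_eq_zero_iff_ae_notMem.1 hνT
    have h2 : ∀ᵐ x ∂μ, x ∈ S := by simpa using measure_eq_zero_iff_ae_notMem.1 hμS
    exact (Measure.quasiMeasurePreserving_fst.ae h2).and (Measure.quasiMeasurePreserving_snd.ae h1)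
  have hswap : ∀ᵐ p ∂(μ.prod ν), ∃ M : ℕ, ∀ j : ℕ,
      tubeMass μ p.2 (lineSlope p.1 p.2) ((2 : ℝ)⁻¹ ^ j) ≤
        ENNReal.ofReal (M * ((2 : ℝ)⁻¹ ^ j) ^ t) := by
    have hmp : Measure.QuasiMeasurePreserving Prod.swap (μ.prod ν) (ν.prod μ) :=
      Measure.measurePreserving_swap.quasiMeasurePreserving
    exact hmp.ae h
  filter_upwards [hswap, hTS, ae_all_iff.2 key] with p ⟨M, hM⟩ hp hkey
  exact hkey M ⟨hp.1, hp.2, hM⟩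

end Transfer

/-! ### Slopes seen from a typical point -/

section Slopes

variable {d k : ℕ}

/-- A mass distribution principle for images. -/
lemma le_dimH_image_of_measure_closedBall_le {α E : Type*} [MeasurableSpace α]
    [NormedAddCommGroup E] [MeasurableSpace E] [BorelSpace E] {Q : Measure α} {f : α → E}
    (hf : Measurable f) {A : Set α} (hQA : Q A ≠ 0) {u : ℝ≥0} {K : ℝ} (hK : 0 < K)
    (h : ∀ y ∈ A, ∀ r, 0 < r → Q {y' | ‖f y' - f y‖ ≤ r} ≤ ENNReal.ofReal (K * r ^ (u : ℝ))) :
    (u : ℝ≥0∞) ≤ dimH (f '' A) := by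
  have hK' : ENNReal.ofReal K ≠ 0 := by simpa using hK
  refine le_dimH_of_hausdorffMeasure_ne_zero fun h0 => ?_
  have hle : (ENNReal.ofReal K)⁻¹ • (Q.restrict A).map f ≤ Measure.hausdorffMeasure (u : ℝ) := by
    refine Measure.le_hausdorffMeasure _ _ 1 one_pos fun s hs => ?_
    rw [Measure.smul_apply, smul_eq_mul, ENNReal.inv_mul_le_iff hK' ENNReal.ofReal_ne_top]
    refine (measure_mono subset_closure).trans ?_
    rw [Measure.map_apply hf isClosed_closure.measurableSet,
      Measure.restrict_apply (hf isClosed_closure.measurableSet)]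
    rcases (f ⁻¹' closure s ∩ A).eq_empty_or_nonempty with he | ⟨y, hys, hyA⟩
    · simp [he]
    have hs_top : ediam s ≠ ∞ := ne_top_of_le_ne_top ENNReal.one_ne_top hs
    have hlt : ∀ r : ℝ, (ediam s).toReal < r →
        Q (f ⁻¹' closure s ∩ A) ≤ ENNReal.ofReal (K * r ^ (u : ℝ)) := by
      intro r hr
      refine le_trans (measure_mono fun y' hy' => ?_)
        (h y hyA r (ENNReal.toReal_nonneg.trans_lt hr))
      have h1 : edist (f y') (f y) ≤ ediam (closure s) := edist_le_ediam_of_mem hy'.1 hys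
      rw [ediam_closure, edist_dist] at h1
      have h2 := (ENNReal.ofReal_le_iff_le_toReal hs_top).1 h1
      rw [dist_eq_norm] at h2
      exact h2.trans hr.le
    have hcont : Filter.Tendsto (fun r : ℝ => ENNReal.ofReal (K * r ^ (u : ℝ)))
        (nhdsWithin (ediam s).toReal (Ioi (ediam s).toReal))
        (nhds (ENNReal.ofReal (K * (ediam s).toReal ^ (u : ℝ)))) := by
      refine Filter.Tendsto.mono_left ?_ nhdsWithin_le_nhds
      exact (ENNReal.continuous_ofReal.comp (continuous_const.mul
        (Real.continuous_rpow_const u.2))).tendsto _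
    refine (ge_of_tendsto hcont (Filter.eventually_of_mem self_mem_nhdsWithin hlt)).trans_eq ?_
    rw [ENNReal.ofReal_mul hK.le, ENNReal.toReal_rpow, ENNReal.ofReal_toReal]
    exact ENNReal.rpow_ne_top_of_nonneg u.2 hs_top
  have h1 := (hle (f '' A)).trans_eq h0
  rw [Measure.smul_apply, smul_eq_mul, nonpos_iff_eq_zero, mul_eq_zero] at h1
  rcases h1 with h1 | h1
  · exact ENNReal.ofReal_ne_top (ENNReal.inv_eq_zero.1 h1)
  · refine hQA (le_antisymm ?_ zero_le)
    rw [← h1]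
    exact (Measure.restrict_apply_self Q A).symm.le.trans
      (Measure.le_map_apply_image hf.aemeasurable A)

lemma rieszEnergy_restrict_map_ne_top {E F : Type*} [MeasurableSpace E]
    [PseudoEMetricSpace F] [MeasurableSpace F] [OpensMeasurableSpace F]
    [SecondCountableTopology F] {P : Measure E} [SFinite P] {f : E → F} (hf : Measurable f)
    {s : ℝ} (h : ∫⁻ x, ∫⁻ y, edist (f x) (f y) ^ (-s) ∂P ∂P < ∞) (S : Set F) :
    rieszEnergy s ((P.map f).restrict S) ≠ ∞ := by
  have hm : Measurable fun p : F × F => edist p.1 p.2 ^ (-s) := measurable_edist.pow_const _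
  refine ne_top_of_le_ne_top h.ne ?_
  calc rieszEnergy s ((P.map f).restrict S) ≤ rieszEnergy s (P.map f) :=
        lintegral_mono' Measure.restrict_le_self fun x =>
          lintegral_mono' Measure.restrict_le_self le_rfl
    _ = ∫⁻ x, ∫⁻ y, edist (f x) y ^ (-s) ∂(P.map f) ∂P :=
        lintegral_map hm.lintegral_prod_right' hf
    _ = _ := lintegral_congr fun x => lintegral_map (hm.comp measurable_prodMk_left) hf

lemma rieszEnergy_ne_top_of_forall_le {E : Type*} [MeasurableSpace E] [PseudoEMetricSpace E]
    {P : Measure E} [IsProbabilityMeasure P] {s : ℝ} {C : ℝ≥0∞} (hC : C ≠ ∞)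
    (h : ∀ x, ∫⁻ y, edist x y ^ (-s) ∂P ≤ C) : rieszEnergy s P ≠ ∞ := by
  refine ne_top_of_le_ne_top hC ((lintegral_mono h).trans ?_)
  simp

lemma measure_singleton_eq_zero_of_lintegral_edist_le {E : Type*} [MeasurableSpace E]
    [PseudoEMetricSpace E] [MeasurableSingletonClass E] {P : Measure E} {s : ℝ} (hs : 0 < s)
    {C : ℝ≥0∞} (hC : C ≠ ∞) {x : E} (h : ∫⁻ y, edist x y ^ (-s) ∂P ≤ C) : P {x} = 0 := by
  by_contra hx
  refine hC (top_le_iff.1 (le_trans ?_ h))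
  calc ∞ = ∫⁻ y in {x}, edist x y ^ (-s) ∂P := by
        rw [lintegral_singleton, edist_self, ENNReal.zero_rpow_of_neg (by linarith),
          ENNReal.top_mul hx]
    _ ≤ _ := setLIntegral_le_lintegral _ _

lemma exists_points_of_measure {E : Type*} [TopologicalSpace E] [SecondCountableTopology E]
    [MeasurableSpace E] [OpensMeasurableSpace E] [T1Space E] (P Q : Measure E)
    [IsProbabilityMeasure P] [IsProbabilityMeasure Q] (hP : ∀ x, P {x} = 0) :
    ∃ x y, x ≠ y ∧ (∀ U ∈ nhds x, P U ≠ 0) ∧ ∀ V ∈ nhds y, Q V ≠ 0 := by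
  obtain ⟨y, -, hy⟩ := exists_mem_forall_mem_nhdsWithin_pos_measure (μ := Q) (s := univ) (by simp)
  obtain ⟨x, hxy, hx⟩ := exists_mem_forall_mem_nhdsWithin_pos_measure (μ := P) (s := {y}ᶜ) (by
    rw [prob_compl_eq_one_sub (measurableSet_singleton y), hP]; simp)
  exact ⟨x, y, hxy, fun U hU => (hx U (mem_nhdsWithin_of_mem_nhds hU)).ne',
    fun V hV => (hy V (mem_nhdsWithin_of_mem_nhds hV)).ne'⟩

end Slopes

section Core

variable {d k : ℕ}

lemma exists_le_dimH_lineSlope_image {E : Type*} [MeasurableSpace E] {Q : Measure E}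
    [IsProbabilityMeasure Q] {Λ : E → (Fin k → ℝ) × ℝ} (hΛ : Measurable Λ)
    {T : Set ((Fin k → ℝ) × ℝ)} (hT : MeasurableSet T) {Y : Set E}
    (hY : Q (Y ∩ Λ ⁻¹' T) ≠ 0) {u : ℝ≥0} {w : (Fin k → ℝ) × ℝ}
    (h : ∀ᵐ q ∂((Q.map Λ).restrict T), ∃ M : ℕ, ∀ j : ℕ,
      tubeMass ((Q.map Λ).restrict T) w (lineSlope q w) ((2 : ℝ)⁻¹ ^ j) ≤
        ENNReal.ofReal (M * ((2 : ℝ)⁻¹ ^ j) ^ (u : ℝ))) :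
    ∃ A ⊆ Y ∩ Λ ⁻¹' T, (u : ℝ≥0∞) ≤ dimH ((fun y => lineSlope (Λ y) w) '' A) := by
  have hslope : Measurable fun y => lineSlope (Λ y) w := hΛ.lineSlope measurable_const
  set ν := (Q.map Λ).restrict T with hν
  have : IsProbabilityMeasure (Q.map Λ) := Measure.isProbabilityMeasure_map hΛ.aemeasurable
  have hQ : ∀ᵐ y ∂Q, y ∈ Λ ⁻¹' T → ∃ M : ℕ, ∀ j : ℕ,
      tubeMass ν w (lineSlope (Λ y) w) ((2 : ℝ)⁻¹ ^ j) ≤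
        ENNReal.ofReal (M * ((2 : ℝ)⁻¹ ^ j) ^ (u : ℝ)) :=
    ae_of_ae_map hΛ.aemeasurable (ae_imp_of_ae_restrict h)
  have hM : ∃ M : ℕ, Q.restrict (Λ ⁻¹' T) {y | y ∈ Y ∩ Λ ⁻¹' T ∧ ∀ j : ℕ,
      tubeMass ν w (lineSlope (Λ y) w) ((2 : ℝ)⁻¹ ^ j) ≤
        ENNReal.ofReal (M * ((2 : ℝ)⁻¹ ^ j) ^ (u : ℝ))} ≠ 0 := by
    by_contra! hcon
    refine hY ?_
    rw [← Measure.restrict_eq_self Q inter_subset_right]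
    rw [← measure_iUnion_null_iff] at hcon
    refine measure_mono_null_ae ?_ hcon
    filter_upwards [ae_restrict_of_ae hQ] with y hy hyY
    obtain ⟨M, hM⟩ := hy hyY.2
    exact mem_iUnion.2 ⟨M, hyY, hM⟩
  obtain ⟨M, hM⟩ := hM
  refine ⟨_, fun y hy => hy.1, le_dimH_image_of_measure_closedBall_le hslope hM
    (K := M * 2 ^ (u : ℝ) + (ν univ).toReal + 1) (by positivity) fun y hy r hr => ?_⟩
  have hmass : Q.restrict (Λ ⁻¹' T) {y' | ‖lineSlope (Λ y') w - lineSlope (Λ y) w‖ ≤ r} =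
      tubeMass ν w (lineSlope (Λ y) w) r := by
    rw [tubeMass, hν, Measure.restrict_map hΛ hT, Measure.map_apply hΛ]
    · rfl
    · exact measurableSet_le
        (((measurable_id.lineSlope measurable_const).sub_const _).norm) measurable_const
  rw [hmass]
  obtain ⟨j, hj⟩ := exists_pow_lt_of_lt_one hr (show (2 : ℝ)⁻¹ < 1 by norm_num)
  refine (le_ofReal_mul_rpow_of_forall_half_pow (tubeMass_monotone w _) ENNReal.toReal_nonneg
    (Nat.cast_nonneg M) u.2 (fun r => tubeMass_le_ofReal _ _ r) (fun i _ => hy.2 i) hj.le).trans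
    (ENNReal.ofReal_le_ofReal ?_)
  exact mul_le_mul_of_nonneg_right (le_add_of_nonneg_right zero_le_one) (by positivity)

theorem exists_le_dimH_lineSlope_image_of_lt_dimH {X Y : Set (Fin d → ℝ)}
    (hX : MeasurableSet X) (hY : MeasurableSet Y) {s t u : ℝ≥0} (hks : k < s) (hsk : s < k + 1)
    (hs : s < dimH X) (hu : 0 < u) (hut : u < t) (htk : t < k) (ht : t < dimH Y) :
    ∃ Λ : (Fin d → ℝ) →L[ℝ] (Fin k → ℝ) × ℝ, ∃ x ∈ X, ∃ A ⊆ Y,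
      (∀ y ∈ A, 0 < (Λ y).2 - (Λ x).2) ∧
        (u : ℝ≥0∞) ≤ dimH ((fun y => lineSlope (Λ y) (Λ x)) '' A) := by
  have ht0 : 0 < t := hu.trans hut
  have hs0 : 0 < s := lt_of_le_of_lt zero_le hks
  have hks' : (k : ℝ) < s := by exact_mod_cast hks
  have hsk' : (s : ℝ) < k + 1 := by exact_mod_cast hsk
  have htk' : (t : ℝ) < k := by exact_mod_cast htk
  obtain ⟨P, hPp, hPX, C, hC, hP⟩ := exists_measure_lintegral_edist_le hX hs0 hs
  obtain ⟨Q, hQp, hQY, D, hD, hQ⟩ := exists_measure_lintegral_edist_le hY ht0 ht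
  obtain ⟨x₀, y₀, hxy, hPx, hQy⟩ := exists_points_of_measure P Q fun x =>
    measure_singleton_eq_zero_of_lintegral_edist_le (NNReal.coe_pos.2 hs0) hC (hP x)
  obtain ⟨Λ, hΛz, hΛP, hΛQ⟩ := exists_linear_rieszEnergy_lt_top (k := k) (NNReal.coe_pos.2 hs0)
    hsk' (NNReal.coe_pos.2 ht0) (by linarith) (rieszEnergy_ne_top_of_forall_le hC hP)
    (rieszEnergy_ne_top_of_forall_le hD hQ) (sub_ne_zero.2 hxy.symm) (two_ne_zero (α := ℝ))
  have hΛm : Measurable Λ := Λ.continuous.measurable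
  have := Measure.isProbabilityMeasure_map (μ := P) hΛm.aemeasurable
  have := Measure.isProbabilityMeasure_map (μ := Q) hΛm.aemeasurable
  set S := ball (Λ x₀) (1 / 2) with hS
  set T := ball (Λ y₀) (1 / 2) with hT
  set L := ‖Λ x₀‖ + ‖Λ y₀‖ + 1 with hL
  have hSL : ∀ x ∈ S, ‖x‖ ≤ L := fun x hx => by
    have h1 := norm_lt_of_mem_ball hx
    have h2 := norm_nonneg (Λ y₀)
    linarith
  have hTL : ∀ y ∈ T, ‖y‖ ≤ L := fun y hy => by
    have h1 := norm_lt_of_mem_ball hy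
    have h2 := norm_nonneg (Λ x₀)
    linarith
  have hgap : ∀ x ∈ S, ∀ y ∈ T, 1 ≤ y.2 - x.2 := fun x hx y hy => by
    have h1 := (norm_snd_le (x - Λ x₀)).trans_lt (mem_ball_iff_norm.1 hx)
    have h2 := (norm_snd_le (y - Λ y₀)).trans_lt (mem_ball_iff_norm.1 hy)
    rw [Prod.snd_sub, Real.norm_eq_abs, abs_lt] at h1 h2
    rw [map_sub, Prod.snd_sub] at hΛz
    linarith [h1.2, h2.1]
  have hST : ∀ x ∈ S, ∀ y ∈ T, 1 ≤ |y.2 - x.2| := fun x hx y hy =>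
    (hgap x hx y hy).trans (le_abs_self _)
  have hL1 : 1 ≤ L := by have := norm_nonneg (Λ x₀); have := norm_nonneg (Λ y₀); linarith
  have hμS : (P.map Λ).restrict S Sᶜ = 0 := by
    rw [Measure.restrict_apply measurableSet_ball.compl, compl_inter_self, measure_empty]
  have hνT : (Q.map Λ).restrict T Tᶜ = 0 := by
    rw [Measure.restrict_apply measurableSet_ball.compl, compl_inter_self, measure_empty]
  have hμ := rieszEnergy_restrict_map_ne_top hΛm hΛP S
  have hν := rieszEnergy_restrict_map_ne_top hΛm hΛQ T
  have hthin : IsThin ((P.map Λ).restrict S) ((Q.map Λ).restrict T) u :=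
    IsThin.swap hL1 (NNReal.coe_pos.2 ht0) u.2 (by exact_mod_cast hut) hν measurableSet_ball
      measurableSet_ball hμS hνT hSL hTL hST (isThin_of_rieszEnergy_ne_top hL1 hks' hsk'.le
        (NNReal.coe_pos.2 ht0) htk' hμ hν measurableSet_ball measurableSet_ball hμS hνT hSL hTL hST)
  have hPS := ae_of_ae_map hΛm.aemeasurable
    (ae_imp_of_ae_restrict (Measure.ae_ae_of_ae_prod hthin))
  have hXS : P (Λ ⁻¹' S) ≠ 0 :=
    hPx _ (Λ.continuous.continuousAt.preimage_mem_nhds (ball_mem_nhds _ (by norm_num)))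
  have hYT : Q (Y ∩ Λ ⁻¹' T) ≠ 0 := by
    rw [inter_comm, measure_inter_conull hQY]
    exact hQy _ (Λ.continuous.continuousAt.preimage_mem_nhds (ball_mem_nhds _ (by norm_num)))
  obtain ⟨x, hxS, hxX, hx⟩ := ((frequently_ae_mem_iff.2 hXS).and_eventually
    (Filter.Eventually.and (show ∀ᵐ x ∂P, x ∈ X from hPX) hPS)).exists
  obtain ⟨A, hA, hAu⟩ := exists_le_dimH_lineSlope_image hΛm measurableSet_ball hYT (hx hxS)
  exact ⟨Λ, x, hxX, A, fun y hy => (hA hy).1,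
    fun y hy => one_pos.trans_le (hgap _ hxS _ (hA hy).2), hAu⟩

end Core

section RadialProjection

variable {d k : ℕ}

lemma dimH_radProj_image_le (x : Ed d) (Y : Set (Ed d)) :
    dimH (radProj x '' (Y \ {x})) ≤ dimH Y := by
  refine (dimH_image_le_of_locally_lipschitzOn fun y hy => ?_).trans (dimH_mono sdiff_subset)
  have hne : y - x ≠ 0 := sub_ne_zero.2 hy.2
  have h : ContDiffAt ℝ 1 (radProj x) y :=
    ((contDiffAt_id.sub contDiffAt_const).norm ℝ hne).inv (norm_ne_zero_iff.2 hne) |>.smul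
      (contDiffAt_id.sub contDiffAt_const)
  obtain ⟨K, t, ht, hK⟩ := h.exists_lipschitzOnWith
  exact ⟨K, t, mem_nhdsWithin_of_mem_nhds ht, hK⟩

lemma dimH_lineSlope_image_le (Λ : Ed d →L[ℝ] (Fin k → ℝ) × ℝ) (x : Ed d) {A : Set (Ed d)}
    (hA : ∀ y ∈ A, 0 < (Λ y).2 - (Λ x).2) :
    dimH ((fun y => lineSlope (Λ y) (Λ x)) '' A) ≤ dimH (radProj x '' A) := by
  set g : Ed d → Fin k → ℝ := fun v => (Λ v).2⁻¹ • (Λ v).1 with hg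
  have hcomp : ∀ y, 0 < (Λ y).2 - (Λ x).2 → 0 < ‖y - x‖ := fun y hy => by
    refine norm_pos_iff.2 fun h => ?_
    rw [sub_eq_zero.1 h, sub_self] at hy
    exact hy.false
  have himage : (fun y => lineSlope (Λ y) (Λ x)) '' A = g '' (radProj x '' A) := by
    rw [image_image]
    refine image_congr fun y hy => ?_
    have h0 := (hcomp y (hA y hy)).ne'
    simp only [hg, radProj, map_smul, map_sub, Prod.smul_fst, Prod.smul_snd, Prod.fst_sub,
      Prod.snd_sub, smul_eq_mul, mul_inv, inv_inv, smul_smul]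
    rw [lineSlope_comm, lineSlope, mul_right_comm, mul_inv_cancel₀ h0, one_mul]
  have hconv : Convex ℝ {v : Ed d | 0 < (Λ v).2} :=
    (convex_Ioi (0 : ℝ)).linear_preimage
      (((LinearMap.snd ℝ (Fin k → ℝ) ℝ).comp (Λ : Ed d →ₗ[ℝ] (Fin k → ℝ) × ℝ)))
  have hcd : ContDiffOn ℝ 1 g {v : Ed d | 0 < (Λ v).2} := by
    have h2 : ContDiff ℝ 1 fun v => Λ v := Λ.contDiff
    exact ContDiffOn.smul (h2.snd.contDiffOn.inv fun v hv => ne_of_gt hv) h2.fst.contDiffOn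
  rw [himage]
  refine hcd.dimH_image_le hconv ?_
  rintro _ ⟨y, hy, rfl⟩
  have h := mul_pos (inv_pos.2 (hcomp y (hA y hy))) (hA y hy)
  simpa only [mem_ofPred_eq, radProj, map_smul, map_sub, Prod.smul_snd, Prod.snd_sub,
    smul_eq_mul] using h

lemma exists_le_dimH_radProj_image {X Y : Set (Ed d)} (hX : MeasurableSet X)
    (hY : MeasurableSet Y) (hkX : (k : ℝ≥0∞) < dimH X) {u : ℝ≥0} (hu : 0 < u)
    (huY : u < dimH Y) (hYk : dimH Y ≤ k) :
    ∃ x ∈ X, (u : ℝ≥0∞) ≤ dimH (radProj x '' (Y \ {x})) := by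
  obtain ⟨t, hut, htY⟩ := ENNReal.lt_iff_exists_nnreal_btwn.1 huY
  obtain ⟨s, hks, hs⟩ := ENNReal.lt_iff_exists_nnreal_btwn.1
    (lt_min hkX (ENNReal.lt_add_right (ENNReal.natCast_ne_top k) one_ne_zero))
  obtain ⟨hsX, hsk⟩ := lt_min_iff.1 hs
  set e := EuclideanSpace.equiv (Fin d) ℝ
  have he : ∀ {Z : Set (Ed d)}, MeasurableSet Z → MeasurableSet (e '' Z) := fun {Z} hZ =>
    e.toHomeomorph.measurableEmbedding.measurableSet_image.2 hZ
  obtain ⟨Λ, _, ⟨x, hx, rfl⟩, A, hAY, hA, hAu⟩ := exists_le_dimH_lineSlope_image_of_lt_dimH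
    (k := k) (he hX) (he hY) (s := s) (t := t) (by exact_mod_cast hks) (by exact_mod_cast hsk)
    (by rwa [e.dimH_image]) hu (by exact_mod_cast hut) (by exact_mod_cast htY.trans_le hYk)
    (by rwa [e.dimH_image])
  refine ⟨x, hx, ?_⟩
  have h1 := dimH_lineSlope_image_le (Λ.comp (e : Ed d →L[ℝ] Fin d → ℝ)) x (A := e ⁻¹' A)
    fun y hy => hA _ hy
  have h2 : (fun y => lineSlope ((Λ.comp (e : Ed d →L[ℝ] Fin d → ℝ)) y)
      ((Λ.comp (e : Ed d →L[ℝ] Fin d → ℝ)) x)) '' (e ⁻¹' A) =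
        (fun y => lineSlope (Λ y) (Λ (e x))) '' A := by
    conv_rhs => rw [← image_preimage_eq A e.surjective, image_image]
    rfl
  rw [h2] at h1
  refine hAu.trans (h1.trans (dimH_mono (image_mono fun y hy => ⟨?_, ?_⟩)))
  · obtain ⟨y', hy', h⟩ := hAY hy
    exact e.injective h ▸ hy'
  · rintro rfl
    exact absurd (hA _ hy) (by simp)

end RadialProjection

/-- If `Y ⊆ ℝ^d` is Borel with `dim_H Y ∈ (k−1, k]` for some `k ∈ {1,…,d−1}`, and `X` is Borel
with `dim_H X > k`, then `sup_{x ∈ X} dim_H π_x(Y \ {x}) = dim_H Y`. -/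
theorem full_radial_projection_high_dim (d k : ℕ) (hk : 1 ≤ k) (hkd : k < d)
    (X Y : Set (Ed d)) (hXm : MeasurableSet X) (hYm : MeasurableSet Y)
    (hY1 : (k : ℝ≥0∞) - 1 < dimH Y) (hY2 : dimH Y ≤ (k : ℝ≥0∞))
    (hX : (k : ℝ≥0∞) < dimH X) :
    ⨆ x ∈ X, dimH (radProj x '' (Y \ {x})) = dimH Y := by
  refine le_antisymm (iSup₂_le fun x _ => dimH_radProj_image_le x Y)
    (ENNReal.le_of_forall_nnreal_lt fun u hu => ?_)
  rcases eq_or_ne u 0 with rfl | hu0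
  · simp
  obtain ⟨x, hx, h⟩ := exists_le_dimH_radProj_image hXm hYm hX (pos_iff_ne_zero.2 hu0) hu hY2
  exact le_iSup₂_of_le x hx h
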